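/- arXiv:1611.02384 — 2 statements merged into one kernel-verified Lean document; each statement's English description precedes it below -/
import Mathlib

section
/- Let Ω ⊆ ℝ^{m+1} (m ≥ 1) be a domain, Qφ = a^{ij}(x,Dφ)D_{ij}φ + b(x,φ,Dφ) with C^∞ coefficients, and φ, ψ ∈ C^∞(Ω) with Qφ ≥ Qψ in Ω. Assume (1) the matrix (a^{ij}(x,p)) is symmetric and nonnegative definite for all (x,p); (2) ∂b/∂z ≤ 0; and (3′) the matrix ã^{ij}(x) := a^{ij}(x, Dφ(x)) has constant rank r̃ on Ω. Then locally there exist C^∞ vector fields X₁,...,X_r and Y such that ã^{ij}(x)∂_i∂_j = Σ_{k=1}^r X_k² + Y as differential operators, and for any such decomposition and any integral curve Γ of a vector field Z ∈ £(X₁,...,X_r), if φ − ψ attains a nonnegative maximum over Ω at some point of Γ, then φ − ψ equals that maximum at every point of Γ. -/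
open Set Finset

noncomputable section

/-- The `k`-th standard basis vector of `ℝ^N` (zero if `k ≥ N`). -/
def ee (N k : ℕ) : Fin N → ℝ := fun i => if (i : ℕ) = k then 1 else 0

/-- The `k`-th partial derivative. -/
def pd (N k : ℕ) (f : (Fin N → ℝ) → ℝ) (x : Fin N → ℝ) : ℝ := fderiv ℝ f x (ee N k)

/-- The gradient `Dφ = (∂₁φ,...,∂_Nφ)`. -/
def grad (N : ℕ) (f : (Fin N → ℝ) → ℝ) (x : Fin N → ℝ) : Fin N → ℝ :=
  fun i => pd N i f x

/-- Derivative of `f` along the vector field `X`. -/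
def vApp {N : ℕ} (X : (Fin N → ℝ) → (Fin N → ℝ)) (f : (Fin N → ℝ) → ℝ) (x : Fin N → ℝ) : ℝ :=
  fderiv ℝ f x (X x)

/-- Lie bracket of vector fields. -/
def lieBr {N : ℕ} (X Y : (Fin N → ℝ) → (Fin N → ℝ)) : (Fin N → ℝ) → (Fin N → ℝ) :=
  fun x => fderiv ℝ Y x (X x) - fderiv ℝ X x (Y x)

/-- `£(S)`: the smallest `C^∞`-module of vector fields containing `S`
and closed under Lie bracket. -/
inductive LieSpan {N : ℕ} (Ω : Set (Fin N → ℝ)) (S : Set ((Fin N → ℝ) → (Fin N → ℝ))) :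
    ((Fin N → ℝ) → (Fin N → ℝ)) → Prop
  | base : ∀ X ∈ S, LieSpan Ω S X
  | smul : ∀ (f : (Fin N → ℝ) → ℝ) (X : (Fin N → ℝ) → (Fin N → ℝ)),
      ContDiffOn ℝ (⊤ : ℕ∞) f Ω → LieSpan Ω S X → LieSpan Ω S (fun x => f x • X x)
  | add : ∀ X Y, LieSpan Ω S X → LieSpan Ω S Y → LieSpan Ω S (fun x => X x + Y x)
  | bracket : ∀ X Y, LieSpan Ω S X → LieSpan Ω S Y → LieSpan Ω S (lieBr X Y)

/-- The quasilinear operator `Qφ = a^{ij}(x,Dφ)D_{ij}φ + b(x,φ,Dφ)`. -/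
def Qop (N : ℕ) (a : (Fin N → ℝ) → (Fin N → ℝ) → Matrix (Fin N) (Fin N) ℝ)
    (b : (Fin N → ℝ) → ℝ → (Fin N → ℝ) → ℝ)
    (f : (Fin N → ℝ) → ℝ) (x : Fin N → ℝ) : ℝ :=
  (∑ i, ∑ j, a x (grad N f x) i j * pd N i (pd N j f) x) + b x (f x) (grad N f x)

section

theorem vApp_vApp_eq {N : ℕ} {X : (Fin N → ℝ) → (Fin N → ℝ)} {f : (Fin N → ℝ) → ℝ}
    {x : Fin N → ℝ} (hX : DifferentiableAt ℝ X x) (hf : ContDiffAt ℝ 2 f x) :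
    vApp X (vApp X f) x =
      fderiv ℝ (fderiv ℝ f) x (X x) (X x) + fderiv ℝ f x (fderiv ℝ X x (X x)) := by
  have hf' : DifferentiableAt ℝ (fderiv ℝ f) x :=
    (hf.fderiv_right (m := 1) (by norm_num)).differentiableAt one_ne_zero
  have h : vApp X f = fun y => fderiv ℝ f y (X y) := rfl
  rw [h, vApp, fderiv_clm_apply hf' hX]
  simp [add_comm]

theorem pd_pd_eq {N i j : ℕ} {f : (Fin N → ℝ) → ℝ} {x : Fin N → ℝ} (hf : ContDiffAt ℝ 2 f x) :
    pd N i (pd N j f) x = fderiv ℝ (fderiv ℝ f) x (ee N i) (ee N j) := by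
  have hf' : DifferentiableAt ℝ (fderiv ℝ f) x :=
    (hf.fderiv_right (m := 1) (by norm_num)).differentiableAt one_ne_zero
  have h : pd N j f = fun y => fderiv ℝ f y (ee N j) := rfl
  rw [h, pd, fderiv_clm_apply hf' (differentiableAt_const _)]
  simp

theorem ee_eq_single {N : ℕ} (i : Fin N) : ee N i = Pi.single i 1 := by
  ext j
  simp [ee, Pi.single_apply, Fin.ext_iff]

theorem sum_smul_ee {N : ℕ} (v : Fin N → ℝ) : ∑ i : Fin N, v i • ee N i = v := by
  simp_rw [ee_eq_single]
  ext j
  simp [Finset.sum_apply, Pi.single_apply]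

theorem sum_mul_bilin_ee {N r : ℕ} (B : (Fin N → ℝ) →L[ℝ] (Fin N → ℝ) →L[ℝ] ℝ)
    (A : Fin N → Fin N → ℝ) (V : Fin r → Fin N → ℝ) (h : ∀ i j, A i j = ∑ k, V k i * V k j) :
    ∑ i : Fin N, ∑ j : Fin N, A i j * B (ee N i) (ee N j) = ∑ k, B (V k) (V k) := by
  have h1 : ∀ v : Fin N → ℝ, B v v = ∑ i : Fin N, ∑ j : Fin N, v i * v j * B (ee N i) (ee N j) := by
    intro v
    conv_lhs => rw [← sum_smul_ee v]
    simp only [map_sum, map_smul, _root_.sum_apply, _root_.smul_apply,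
      smul_eq_mul, Finset.mul_sum]
    rw [Finset.sum_comm]
    refine Finset.sum_congr rfl fun i _ => Finset.sum_congr rfl fun j _ => ?_
    ring
  simp_rw [h1, h, Finset.sum_mul]
  conv_rhs => rw [Finset.sum_comm]
  refine Finset.sum_congr rfl fun i _ => ?_
  rw [Finset.sum_comm]

open Matrix in
theorem Matrix.PosSemidef.exists_diag_pos {N : ℕ} {A : Matrix (Fin N) (Fin N) ℝ}
    (hA : A.PosSemidef) (h0 : A ≠ 0) : ∃ i, 0 < A i i := by
  by_contra! h
  apply h0
  rw [← hA.trace_eq_zero_iff]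
  refine le_antisymm (Finset.sum_nonpos fun i _ => h i) hA.trace_nonneg

open Matrix in
theorem Matrix.schur_mulVec {N : ℕ} (A : Matrix (Fin N) (Fin N) ℝ) (i : Fin N) (v : Fin N → ℝ) :
    (A - (A i i)⁻¹ • vecMulVec (A i) (A i)) *ᵥ v = A *ᵥ v - ((A i i)⁻¹ * (A i ⬝ᵥ v)) • A i := by
  rw [sub_mulVec, smul_mulVec, vecMulVec_mulVec]
  ext k
  simp only [Pi.sub_apply, Pi.smul_apply, smul_eq_mul, op_smul_eq_mul]
  ring

open Matrix in
theorem Matrix.PosSemidef.mulVec_single_one_real {N : ℕ} {A : Matrix (Fin N) (Fin N) ℝ}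
    (hA : A.PosSemidef) (i : Fin N) : A *ᵥ Pi.single i 1 = A i := by
  ext k
  simpa using (hA.1.apply i k)

open Matrix in
theorem Matrix.PosSemidef.schur_posSemidef {N : ℕ} {A : Matrix (Fin N) (Fin N) ℝ}
    (hA : A.PosSemidef) {i : Fin N} (hi : 0 < A i i) :
    (A - (A i i)⁻¹ • vecMulVec (A i) (A i)).PosSemidef := by
  have hs : ∀ k l, A k l = A l k := fun k l => by simpa using (hA.1.apply k l).symm
  refine Matrix.PosSemidef.of_dotProduct_mulVec_nonneg ?_ ?_
  · ext k l
    simp [vecMulVec_apply, hs k l, mul_comm]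
  · intro v
    have h := hA.dotProduct_mulVec_nonneg (v - ((A i i)⁻¹ * (A i ⬝ᵥ v)) • Pi.single i 1)
    rw [schur_mulVec]
    rw [mulVec_sub, mulVec_smul, hA.mulVec_single_one_real] at h
    have h3 : (Pi.single i 1 : Fin N → ℝ) ⬝ᵥ (A *ᵥ v) = A i ⬝ᵥ v := by
      simp [mulVec]
    simp only [star_trivial, dotProduct_sub, sub_dotProduct, smul_dotProduct, dotProduct_smul,
      smul_eq_mul, h3, dotProduct_comm v (A i), single_dotProduct, one_mul] at h ⊢
    have h4 : (A i i)⁻¹ * A i i = 1 := inv_mul_cancel₀ hi.ne'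
    linear_combination h + ((A i i)⁻¹ * (A i ⬝ᵥ v) ^ 2) * h4

open Matrix in
theorem Matrix.PosSemidef.schur_rank {N n : ℕ} {A : Matrix (Fin N) (Fin N) ℝ}
    (hA : A.PosSemidef) {i : Fin N} (hi : 0 < A i i) (hr : A.rank = n + 1) :
    (A - (A i i)⁻¹ • vecMulVec (A i) (A i)).rank = n := by
  set A' := A - (A i i)⁻¹ • vecMulVec (A i) (A i) with hA'
  have hmem : A i ∈ LinearMap.range A.mulVecLin :=
    ⟨Pi.single i 1, by rw [mulVecLin_apply, hA.mulVec_single_one_real]⟩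
  have hlt : LinearMap.range A'.mulVecLin < LinearMap.range A.mulVecLin := by
    refine SetLike.lt_iff_le_and_exists.2 ⟨?_, A i, hmem, ?_⟩
    · rintro _ ⟨v, rfl⟩
      rw [mulVecLin_apply, hA', schur_mulVec]
      exact Submodule.sub_mem _ ⟨v, rfl⟩ (Submodule.smul_mem _ _ hmem)
    · rintro ⟨v, hv⟩
      rw [mulVecLin_apply, hA', schur_mulVec] at hv
      have h := congrFun hv i
      have h2 : (A *ᵥ v) i = A i ⬝ᵥ v := rfl
      simp only [Pi.sub_apply, Pi.smul_apply, smul_eq_mul, h2] at h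
      field_simp at h
      linarith
  have hle : LinearMap.range A.mulVecLin ≤
      LinearMap.range A'.mulVecLin ⊔ Submodule.span ℝ {A i} := by
    rintro _ ⟨v, rfl⟩
    have h : A.mulVecLin v = A'.mulVecLin v + ((A i i)⁻¹ * (A i ⬝ᵥ v)) • A i := by
      rw [mulVecLin_apply, mulVecLin_apply, hA', schur_mulVec, sub_add_cancel]
    rw [h]
    exact Submodule.add_mem_sup ⟨v, rfl⟩
      (Submodule.smul_mem _ _ (Submodule.mem_span_singleton_self _))
  have h1 := Submodule.finrank_lt_finrank_of_lt hlt
  have h2 := (Submodule.finrank_mono hle).trans (Submodule.finrank_add_le_finrank_add_finrank _ _)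
  have h3 := finrank_span_le_card (R := ℝ) ({A i} : Set (Fin N → ℝ))
  simp only [Set.toFinset_singleton, Finset.card_singleton] at h3
  unfold Matrix.rank at hr ⊢
  omega

open Matrix in
theorem exists_contDiffOn_factor {N : ℕ} (n : ℕ) (x₀ : Fin N → ℝ) :
    ∀ (U : Set (Fin N → ℝ)) (A : (Fin N → ℝ) → Matrix (Fin N) (Fin N) ℝ), IsOpen U → x₀ ∈ U →
    (∀ i j, ContDiffOn ℝ (⊤ : ℕ∞) (fun x => A x i j) U) → (∀ x ∈ U, (A x).PosSemidef) →
    (∀ x ∈ U, (A x).rank = n) →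
    ∃ V : Set (Fin N → ℝ), IsOpen V ∧ x₀ ∈ V ∧ V ⊆ U ∧
      ∃ X : Fin n → (Fin N → ℝ) → (Fin N → ℝ), (∀ k, ContDiffOn ℝ (⊤ : ℕ∞) (X k) V) ∧
        ∀ x ∈ V, ∀ i j, A x i j = ∑ k, X k x i * X k x j := by
  induction n with
  | zero =>
    intro U A hU hx hA hp hr
    refine ⟨U, hU, hx, Subset.rfl, Fin.elim0, fun k => k.elim0, fun x hx i j => ?_⟩
    have h := hr x hx
    have : A x = 0 := by
      rw [Matrix.rank, Submodule.finrank_eq_zero, LinearMap.range_eq_bot] at h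
      ext k l
      simpa using congrFun (LinearMap.congr_fun h (Pi.single l 1)) k
    simp [this]
  | succ n ih =>
    intro U A hU hx hA hp hr
    have h0 : A x₀ ≠ 0 := by
      intro h
      have := hr x₀ hx
      simp [h] at this
    obtain ⟨i, hi⟩ := (hp x₀ hx).exists_diag_pos h0
    have hW : IsOpen (U ∩ (fun x => A x i i) ⁻¹' Ioi 0) :=
      (hA i i).continuousOn.isOpen_inter_preimage hU isOpen_Ioi
    set W := U ∩ (fun x => A x i i) ⁻¹' Ioi 0 with hWdef
    have hWpos : ∀ x ∈ W, 0 < A x i i := fun x hx => hx.2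
    have hAW : ∀ k l, ContDiffOn ℝ (⊤ : ℕ∞) (fun x => A x k l) W :=
      fun k l => (hA k l).mono inter_subset_left
    obtain ⟨V, hV, hxV, hVW, X, hX, hAX⟩ := ih W
      (fun x => A x - (A x i i)⁻¹ • vecMulVec (A x i) (A x i)) hW ⟨hx, hi⟩
      (fun k l => by
        simp only [Matrix.sub_apply, Matrix.smul_apply, vecMulVec_apply, smul_eq_mul]
        exact (hAW k l).sub (((hAW i i).inv fun x hx => (hWpos x hx).ne').mul
          ((hAW i k).mul (hAW i l))))
      (fun x hx => (hp x hx.1).schur_posSemidef hx.2)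
      (fun x hx => (hp x hx.1).schur_rank hx.2 (hr x hx.1))
    refine ⟨V, hV, hxV, hVW.trans inter_subset_left,
      Fin.cons (fun x => (√(A x i i))⁻¹ • A x i) X, ?_, ?_⟩
    · intro k
      refine Fin.cases ?_ (fun k => ?_) k
      · simp only [Fin.cons_zero]
        refine contDiffOn_pi.2 fun l => ?_
        simp only [Pi.smul_apply, smul_eq_mul]
        refine ContDiffOn.mul (ContDiffOn.inv (ContDiffOn.sqrt ((hAW i i).mono hVW) ?_) ?_)
          ((hAW i l).mono hVW)
        · exact fun x hx => (hWpos x (hVW hx)).ne'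
        · exact fun x hx => (Real.sqrt_pos.2 (hWpos x (hVW hx))).ne'
      · simpa using hX k
    · intro x hx k l
      have h := hAX x hx k l
      simp only [Matrix.sub_apply, Matrix.smul_apply, vecMulVec_apply, smul_eq_mul] at h
      rw [Fin.sum_univ_succ]
      simp only [Fin.cons_zero, Fin.cons_succ, ← h, Pi.smul_apply, smul_eq_mul]
      have h1 := hWpos x (hVW hx)
      have h2 : (√(A x i i))⁻¹ * (√(A x i i))⁻¹ = (A x i i)⁻¹ := by
        rw [← mul_inv, Real.mul_self_sqrt h1.le]
      linear_combination (-(A x i k * A x i l)) * h2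

/-- A smooth positive semidefinite matrix field of constant rank is locally the principal symbol of
a sum of squares of smooth vector fields. -/
theorem exists_sum_sq_decomposition {N n : ℕ} {Ω : Set (Fin N → ℝ)} (hΩ : IsOpen Ω)
    {A : (Fin N → ℝ) → Matrix (Fin N) (Fin N) ℝ}
    (hA : ∀ i j, ContDiffOn ℝ (⊤ : ℕ∞) (fun x => A x i j) Ω) (hp : ∀ x ∈ Ω, (A x).PosSemidef)
    (hr : ∀ x ∈ Ω, (A x).rank = n) {x₀ : Fin N → ℝ} (hx₀ : x₀ ∈ Ω) :
    ∃ U : Set (Fin N → ℝ), IsOpen U ∧ x₀ ∈ U ∧ U ⊆ Ω ∧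
      ∃ (r : ℕ) (X : Fin r → ((Fin N → ℝ) → (Fin N → ℝ))) (Y : (Fin N → ℝ) → (Fin N → ℝ)),
        (∀ k, ContDiffOn ℝ (⊤ : ℕ∞) (X k) U) ∧ ContDiffOn ℝ (⊤ : ℕ∞) Y U ∧
        (∀ f : (Fin N → ℝ) → ℝ, ContDiff ℝ 2 f → ∀ x ∈ U,
          (∑ i, ∑ j, A x i j * pd N i (pd N j f) x)
            = (∑ k, vApp (X k) (vApp (X k) f) x) + vApp Y f x) := by
  obtain ⟨V, hV, hxV, hVΩ, X, hX, hAX⟩ := exists_contDiffOn_factor n x₀ Ω A hΩ hx₀ hA hp hr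
  refine ⟨V, hV, hxV, hVΩ, n, X, fun x => -∑ k, fderiv ℝ (X k) x (X k x), hX, ?_, ?_⟩
  · refine ContDiffOn.neg (ContDiffOn.sum fun k _ => ?_)
    exact ((hX k).fderiv_of_isOpen hV (by simp)).clm_apply (hX k)
  · intro f hf x hx
    simp_rw [pd_pd_eq hf.contDiffAt]
    rw [sum_mul_bilin_ee _ (A x) (fun k => X k x) (hAX x hx)]
    have h : ∀ k, vApp (X k) (vApp (X k) f) x = _ := fun k =>
      vApp_vApp_eq (((hX k).differentiableOn (by simp)).differentiableAt (hV.mem_nhds hx))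
        hf.contDiffAt
    simp_rw [h]
    simp [vApp, Finset.sum_add_distrib, map_sum]

/-- The principal symbol of a sum-of-squares decomposition is `∑ k, X k ⊗ X k`. -/
theorem coeff_eq_of_decomposition {N r : ℕ} {A : Matrix (Fin N) (Fin N) ℝ}
    (hA : ∀ i j, A i j = A j i) {X : Fin r → ((Fin N → ℝ) → (Fin N → ℝ))}
    {Y : (Fin N → ℝ) → (Fin N → ℝ)} {x : Fin N → ℝ} (hX : ∀ k, DifferentiableAt ℝ (X k) x)
    (h : ∀ f : (Fin N → ℝ) → ℝ, ContDiff ℝ 2 f →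
      (∑ i, ∑ j, A i j * pd N i (pd N j f) x)
        = (∑ k, vApp (X k) (vApp (X k) f) x) + vApp Y f x) (i j : Fin N) :
    A i j = ∑ k, X k x i * X k x j := by
  let p : Fin N → ((Fin N → ℝ) →L[ℝ] ℝ) := fun i => ContinuousLinearMap.proj i
  let f : (Fin N → ℝ) → ℝ := fun y => (y i - x i) * (y j - x j)
  have hf : ContDiff ℝ 2 f := by fun_prop
  have h1 : ∀ y, HasFDerivAt f ((y i - x i) • p j + (y j - x j) • p i) y := fun y =>
    (((p i).hasFDerivAt (x := y)).sub_const (x i)).mul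
      (((p j).hasFDerivAt (x := y)).sub_const (x j))
  have h2 : fderiv ℝ f = fun y => (y i - x i) • p j + (y j - x j) • p i :=
    funext fun y => (h1 y).fderiv
  have h3 : HasFDerivAt (fderiv ℝ f) ((p i).smulRight (p j) + (p j).smulRight (p i)) x := by
    rw [h2]
    exact ((((p i).hasFDerivAt (x := x)).sub_const (x i)).smul_const (p j)).add
      ((((p j).hasFDerivAt (x := x)).sub_const (x j)).smul_const (p i))
  have h4 := h f hf
  have h5 : fderiv ℝ f x = 0 := by rw [h2]; simp
  simp_rw [pd_pd_eq hf.contDiffAt, fun k => vApp_vApp_eq (hX k) hf.contDiffAt, vApp, h5,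
    h3.fderiv] at h4
  simp only [_root_.add_apply, ContinuousLinearMap.smulRight_apply, _root_.smul_apply] at h4
  simp [p, ee_eq_single, Pi.single_apply, mul_add, Finset.sum_add_distrib, hA j i,
    mul_comm (X _ x j)] at h4
  linarith

end

section

open Filter Topology NNReal Metric Asymptotics

/-- The field `X` is tangent to the set `C` inside `U`: at every point of `U ∩ C` it is orthogonal
to all proximal normals of `C`. -/
def TangentTo {N : ℕ} (U C : Set (Fin N → ℝ)) (X : (Fin N → ℝ) → (Fin N → ℝ)) : Prop :=
  ∀ x ∈ U, x ∈ C → ∀ ν : Fin N → ℝ,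
    (∀ᶠ y in 𝓝 x, y ∈ C → ν ⬝ᵥ (y - x) ≤ (y - x) ⬝ᵥ (y - x)) → X x ⬝ᵥ ν = 0

theorem dotProduct_self_nonneg_real {N : ℕ} (v : Fin N → ℝ) : 0 ≤ v ⬝ᵥ v :=
  Finset.sum_nonneg fun i _ => mul_self_nonneg (v i)

theorem norm_sq_le_dotProduct_self {N : ℕ} (v : Fin N → ℝ) : ‖v‖ ^ 2 ≤ v ⬝ᵥ v := by
  have h0 := dotProduct_self_nonneg_real v
  rw [← Real.le_sqrt (norm_nonneg v) h0]
  refine (pi_norm_le_iff_of_nonneg (Real.sqrt_nonneg _)).2 fun i => Real.abs_le_sqrt ?_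
  rw [sq]
  exact Finset.single_le_sum (f := fun i => v i * v i) (fun j _ => mul_self_nonneg (v j))
    (Finset.mem_univ i)

theorem abs_dotProduct_le {N : ℕ} (u v : Fin N → ℝ) : |u ⬝ᵥ v| ≤ N * (‖u‖ * ‖v‖) := by
  refine (Finset.abs_sum_le_sum_abs _ _).trans ?_
  refine (Finset.sum_le_card_nsmul _ _ (‖u‖ * ‖v‖) fun i _ => ?_).trans (by simp)
  rw [abs_mul]
  exact mul_le_mul (norm_le_pi_norm u i) (norm_le_pi_norm v i) (abs_nonneg _) (norm_nonneg _)

theorem dist_toLp_sq {N : ℕ} (u v : Fin N → ℝ) :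
    dist (WithLp.toLp 2 u) (WithLp.toLp 2 v) ^ 2 = (u - v) ⬝ᵥ (u - v) := by
  rw [EuclideanSpace.dist_eq, Real.sq_sqrt (Finset.sum_nonneg fun i _ => sq_nonneg _)]
  simp [dotProduct, Real.dist_eq, sq]

theorem hasDerivAt_dotProduct_self_sub {N : ℕ} {γ : ℝ → Fin N → ℝ} {v : Fin N → ℝ} {t : ℝ}
    (h : HasDerivAt γ v t) (z : Fin N → ℝ) :
    HasDerivAt (fun s => (γ s - z) ⬝ᵥ (γ s - z)) (2 * (v ⬝ᵥ (γ t - z))) t := by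
  have h1 := hasDerivAt_pi.1 h
  have h2 : HasDerivAt (fun s => ∑ i, (γ s i - z i) * (γ s i - z i))
      (∑ i, (v i * (γ t i - z i) + (γ t i - z i) * v i)) t :=
    HasDerivAt.fun_sum fun i _ => ((h1 i).sub_const (z i)).mul ((h1 i).sub_const (z i))
  have e : 2 * (v ⬝ᵥ (γ t - z)) = ∑ i, (v i * (γ t i - z i) + (γ t i - z i) * v i) := by
    rw [dotProduct, Finset.mul_sum]
    exact Finset.sum_congr rfl fun i _ => by simp only [Pi.sub_apply]; ring
  rw [e]
  exact h2

/-- Bony's invariance theorem: integral curves of a Lipschitz field tangent to a closed set do not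
leave that set. -/
theorem TangentTo.mem_of_integralCurve {N : ℕ} {U C : Set (Fin N → ℝ)} (hC : IsClosed C)
    {X : (Fin N → ℝ) → (Fin N → ℝ)} (hT : TangentTo U C X) {x₀ : Fin N → ℝ} {ρ : ℝ} (hρ : 0 < ρ)
    (hU : closedBall x₀ ρ ⊆ U) {K : ℝ≥0} (hL : LipschitzOnWith K X (closedBall x₀ ρ))
    {γ : ℝ → Fin N → ℝ} {a b : ℝ} (hγ : ∀ t ∈ Icc a b, HasDerivAt γ (X (γ t)) t)
    (hb : ∀ t ∈ Icc a b, γ t ∈ closedBall x₀ (ρ / (2 * N + 2))) (ha : γ a ∈ C) :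
    ∀ t ∈ Icc a b, γ t ∈ C := by
  intro t₁ ht₁
  have haI : a ∈ Icc a b := ⟨le_rfl, ht₁.1.trans ht₁.2⟩
  set σ := ρ / (2 * N + 2) with hσ
  have hN : (0 : ℝ) ≤ N := Nat.cast_nonneg N
  have hσ0 : 0 < σ := by positivity
  have hσρ : σ * (2 * N + 2) = ρ := by rw [hσ]; field_simp
  have hσle : σ ≤ ρ := by nlinarith
  set S := C ∩ closedBall x₀ ρ with hS
  have hScomp : IsCompact S := (isCompact_closedBall x₀ ρ).inter_left hC
  have hcont : Continuous (fun v : Fin N → ℝ => WithLp.toLp 2 v) := PiLp.continuous_toLp 2 _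
  have hS' : IsCompact ((fun v : Fin N → ℝ => WithLp.toLp 2 v) '' S) := hScomp.image hcont
  set S' := (fun v : Fin N → ℝ => WithLp.toLp 2 v) '' S with hSdef
  have haS : γ a ∈ S := ⟨ha, closedBall_subset_closedBall hσle (hb a haI)⟩
  have hne : S'.Nonempty := ⟨_, Set.mem_image_of_mem _ haS⟩
  set δ : ℝ → ℝ := fun t => infDist (WithLp.toLp 2 (γ t)) S' ^ 2 with hδ
  have hδle : ∀ t, ∀ y ∈ S, δ t ≤ (γ t - y) ⬝ᵥ (γ t - y) := by
    intro t y hy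
    rw [← dist_toLp_sq]
    exact pow_le_pow_left₀ infDist_nonneg (infDist_le_dist_of_mem (Set.mem_image_of_mem _ hy)) 2
  have hδmin : ∀ t, ∃ z ∈ S, δ t = (γ t - z) ⬝ᵥ (γ t - z) := by
    intro t
    obtain ⟨_, ⟨z, hz, rfl⟩, h⟩ := hS'.exists_infDist_eq_dist hne (WithLp.toLp 2 (γ t))
    exact ⟨z, hz, by rw [hδ, ← dist_toLp_sq]; simp only [h]⟩
  have hδa : δ a = 0 := by
    refine le_antisymm ?_ (sq_nonneg _)
    simpa using hδle a _ haS
  have hγc : ContinuousOn γ (Icc a b) := fun t ht => (hγ t ht).continuousAt.continuousWithinAt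
  have hδc : ContinuousOn δ (Icc a b) :=
    ((continuous_infDist_pt S').comp_continuousOn (hcont.comp_continuousOn hγc)).pow 2
  have key := le_gronwallBound_of_liminf_deriv_right_le (f := δ) (f' := fun t => (2 * N * K) * δ t)
    (δ := 0) (K := 2 * N * K) (ε := 0) hδc ?_ hδa.le (fun t _ => by simp) t₁ ht₁
  · rw [gronwallBound_ε0_δ0] at key
    have h0 : infDist (WithLp.toLp 2 (γ t₁)) S' = 0 := by
      have := le_antisymm key (sq_nonneg _)
      simpa [hδ] using this
    obtain ⟨z, hz, h⟩ := (hS'.isClosed.mem_iff_infDist_zero hne).2 h0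
    have : z = γ t₁ := by simpa using h
    exact this ▸ hz.1
  · intro t ht r hr
    have htI : t ∈ Icc a b := Ico_subset_Icc_self ht
    obtain ⟨z, hz, hδz⟩ := hδmin t
    set ν := γ t - z with hν
    have hνnorm : ‖ν‖ ≤ 2 * N * σ := by
      have h1 : ‖γ t - γ a‖ ≤ 2 * σ := by
        have h1 := mem_closedBall_iff_norm.1 (hb t htI)
        have h2 := mem_closedBall_iff_norm.1 (hb a haI)
        have h3 : γ t - γ a = (γ t - x₀) - (γ a - x₀) := by abel
        rw [h3]
        exact (norm_sub_le _ _).trans (by linarith)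
      have h2 : ‖ν‖ ^ 2 ≤ N * (2 * σ) ^ 2 := by
        refine (norm_sq_le_dotProduct_self ν).trans ?_
        rw [← hδz]
        refine (hδle t _ haS).trans ((le_abs_self _).trans ((abs_dotProduct_le _ _).trans ?_))
        rw [sq]
        gcongr
      have h3 : (N : ℝ) ≤ N ^ 2 := by exact_mod_cast Nat.le_self_pow two_ne_zero N
      refine abs_le_of_sq_le_sq' ?_ (by positivity) |>.2
      nlinarith [sq_nonneg σ]
    have hzball : z ∈ ball x₀ ρ := by
      rw [mem_ball_iff_norm]
      have h1 := mem_closedBall_iff_norm.1 (hb t htI)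
      have h3 : z - x₀ = (γ t - x₀) - ν := by rw [hν]; abel
      rw [h3]
      refine (norm_sub_le _ _).trans_lt ?_
      nlinarith
    have hnormal : X z ⬝ᵥ ν = 0 := by
      refine hT z (hU hz.2) hz.1 ν ?_
      filter_upwards [isOpen_ball.mem_nhds hzball] with y hy hyC
      have h1 := hδle t y ⟨hyC, ball_subset_closedBall hy⟩
      have h2 : γ t - y = ν - (y - z) := by rw [hν]; abel
      rw [hδz, h2] at h1
      simp only [sub_dotProduct ν, dotProduct_sub _ ν] at h1
      have h3 := dotProduct_comm (y - z) ν
      have h4 := dotProduct_self_nonneg_real (y - z)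
      linarith
    have hder : 2 * (X (γ t) ⬝ᵥ ν) ≤ 2 * N * K * δ t := by
      have h1 : X (γ t) ⬝ᵥ ν = (X (γ t) - X z) ⬝ᵥ ν := by rw [sub_dotProduct, hnormal, sub_zero]
      have h2 : ‖X (γ t) - X z‖ ≤ K * ‖ν‖ :=
        hL.norm_sub_le (closedBall_subset_closedBall hσle (hb t htI)) hz.2
      have h3 := norm_sq_le_dotProduct_self ν
      rw [← hδz] at h3
      rw [h1]
      calc 2 * ((X (γ t) - X z) ⬝ᵥ ν) ≤ 2 * (N * (‖X (γ t) - X z‖ * ‖ν‖)) := by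
            gcongr
            exact (le_abs_self _).trans (abs_dotProduct_le _ _)
        _ ≤ 2 * (N * (K * ‖ν‖ * ‖ν‖)) := by gcongr
        _ = 2 * N * K * ‖ν‖ ^ 2 := by ring
        _ ≤ _ := by gcongr
    have hslope := (hasDerivAt_iff_tendsto_slope.1 (hasDerivAt_dotProduct_self_sub (hγ t htI) z))
    have hev :=
      (hslope.mono_left (nhdsWithin_mono t fun s (hs : t < s) => hs.ne')).eventually_lt_const
      (hder.trans_lt hr)
    refine Eventually.frequently ?_
    filter_upwards [hev, self_mem_nhdsWithin] with s hs hts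
    rw [slope_def_field, div_eq_inv_mul] at hs
    refine lt_of_le_of_lt ?_ hs
    have : 0 < s - t := sub_pos.2 hts
    have h1 := hδle s z hz
    rw [hδz]
    gcongr

theorem ContDiffAt.exists_local_flow {N : ℕ} {X : (Fin N → ℝ) → (Fin N → ℝ)} {x : Fin N → ℝ}
    (hX : ContDiffAt ℝ 1 X x) :
    ∃ α : (Fin N → ℝ) → ℝ → (Fin N → ℝ), ∀ R > (0 : ℝ), ∃ η > (0 : ℝ), ∀ y ∈ closedBall x η,
      α y 0 = y ∧ ∀ t ∈ Icc (0 : ℝ) η, HasDerivAt (α y) (X (α y t)) t ∧ α y t ∈ closedBall x R := by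
  obtain ⟨ε, hε, a, r, _, _, hr, hpl⟩ := IsPicardLindelof.of_contDiffAt_one hX
  obtain ⟨α, hα, hαc⟩ := (hpl 0).exists_forall_mem_closedBall_eq_hasDerivWithinAt_continuousOn
  simp only [zero_sub, zero_add] at hα hαc
  refine ⟨fun y t => α (y, t), fun R hR => ?_⟩
  have hr' : (0 : ℝ) < r := hr
  have hmem : closedBall x (r : ℝ) ×ˢ Icc (-ε) ε ∈ 𝓝 (x, (0 : ℝ)) :=
    prod_mem_nhds (closedBall_mem_nhds x hr') (Icc_mem_nhds (by linarith) hε)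
  have hcont : ContinuousAt α (x, 0) := hαc.continuousAt hmem
  have hx0 : α (x, 0) = x := (hα x (mem_closedBall_self hr'.le)).1
  have hpre : α ⁻¹' closedBall x R ∈ 𝓝 (x, (0 : ℝ)) :=
    hcont (by rw [hx0]; exact closedBall_mem_nhds x hR)
  obtain ⟨d, hd, hball⟩ := nhds_basis_closedBall.mem_iff.1 hpre
  refine ⟨min (min d r) (ε / 2), by positivity, fun y hy => ?_⟩
  have hyr : y ∈ closedBall x (r : ℝ) :=
    closedBall_subset_closedBall ((min_le_left _ _).trans (min_le_right _ _)) hy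
  have hyd : y ∈ closedBall x d :=
    closedBall_subset_closedBall ((min_le_left _ _).trans (min_le_left _ _)) hy
  refine ⟨(hα y hyr).1, fun t ht => ⟨?_, ?_⟩⟩
  · have h1 : t ≤ ε / 2 := ht.2.trans (min_le_right _ _)
    exact ((hα y hyr).2 t ⟨by linarith [ht.1], by linarith⟩).hasDerivAt
      (Icc_mem_nhds (by linarith [ht.1]) (by linarith))
  · have h1 : t ≤ d := ht.2.trans ((min_le_left _ _).trans (min_le_left _ _))
    refine hball (?_ : (y, t) ∈ closedBall (x, (0 : ℝ)) d)
    rw [← closedBall_prod_same]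
    exact ⟨hyd, by rw [mem_closedBall, Real.dist_eq, sub_zero, abs_of_nonneg ht.1]; exact h1⟩

/-- Following the flow of a tangent field for time `t`, expanded to second order in `t`. -/
theorem TangentTo.exists_second_order_step {N : ℕ} {U C : Set (Fin N → ℝ)} (hU : IsOpen U)
    (hC : IsClosed C) {X : (Fin N → ℝ) → (Fin N → ℝ)} (hT : TangentTo U C X) {x : Fin N → ℝ}
    (hx : x ∈ U) (hX : ContDiffAt ℝ 1 X x) {y : ℝ → Fin N → ℝ} {v : Fin N → ℝ}
    (hyC : ∀ᶠ t in 𝓝[>] (0 : ℝ), y t ∈ C)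
    (hy : (fun t => y t - x - t • v) =o[𝓝[>] (0 : ℝ)] (fun t => t)) :
    ∃ z : ℝ → Fin N → ℝ, (∀ᶠ t in 𝓝[>] (0 : ℝ), z t ∈ C) ∧
      (fun t => z t - y t - t • X x -
        t ^ 2 • (fderiv ℝ X x v + (1 / 2 : ℝ) • fderiv ℝ X x (X x))) =o[𝓝[>] (0 : ℝ)]
          (fun t => t ^ 2) := by
  obtain ⟨α, hα⟩ := hX.exists_local_flow
  have hpos : ∀ᶠ t : ℝ in 𝓝[>] (0 : ℝ), 0 < t := self_mem_nhdsWithin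
  have hid : Tendsto (fun t : ℝ => t) (𝓝[>] (0 : ℝ)) (𝓝 0) := nhdsWithin_le_nhds
  have hylim : Tendsto y (𝓝[>] (0 : ℝ)) (𝓝 x) := by
    have h1 : Tendsto (fun t : ℝ => y t - x - t • v) (𝓝[>] (0 : ℝ)) (𝓝 0) := hy.trans_tendsto hid
    have h2 : Tendsto (fun t : ℝ => t • v) (𝓝[>] (0 : ℝ)) (𝓝 ((0 : ℝ) • v)) := hid.smul_const v
    have h3 := (h1.add h2).add_const x
    simpa using h3
  have hflow : ∀ R > (0 : ℝ), ∀ᶠ t : ℝ in 𝓝[>] (0 : ℝ), α (y t) 0 = y t ∧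
      ∀ s ∈ Icc 0 t, HasDerivAt (α (y t)) (X (α (y t) s)) s ∧ α (y t) s ∈ closedBall x R := by
    intro R hR
    obtain ⟨η, hη, h⟩ := hα R hR
    filter_upwards [hylim (closedBall_mem_nhds x hη), hid (Iic_mem_nhds hη)] with t h1 h2
    exact ⟨(h _ h1).1, fun s hs => (h _ h1).2 s ⟨hs.1, hs.2.trans h2⟩⟩
  refine ⟨fun t => α (y t) t, ?_, ?_⟩
  · obtain ⟨K, s, hs, hL⟩ := hX.exists_lipschitzOnWith
    obtain ⟨ρ, hρ, hball⟩ := nhds_basis_closedBall.mem_iff.1 (inter_mem hs (hU.mem_nhds hx))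
    have hN : (0 : ℝ) < 2 * N + 2 := by positivity
    filter_upwards [hflow (ρ / (2 * N + 2)) (by positivity), hyC, hpos] with t ht htC ht0
    exact hT.mem_of_integralCurve hC hρ (hball.trans inter_subset_right)
      (hL.mono (hball.trans inter_subset_left)) (fun s hs => (ht.2 s hs).1)
      (fun s hs => (ht.2 s hs).2) (by rw [ht.1]; exact htC) t ⟨ht0.le, le_rfl⟩
  · set A := fderiv ℝ X x with hA
    have hXd : HasFDerivAt X A x := (hX.differentiableAt one_ne_zero).hasFDerivAt
    rw [isLittleO_iff]
    intro c hc
    set M := ‖v‖ + ‖X x‖ + 2 + 2 * ‖A‖ with hM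
    have hM0 : 0 < M := by positivity
    set η := min 1 (c / M) with hη
    have hη0 : 0 < η := by positivity
    have hη1 : η ≤ 1 := min_le_left _ _
    have hηc : η * M ≤ c := by
      rw [← le_div_iff₀ hM0]
      exact min_le_right _ _
    obtain ⟨R, hR, hball⟩ := nhds_basis_closedBall.mem_iff.1
      (inter_mem ((isLittleO_iff.1 hXd.isLittleO) hη0)
        (hXd.continuousAt (closedBall_mem_nhds (X x) hη0)))
    filter_upwards [hflow R hR, (isLittleO_iff.1 hy) hη0, hpos] with t ht hyt ht0
    have hder := fun s hs => (ht.2 s hs).1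
    have hX1 : ∀ s ∈ Icc 0 t, ‖X (α (y t) s) - X x - A (α (y t) s - x)‖ ≤ η * ‖α (y t) s - x‖ :=
      fun s hs => (hball (ht.2 s hs).2).1
    have hX2 : ∀ s ∈ Icc 0 t, ‖X (α (y t) s) - X x‖ ≤ η :=
      fun s hs => mem_closedBall_iff_norm.1 (hball (ht.2 s hs).2).2
    rw [Real.norm_of_nonneg ht0.le] at hyt
    have e1 : ∀ s ∈ Icc 0 t, ‖α (y t) s - y t - s • X x‖ ≤ η * t := by
      intro s hs
      have h := norm_image_sub_le_of_norm_deriv_le_segment' (f := fun s => α (y t) s - s • X x)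
        (f' := fun s => X (α (y t) s) - X x) (C := η) (a := 0) (b := t)
        (fun s hs => by
          simpa using ((hder s hs).fun_sub ((hasDerivAt_id' s).smul_const (X x))).hasDerivWithinAt)
        (fun s hs => hX2 s (Ico_subset_Icc_self hs)) s hs
      simp only [ht.1, zero_smul, sub_zero] at h
      rw [sub_right_comm]
      exact h.trans (by gcongr; exact hs.2)
    have e2 : ∀ s ∈ Icc 0 t, ‖α (y t) s - x - (t • v + s • X x)‖ ≤ 2 * η * t := by
      intro s hs
      have h : α (y t) s - x - (t • v + s • X x) =
          (y t - x - t • v) + (α (y t) s - y t - s • X x) := by abel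
      rw [h]
      exact (norm_add_le _ _).trans (by linarith [e1 s hs])
    have e3 : ∀ s ∈ Icc 0 t, ‖α (y t) s - x‖ ≤ (‖v‖ + ‖X x‖ + 2) * t := by
      intro s hs
      have h : α (y t) s - x = (α (y t) s - x - (t • v + s • X x)) + t • v + s • X x := by abel
      rw [h]
      refine norm_add₃_le.trans ?_
      rw [norm_smul, norm_smul, Real.norm_of_nonneg ht0.le, Real.norm_of_nonneg hs.1]
      have h1 := e2 s hs
      have h2 : s * ‖X x‖ ≤ t * ‖X x‖ := by gcongr; exact hs.2
      have h3 : η * t ≤ 1 * t := by gcongr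
      linarith
    have e4 : ∀ s ∈ Icc 0 t, ‖X (α (y t) s) - X x - A (t • v + s • X x)‖ ≤ η * M * t := by
      intro s hs
      have h : X (α (y t) s) - X x - A (t • v + s • X x) =
          (X (α (y t) s) - X x - A (α (y t) s - x)) + A (α (y t) s - x - (t • v + s • X x)) := by
        rw [map_sub A (α (y t) s - x)]; abel
      rw [h]
      refine (norm_add_le _ _).trans ?_
      have h1 : ‖A (α (y t) s - x - (t • v + s • X x))‖ ≤ ‖A‖ * (2 * η * t) :=
        (A.le_opNorm _).trans (by gcongr; exact e2 s hs)
      have h2 : η * ‖α (y t) s - x‖ ≤ η * ((‖v‖ + ‖X x‖ + 2) * t) := by gcongr; exact e3 s hs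
      have h3 := hX1 s hs
      rw [hM]
      linarith
    have h := norm_image_sub_le_of_norm_deriv_le_segment'
      (f := fun s => α (y t) s - s • X x - (s * t) • A v - (s ^ 2 / 2) • A (X x))
      (f' := fun s => X (α (y t) s) - X x - A (t • v + s • X x)) (C := η * M * t) (a := 0) (b := t)
      (fun s hs => by
        have h1 := (hder s hs).fun_sub ((hasDerivAt_id' s).smul_const (X x))
        have h2 := ((hasDerivAt_id' s).mul_const t).smul_const (A v)
        have h3 := (((hasDerivAt_id' s).fun_pow 2).div_const 2).smul_const (A (X x))
        convert ((h1.fun_sub h2).fun_sub h3).hasDerivWithinAt (s := Icc 0 t) using 1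
        simp [sub_sub, add_assoc])
      (fun s hs => e4 s (Ico_subset_Icc_self hs)) t ⟨ht0.le, le_rfl⟩
    have e5 : α (y t) t - y t - t • X x - t ^ 2 • (A v + (1 / 2 : ℝ) • A (X x)) =
        (α (y t) t - t • X x - (t * t) • A v - (t ^ 2 / 2) • A (X x)) -
          (α (y t) 0 - (0 : ℝ) • X x - (0 * t) • A v - ((0 : ℝ) ^ 2 / 2) • A (X x)) := by
      rw [ht.1]
      simp only [zero_mul, zero_smul, smul_add, smul_smul, sub_zero]
      module
    rw [e5]
    refine h.trans ?_
    rw [norm_pow, Real.norm_of_nonneg ht0.le]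
    nlinarith [sq_nonneg t]

theorem TangentTo.neg {N : ℕ} {U C : Set (Fin N → ℝ)} {X : (Fin N → ℝ) → (Fin N → ℝ)}
    (hX : TangentTo U C X) : TangentTo U C (-X) := fun x hxU hxC ν hν => by
  rw [Pi.neg_apply, neg_dotProduct, hX x hxU hxC ν hν, neg_zero]

theorem TangentTo.dotProduct_lieBr_le {N : ℕ} {U C : Set (Fin N → ℝ)} (hU : IsOpen U)
    (hC : IsClosed C) {X Y : (Fin N → ℝ) → (Fin N → ℝ)} (hTX : TangentTo U C X)
    (hTY : TangentTo U C Y) {x : Fin N → ℝ} (hx : x ∈ U) (hxC : x ∈ C)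
    (hX : ContDiffAt ℝ 1 X x) (hY : ContDiffAt ℝ 1 Y x) {ν : Fin N → ℝ}
    (hν : ∀ᶠ y in 𝓝 x, y ∈ C → ν ⬝ᵥ (y - x) ≤ (y - x) ⬝ᵥ (y - x)) :
    lieBr X Y x ⬝ᵥ ν ≤ 0 := by
  have hid : Tendsto (fun t : ℝ => t) (𝓝[>] (0 : ℝ)) (𝓝 0) := nhdsWithin_le_nhds
  have hsq : (fun t : ℝ => t ^ 2) =o[𝓝[>] (0 : ℝ)] fun t => t :=
    ((isLittleO_pow_id one_lt_two).mono nhdsWithin_le_nhds)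
  have hsmul : ∀ w : Fin N → ℝ, (fun t : ℝ => t ^ 2 • w) =o[𝓝[>] (0 : ℝ)] fun t => t := by
    intro w
    have h := hsq.smul_isBigO (isBigO_refl (fun _ : ℝ => w) (𝓝[>] (0 : ℝ)))
    refine h.trans_isBigO (IsBigO.of_bound ‖w‖ (Eventually.of_forall fun t => ?_))
    rw [norm_smul, mul_comm]
  have hstep : ∀ {y z : ℝ → Fin N → ℝ} {v u w : Fin N → ℝ},
      (fun t => y t - x - t • v) =o[𝓝[>] (0 : ℝ)] (fun t => t) →
      (fun t => z t - y t - t • u - t ^ 2 • w) =o[𝓝[>] (0 : ℝ)] (fun t => t ^ 2) →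
      (fun t => z t - x - t • (v + u)) =o[𝓝[>] (0 : ℝ)] (fun t => t) := by
    intro y z v u w h1 h2
    refine ((h1.add (h2.trans hsq)).add (hsmul w)).congr_left fun t => ?_
    module
  have h0 : (fun t : ℝ => (fun _ : ℝ => x) t - x - t • (0 : Fin N → ℝ)) =o[𝓝[>] (0 : ℝ)]
      (fun t => t) := by
    simp
  obtain ⟨z₁, hz₁C, hz₁⟩ := hTX.exists_second_order_step hU hC hx hX
    (Eventually.of_forall fun _ => hxC) h0
  have h1 := hstep h0 hz₁
  obtain ⟨z₂, hz₂C, hz₂⟩ := hTY.exists_second_order_step hU hC hx hY hz₁C h1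
  have h2 := hstep h1 hz₂
  obtain ⟨z₃, hz₃C, hz₃⟩ := hTX.neg.exists_second_order_step hU hC hx hX.neg hz₂C h2
  have h3 := hstep h2 hz₃
  obtain ⟨z₄, hz₄C, hz₄⟩ := hTY.neg.exists_second_order_step hU hC hx hY.neg hz₃C h3
  have hz : (fun t => z₄ t - x - t ^ 2 • lieBr X Y x) =o[𝓝[>] (0 : ℝ)] (fun t => t ^ 2) := by
    refine (((hz₁.add hz₂).add hz₃).add hz₄).congr_left fun t => ?_
    simp only [lieBr, fderiv_neg, Pi.neg_apply, _root_.neg_apply, map_add, map_neg, map_zero]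
    module
  have hpos : ∀ᶠ t : ℝ in 𝓝[>] (0 : ℝ), 0 < t := self_mem_nhdsWithin
  have hlim : Tendsto (fun t : ℝ => (t ^ 2)⁻¹ • (z₄ t - x)) (𝓝[>] (0 : ℝ))
      (𝓝 (lieBr X Y x)) := by
    have h := hz.tendsto_inv_smul_nhds_zero.add_const (lieBr X Y x)
    rw [zero_add] at h
    refine h.congr' ?_
    filter_upwards [hpos] with t ht
    rw [smul_sub, inv_smul_smul₀ (by positivity), sub_add_cancel]
  have hzx : Tendsto z₄ (𝓝[>] (0 : ℝ)) (𝓝 x) := by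
    have h := ((hid.pow 2).smul hlim).add_const x
    simp only [ne_eq, OfNat.ofNat_ne_zero, not_false_eq_true, zero_pow, zero_smul, zero_add] at h
    refine h.congr' ?_
    filter_upwards [hpos] with t ht
    rw [smul_inv_smul₀ (by positivity), sub_add_cancel]
  have hdot : Continuous fun v : Fin N → ℝ => v ⬝ᵥ ν :=
    continuous_id.dotProduct continuous_const
  have hself : Continuous fun v : Fin N → ℝ => v ⬝ᵥ v := continuous_id.dotProduct continuous_id
  have hl := (hdot.tendsto _).comp hlim
  have hr := (hid.pow 2).mul ((hself.tendsto _).comp hlim)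
  simp only [ne_eq, OfNat.ofNat_ne_zero, not_false_eq_true, zero_pow, zero_mul] at hr
  refine le_of_tendsto_of_tendsto hl hr ?_
  filter_upwards [hpos, hzx.eventually hν, hz₄C] with t ht h1 h2
  have h := h1 h2
  simp only [Function.comp_apply, smul_dotProduct, dotProduct_smul, smul_eq_mul]
  rw [mul_inv_cancel_left₀ (by positivity), dotProduct_comm]
  gcongr

/-- The bracket of two fields tangent to a closed set is tangent to it. -/
theorem TangentTo.lieBr {N : ℕ} {U C : Set (Fin N → ℝ)} (hU : IsOpen U)
    (hC : IsClosed C) {X Y : (Fin N → ℝ) → (Fin N → ℝ)} (hTX : TangentTo U C X)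
    (hTY : TangentTo U C Y) (hX : ContDiffOn ℝ 1 X U) (hY : ContDiffOn ℝ 1 Y U) :
    TangentTo U C (lieBr X Y) := by
  intro x hx hxC ν hν
  have hX' := hX.contDiffAt (hU.mem_nhds hx)
  have hY' := hY.contDiffAt (hU.mem_nhds hx)
  refine le_antisymm (hTX.dotProduct_lieBr_le hU hC hTY hx hxC hX' hY' hν) ?_
  have h := hTY.dotProduct_lieBr_le hU hC hTX hx hxC hY' hX' hν
  have e : _root_.lieBr Y X x = -_root_.lieBr X Y x := by simp [_root_.lieBr]
  rw [e, neg_dotProduct] at h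
  linarith

theorem ContDiffOn.lieBr {N : ℕ} {U : Set (Fin N → ℝ)} (hU : IsOpen U)
    {X Y : (Fin N → ℝ) → (Fin N → ℝ)} (hX : ContDiffOn ℝ (⊤ : ℕ∞) X U)
    (hY : ContDiffOn ℝ (⊤ : ℕ∞) Y U) : ContDiffOn ℝ (⊤ : ℕ∞) (lieBr X Y) U :=
  ((hY.fderiv_of_isOpen hU (by simp)).clm_apply hX).sub
    ((hX.fderiv_of_isOpen hU (by simp)).clm_apply hY)

theorem LieSpan.contDiffOn_and_tangentTo {N : ℕ} {U C : Set (Fin N → ℝ)} (hU : IsOpen U)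
    (hC : IsClosed C) {S : Set ((Fin N → ℝ) → (Fin N → ℝ))}
    (hS : ∀ X ∈ S, ContDiffOn ℝ (⊤ : ℕ∞) X U) (hST : ∀ X ∈ S, TangentTo U C X)
    {Z : (Fin N → ℝ) → (Fin N → ℝ)} (hZ : LieSpan U S Z) :
    ContDiffOn ℝ (⊤ : ℕ∞) Z U ∧ TangentTo U C Z := by
  induction hZ with
  | base X hX => exact ⟨hS X hX, hST X hX⟩
  | smul f X hf _ ih =>
    refine ⟨hf.smul ih.1, fun x hx hxC ν hν => ?_⟩
    rw [smul_dotProduct, ih.2 x hx hxC ν hν, smul_zero]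
  | add X Y _ _ ihX ihY =>
    refine ⟨ihX.1.add ihY.1, fun x hx hxC ν hν => ?_⟩
    rw [add_dotProduct, ihX.2 x hx hxC ν hν, ihY.2 x hx hxC ν hν, add_zero]
  | bracket X Y _ _ ihX ihY =>
    have h1 : (1 : WithTop ℕ∞) ≤ ((⊤ : ℕ∞) : WithTop ℕ∞) := by exact_mod_cast le_top
    exact ⟨ihX.1.lieBr hU ihY.1,
      ihX.2.lieBr hU hC ihY.2 (ihX.1.of_le h1) (ihY.1.of_le h1)⟩

theorem TangentTo.forall_mem_of_integralCurve {N : ℕ} {U C : Set (Fin N → ℝ)} (hU : IsOpen U)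
    (hC : IsClosed C) {Z : (Fin N → ℝ) → (Fin N → ℝ)} (hT : TangentTo U C Z)
    (hZ : ContDiffOn ℝ 1 Z U) {I : Set ℝ} (hI : IsOpen I) (hIc : IsPreconnected I)
    {γ : ℝ → Fin N → ℝ} (hγU : ∀ t ∈ I, γ t ∈ U) (hγ : ∀ t ∈ I, HasDerivAt γ (Z (γ t)) t)
    {t₀ : ℝ} (ht₀ : t₀ ∈ I) (h₀ : γ t₀ ∈ C) : ∀ t ∈ I, γ t ∈ C := by
  have hγc : ContinuousOn γ I := fun t ht => (hγ t ht).continuousAt.continuousWithinAt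
  have hloc : ∀ t ∈ I, γ t ∈ C → ∀ᶠ s in 𝓝 t, γ s ∈ C := by
    intro t ht htC
    obtain ⟨K, s, hs, hL⟩ := (hZ.contDiffAt (hU.mem_nhds (hγU t ht))).exists_lipschitzOnWith
    obtain ⟨ρ, hρ, hball⟩ := nhds_basis_closedBall.mem_iff.1
      (inter_mem hs (hU.mem_nhds (hγU t ht)))
    have hσ : 0 < ρ / (2 * N + 2) := by positivity
    obtain ⟨δ, hδ, hsub⟩ := nhds_basis_closedBall.mem_iff.1 (inter_mem (hI.mem_nhds ht)
      ((hγ t ht).continuousAt (closedBall_mem_nhds _ hσ)))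
    have hsub' : ∀ s ∈ Icc (t - δ) (t + δ), s ∈ I ∧ γ s ∈ closedBall (γ t) (ρ / (2 * N + 2)) := by
      rw [← Real.closedBall_eq_Icc]
      exact fun s hs => hsub hs
    have hLn : LipschitzOnWith K (-Z) (closedBall (γ t) ρ) :=
      (hL.mono (hball.trans inter_subset_left)).neg
    filter_upwards [Icc_mem_nhds (by linarith : t - δ < t) (by linarith : t < t + δ)] with s hs
    rcases le_total t s with hts | hts
    · have hsubI : Icc t s ⊆ Icc (t - δ) (t + δ) := Icc_subset_Icc (by linarith) hs.2
      exact hT.mem_of_integralCurve hC hρ (hball.trans inter_subset_right)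
        (hL.mono (hball.trans inter_subset_left)) (fun u hu => hγ u (hsub' u (hsubI hu)).1)
        (fun u hu => (hsub' u (hsubI hu)).2) htC s ⟨hts, le_rfl⟩
    · have hsubI : ∀ u ∈ Icc (-t) (-s), -u ∈ Icc (t - δ) (t + δ) := fun u hu =>
        ⟨by linarith [hu.2, hs.1], by linarith [hu.1]⟩
      have h := hT.neg.mem_of_integralCurve (γ := fun u => γ (-u)) (a := -t) (b := -s) hC hρ
        (hball.trans inter_subset_right) hLn
        (fun u hu => by
          have h := (hγ (-u) (hsub' _ (hsubI u hu)).1).scomp u (hasDerivAt_neg u)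
          simpa [Function.comp_def] using h)
        (fun u hu => (hsub' _ (hsubI u hu)).2) (by simpa using htC) (-s) ⟨by linarith, le_rfl⟩
      simpa using h
  have hopen : IsOpen (I ∩ γ ⁻¹' C) := isOpen_iff_mem_nhds.2 fun t ht =>
    inter_mem (hI.mem_nhds ht.1) (hloc t ht.1 ht.2)
  have hopen' : IsOpen (I ∩ γ ⁻¹' Cᶜ) := hγc.isOpen_inter_preimage hI hC.isOpen_compl
  intro t ht
  by_contra htC
  obtain ⟨s, _, hs, hs'⟩ := hIc _ _ hopen hopen'
    (fun s hs => (em (γ s ∈ C)).elim (fun h => Or.inl ⟨hs, h⟩) fun h => Or.inr ⟨hs, h⟩)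
    ⟨t₀, ht₀, ht₀, h₀⟩ ⟨t, ht, ht, htC⟩
  exact hs'.2 hs.2

theorem IsLocalMax.second_deriv_nonpos {g g' : ℝ → ℝ} {t s : ℝ} (h : IsLocalMax g t)
    (hg : ∀ᶠ u in 𝓝 t, HasDerivAt g (g' u) u) (hg' : HasDerivAt g' s t) : s ≤ 0 := by
  by_contra! hs
  have hd : deriv g =ᶠ[𝓝 t] g' := hg.mono fun u hu => hu.deriv
  have hmin : IsLocalMin g t := isLocalMin_of_deriv_deriv_pos
    (by rw [hd.deriv_eq, hg'.deriv]; exact hs) h.deriv_eq_zero hg.self_of_nhds.continuousAt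
  have hconst : g =ᶠ[𝓝 t] fun _ => g t := by
    filter_upwards [h, hmin] with u h1 h2 using le_antisymm h1 h2
  have h2 : deriv g =ᶠ[𝓝 t] fun _ => (0 : ℝ) := by
    simpa using hconst.deriv
  have h3 := h2.deriv_eq
  rw [hd.deriv_eq, hg'.deriv, deriv_const] at h3
  exact hs.ne' h3

theorem hasDerivAt_exp_barrier {N : ℕ} (c x ξ : Fin N → ℝ) (α t : ℝ) :
    HasDerivAt (fun s : ℝ => Real.exp (-α * ((x + s • ξ - c) ⬝ᵥ (x + s • ξ - c))))
      (Real.exp (-α * ((x + t • ξ - c) ⬝ᵥ (x + t • ξ - c))) *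
        (-α * (2 * (ξ ⬝ᵥ (x + t • ξ - c))))) t := by
  have h : HasDerivAt (fun s : ℝ => x + s • ξ) ξ t := by
    simpa using ((hasDerivAt_id' t).smul_const ξ).const_add x
  exact ((hasDerivAt_dotProduct_self_sub h c).const_mul (-α)).exp

theorem IsLocalMax.add_exp_barrier {N : ℕ} {w : (Fin N → ℝ) → ℝ} {c x : Fin N → ℝ} {α ε : ℝ}
    (hw : ContDiffAt ℝ 2 w x)
    (h : IsLocalMax (fun y => w y + ε * Real.exp (-α * ((y - c) ⬝ᵥ (y - c)))) x)
    (ξ : Fin N → ℝ) :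
    fderiv ℝ w x ξ = ε * Real.exp (-α * ((x - c) ⬝ᵥ (x - c))) * (2 * α * (ξ ⬝ᵥ (x - c))) ∧
    fderiv ℝ (fderiv ℝ w) x ξ ξ ≤ ε * Real.exp (-α * ((x - c) ⬝ᵥ (x - c))) *
      (2 * α * (ξ ⬝ᵥ ξ) - 4 * α ^ 2 * (ξ ⬝ᵥ (x - c)) ^ 2) := by
  have hline : ∀ t : ℝ, HasDerivAt (fun s : ℝ => x + s • ξ) ξ t := fun t => by
    simpa using ((hasDerivAt_id' t).smul_const ξ).const_add x
  have hx0 : x + (0 : ℝ) • ξ = x := by simp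
  have hlim : Tendsto (fun s : ℝ => x + s • ξ) (𝓝 0) (𝓝 x) := by
    have := (hline 0).continuousAt.tendsto
    rwa [hx0] at this
  have hwd : ∀ᶠ y in 𝓝 x, DifferentiableAt ℝ w y :=
    (hw.eventually (by simp)).mono fun y hy => hy.differentiableAt two_ne_zero
  have hw' : DifferentiableAt ℝ (fderiv ℝ w) x :=
    (hw.fderiv_right (m := 1) (by norm_num)).differentiableAt one_ne_zero
  set G : ℝ → ℝ := fun s => w (x + s • ξ) +
    ε * Real.exp (-α * ((x + s • ξ - c) ⬝ᵥ (x + s • ξ - c))) with hG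
  set G' : ℝ → ℝ := fun t => fderiv ℝ w (x + t • ξ) ξ +
    ε * (Real.exp (-α * ((x + t • ξ - c) ⬝ᵥ (x + t • ξ - c))) *
        (-α * (2 * (ξ ⬝ᵥ (x + t • ξ - c))))) with hG'
  have hGd : ∀ᶠ t in 𝓝 (0 : ℝ), HasDerivAt G (G' t) t := by
    filter_upwards [hlim.eventually hwd] with t ht
    exact (ht.hasFDerivAt.comp_hasDerivAt t (hline t)).add
      ((hasDerivAt_exp_barrier c x ξ α t).const_mul ε)
  have hmax : IsLocalMax G 0 := by
    have := hlim.eventually h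
    filter_upwards [this] with t ht
    simpa [hG] using ht
  have hdot : HasDerivAt (fun t : ℝ => -α * (2 * (ξ ⬝ᵥ (x + t • ξ - c)))) (-α * (2 * (ξ ⬝ᵥ ξ)))
      0 := by
    have e : (fun t : ℝ => -α * (2 * (ξ ⬝ᵥ (x + t • ξ - c)))) =
        fun t => -α * (2 * (ξ ⬝ᵥ (x - c) + t * (ξ ⬝ᵥ ξ))) := by
      funext t
      rw [add_sub_right_comm, dotProduct_add, dotProduct_smul, smul_eq_mul]
    rw [e]
    have h1 : HasDerivAt (fun t : ℝ => t * (ξ ⬝ᵥ ξ)) (ξ ⬝ᵥ ξ) 0 := by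
      simpa only [one_mul] using (hasDerivAt_id' (0 : ℝ)).mul_const (ξ ⬝ᵥ ξ)
    exact ((h1.const_add (ξ ⬝ᵥ (x - c))).const_mul 2).const_mul (-α)
  have hfd : HasDerivAt (fun t : ℝ => fderiv ℝ w (x + t • ξ) ξ)
      (fderiv ℝ (fderiv ℝ w) x ξ ξ) 0 := by
    have h1 : HasFDerivAt (fderiv ℝ w) (fderiv ℝ (fderiv ℝ w) x) (x + (0 : ℝ) • ξ) := by
      rw [hx0]; exact hw'.hasFDerivAt
    have h2 : HasDerivAt (fun t : ℝ => fderiv ℝ w (x + t • ξ)) (fderiv ℝ (fderiv ℝ w) x ξ) 0 :=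
      h1.comp_hasDerivAt (0 : ℝ) (hline 0)
    have h3 := h2.clm_apply (hasDerivAt_const (0 : ℝ) ξ)
    simpa only [map_zero, add_zero] using h3
  have hGd' := hfd.add (((hasDerivAt_exp_barrier c x ξ α 0).mul hdot).const_mul ε)
  have hz := hmax.hasDerivAt_eq_zero hGd.self_of_nhds
  have hs := hmax.second_deriv_nonpos hGd hGd'
  simp only [hG', hx0] at hz hs
  constructor
  · linear_combination hz
  · linarith

/-- Hopf's boundary point argument: a differential inequality with principal part
`∑ k, D²w (V k, V k)` makes each `V k` orthogonal to the proximal normals of the set where `w`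
attains its maximum. -/
theorem dotProduct_eq_zero_of_proximal_normal {N r : ℕ} {w : (Fin N → ℝ) → ℝ}
    {V : Fin r → (Fin N → ℝ) → (Fin N → ℝ)} {x₀ ν : Fin N → ℝ} {K : ℝ} (hK : 0 ≤ K)
    (hw : ContDiffAt ℝ 2 w x₀) (hV : ∀ k, ContinuousAt (V k) x₀) (hmax : IsLocalMax w x₀)
    (hL : ∀ᶠ x in 𝓝 x₀, -K * (‖grad N w x‖ + (w x₀ - w x)) ≤
      ∑ k, fderiv ℝ (fderiv ℝ w) x (V k x) (V k x))
    (hν : ∀ᶠ y in 𝓝 x₀, w y = w x₀ → ν ⬝ᵥ (y - x₀) ≤ (y - x₀) ⬝ᵥ (y - x₀)) (j : Fin r) :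
    V j x₀ ⬝ᵥ ν = 0 := by
  by_contra hne
  set c : Fin N → ℝ := x₀ + (1 / 4 : ℝ) • ν with hc
  have hd0 : x₀ - c = -((1 / 4 : ℝ) • ν) := by rw [hc]; abel
  have hcd : Continuous fun x : Fin N → ℝ => x - c := continuous_id.sub continuous_const
  have hself : Continuous fun v : Fin N → ℝ => v ⬝ᵥ v := continuous_id.dotProduct continuous_id
  set l : ℝ := (V j x₀ ⬝ᵥ (x₀ - c)) ^ 2 / 2 with hl
  have hl0 : 0 < l := by
    have : V j x₀ ⬝ᵥ (x₀ - c) ≠ 0 := by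
      rw [hd0, dotProduct_neg, dotProduct_smul, smul_eq_mul]
      simpa using hne
    positivity
  set S : ℝ := ∑ k, V k x₀ ⬝ᵥ V k x₀ + 1 with hS
  set D : ℝ := ‖x₀ - c‖ + 1 with hD
  have hS0 : 0 < S := add_pos_of_nonneg_of_pos
    (Finset.sum_nonneg fun k _ => dotProduct_self_nonneg_real _) one_pos
  have hD0 : 0 < D := by positivity
  have ev1 : ∀ᶠ x in 𝓝 x₀, l < (V j x ⬝ᵥ (x - c)) ^ 2 := by
    have h1 : ContinuousAt (fun x => (V j x ⬝ᵥ (x - c)) ^ 2) x₀ := by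
      refine ContinuousAt.pow ?_ 2
      have h : Continuous fun p : (Fin N → ℝ) × (Fin N → ℝ) => p.1 ⬝ᵥ p.2 :=
        continuous_fst.dotProduct continuous_snd
      exact h.continuousAt.comp (f := fun x => (V j x, x - c)) ((hV j).prodMk hcd.continuousAt)
    exact h1.eventually (lt_mem_nhds (by rw [hl] at hl0 ⊢; linarith))
  have ev2 : ∀ᶠ x in 𝓝 x₀, ∑ k, V k x ⬝ᵥ V k x < S := by
    have h1 : ContinuousAt (fun x => ∑ k, V k x ⬝ᵥ V k x) x₀ :=
      tendsto_finsetSum _ fun k _ => (hself.continuousAt (x := V k x₀)).comp (f := V k) (hV k)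
    exact h1.eventually (gt_mem_nhds (by rw [hS]; linarith))
  have ev3 : ∀ᶠ x in 𝓝 x₀, ‖x - c‖ < D :=
    hcd.norm.continuousAt.eventually (gt_mem_nhds (by rw [hD]; linarith))
  obtain ⟨ρ, hρ, hball⟩ := nhds_basis_closedBall.mem_iff.1
    (inter_mem (inter_mem (inter_mem ev1 ev2) (inter_mem ev3 hL))
      (inter_mem (inter_mem hmax hν) (hw.eventually (by simp))))
  set q : (Fin N → ℝ) → ℝ := fun x => (x - c) ⬝ᵥ (x - c) with hq
  have hqc : Continuous q := hself.comp hcd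
  have hwc : ContinuousOn w (closedBall x₀ ρ) := fun x hx => by
    have h : ContDiffAt ℝ 2 w x := (hball hx).2.2
    exact h.continuousAt.continuousWithinAt
  have htouch : ∀ x ∈ sphere x₀ ρ, q x ≤ q x₀ → w x < w x₀ := by
    intro x hx hqx
    have hxb := hball (sphere_subset_closedBall hx)
    refine lt_of_le_of_ne hxb.2.1.1 fun he => ?_
    have h1 := hxb.2.1.2 he
    have hx' : 0 < ‖x - x₀‖ := by rw [mem_sphere_iff_norm.1 hx]; exact hρ
    have h2 : 0 < (x - x₀) ⬝ᵥ (x - x₀) :=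
      lt_of_lt_of_le (by positivity) (norm_sq_le_dotProduct_self _)
    have e1 : x - c = (x - x₀) - (1 / 4 : ℝ) • ν := by rw [hc]; abel
    simp only [hq] at hqx
    rw [e1, hd0] at hqx
    simp only [sub_dotProduct (x - x₀), dotProduct_sub _ (x - x₀), neg_dotProduct,
      dotProduct_neg, smul_dotProduct, dotProduct_smul, smul_eq_mul, dotProduct_comm (x - x₀) ν] at hqx
    linarith
  have hcomp : IsCompact (sphere x₀ ρ ∩ {x | q x ≤ q x₀}) :=
    (isCompact_sphere x₀ ρ).inter_right (isClosed_le hqc continuous_const)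
  obtain ⟨η, hη, hgap⟩ : ∃ η > (0 : ℝ), ∀ x ∈ sphere x₀ ρ ∩ {x | q x ≤ q x₀},
      w x ≤ w x₀ - η := by
    rcases (sphere x₀ ρ ∩ {x | q x ≤ q x₀}).eq_empty_or_nonempty with he | hne'
    · exact ⟨1, one_pos, by simp [he]⟩
    · obtain ⟨z, hz, hzm⟩ := hcomp.exists_isMaxOn hne'
        (hwc.mono (inter_subset_left.trans sphere_subset_closedBall))
      refine ⟨w x₀ - w z, sub_pos.2 (htouch z hz.1 hz.2), fun x hx => ?_⟩
      have := hzm hx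
      have h : w x ≤ w z := this
      linarith
  set α : ℝ := (2 * S + 2 * K * D + K) / (4 * l) + 1 with hα
  have hα1 : 1 ≤ α := by
    rw [hα]; exact le_add_of_nonneg_left (by positivity)
  have hα2 : 2 * S + 2 * K * D + K < 4 * α * l := by
    have e : 4 * α * l = (2 * S + 2 * K * D + K) + 4 * l := by rw [hα]; field_simp
    rw [e]
    linarith
  set u : (Fin N → ℝ) → ℝ := fun x => w x + η / 2 * Real.exp (-α * q x) with hu
  have huc : ContinuousOn u (closedBall x₀ ρ) := hwc.add
    (continuous_const.mul (Real.continuous_exp.comp (continuous_const.mul hqc))).continuousOn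
  obtain ⟨x₁, hx₁, hx₁m⟩ := (isCompact_closedBall x₀ ρ).exists_isMaxOn
    ⟨x₀, mem_closedBall_self hρ.le⟩ huc
  have hq0 : ∀ x, 0 ≤ q x := fun x => dotProduct_self_nonneg_real _
  have hsph : ∀ x ∈ sphere x₀ ρ, u x < u x₀ := by
    intro x hx
    simp only [hu]
    have hxM : w x ≤ w x₀ := (hball (sphere_subset_closedBall hx)).2.1.1
    rcases le_or_gt (q x) (q x₀) with h | h
    · have h1 := hgap x ⟨hx, h⟩
      have h2 : Real.exp (-α * q x) ≤ 1 := Real.exp_le_one_iff.2 (by nlinarith [hq0 x])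
      have h3 := Real.exp_pos (-α * q x₀)
      nlinarith
    · have h1 : Real.exp (-α * q x) < Real.exp (-α * q x₀) := Real.exp_lt_exp.2 (by nlinarith)
      nlinarith
  have hux : u x₀ ≤ u x₁ := hx₁m (mem_closedBall_self hρ.le)
  have hx₁b : x₁ ∈ ball x₀ ρ := by
    rcases (mem_closedBall.1 hx₁).lt_or_eq with h | h
    · exact h
    · exact absurd (hsph x₁ h) (not_lt.2 hux)
  have hlm : IsLocalMax u x₁ :=
    hx₁m.isLocalMax (mem_of_superset (isOpen_ball.mem_nhds hx₁b) ball_subset_closedBall)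
  obtain ⟨⟨⟨hb1, hb2⟩, hb3, hb4⟩, _, hb5⟩ := hball hx₁
  have hpt := IsLocalMax.add_exp_barrier hb5 hlm
  set E : ℝ := η / 2 * Real.exp (-α * q x₁) with hE
  have hE0 : 0 < E := by positivity
  have hgrad : ‖grad N w x₁‖ ≤ E * (2 * α * D) := by
    refine (pi_norm_le_iff_of_nonneg (by positivity)).2 fun i => ?_
    have h1 : grad N w x₁ i = E * (2 * α * (x₁ - c) i) := by
      rw [grad, pd, (hpt (ee N i)).1, ee_eq_single, single_one_dotProduct]
    rw [h1, norm_mul E (2 * α * (x₁ - c) i), norm_mul (2 * α), Real.norm_of_nonneg hE0.le,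
      Real.norm_of_nonneg (by positivity : (0 : ℝ) ≤ 2 * α)]
    have := (norm_le_pi_norm (x₁ - c) i).trans hb3.le
    gcongr
  have hdef : w x₀ - w x₁ ≤ E := by
    have h3 : 0 < η / 2 * Real.exp (-α * q x₀) := by positivity
    simp only [hu] at hux
    linarith
  have hsum : ∑ k, fderiv ℝ (fderiv ℝ w) x₁ (V k x₁) (V k x₁) ≤
      E * (2 * α * S - 4 * α ^ 2 * l) := by
    refine (Finset.sum_le_sum fun k _ => (hpt (V k x₁)).2).trans ?_
    rw [← Finset.mul_sum, Finset.sum_sub_distrib, ← Finset.mul_sum, ← Finset.mul_sum]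
    have h1 : l ≤ ∑ k, (V k x₁ ⬝ᵥ (x₁ - c)) ^ 2 := le_trans (le_of_lt hb1)
      (Finset.single_le_sum (f := fun k => (V k x₁ ⬝ᵥ (x₁ - c)) ^ 2) (fun k _ => sq_nonneg _)
        (Finset.mem_univ j))
    have h2 : ∑ k, V k x₁ ⬝ᵥ V k x₁ ≤ S := le_of_lt hb2
    gcongr
  have hfin : -K * (E * (2 * α * D) + E) ≤ E * (2 * α * S - 4 * α ^ 2 * l) := by
    refine le_trans ?_ (hb4.trans hsum)
    rw [neg_mul, neg_mul, neg_le_neg_iff]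
    gcongr
  have h1 : E * (4 * α ^ 2 * l) ≤ E * (2 * α * S + K * (2 * α * D) + K) := by linarith
  have h2 := le_of_mul_le_mul_left h1 hE0
  nlinarith

theorem ContDiffAt.exists_eventually_abs_sub_le {E G : Type*} [NormedAddCommGroup E]
    [NormedSpace ℝ E] [TopologicalSpace G] {F : E → ℝ} {q₀ : E} (hF : ContDiffAt ℝ 1 F q₀)
    {u v : G → E} {l : Filter G} (hu : Tendsto u l (𝓝 q₀)) (hv : Tendsto v l (𝓝 q₀)) :
    ∃ K ≥ (0 : ℝ), ∀ᶠ x in l, |F (u x) - F (v x)| ≤ K * ‖u x - v x‖ := by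
  obtain ⟨K, s, hs, hL⟩ := hF.exists_lipschitzOnWith
  refine ⟨K, K.2, ?_⟩
  filter_upwards [hu hs, hv hs] with x h1 h2
  simpa [dist_eq_norm, Real.norm_eq_abs] using hL.dist_le_mul _ h1 _ h2

theorem fderiv_fderiv_sub {N : ℕ} {φ ψ : (Fin N → ℝ) → ℝ} {x : Fin N → ℝ}
    (hφ : ContDiffAt ℝ 2 φ x) (hψ : ContDiffAt ℝ 2 ψ x) :
    fderiv ℝ (fderiv ℝ (fun y => φ y - ψ y)) x =
      fderiv ℝ (fderiv ℝ φ) x - fderiv ℝ (fderiv ℝ ψ) x := by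
  have h : fderiv ℝ (fun y => φ y - ψ y) =ᶠ[𝓝 x] fun y => fderiv ℝ φ y - fderiv ℝ ψ y := by
    filter_upwards [hφ.eventually (by simp), hψ.eventually (by simp)] with y h1 h2
    exact fderiv_fun_sub (h1.differentiableAt two_ne_zero) (h2.differentiableAt two_ne_zero)
  rw [h.fderiv_eq]
  exact fderiv_fun_sub ((hφ.fderiv_right (m := 1) (by norm_num)).differentiableAt one_ne_zero)
    ((hψ.fderiv_right (m := 1) (by norm_num)).differentiableAt one_ne_zero)

theorem ContDiffOn.grad {N : ℕ} {n : ℕ∞} {Ω : Set (Fin N → ℝ)} (hΩ : IsOpen Ω)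
    {f : (Fin N → ℝ) → ℝ} (hf : ContDiffOn ℝ (n + 1) f Ω) : ContDiffOn ℝ n (grad N f) Ω :=
  contDiffOn_pi.2 fun _ => (hf.fderiv_of_isOpen hΩ le_rfl).clm_apply contDiffOn_const

/-- The difference of a subsolution and a supersolution satisfies a linear differential inequality
near a point where it attains a nonnegative maximum. -/
theorem exists_linearized_inequality {N : ℕ} {Ω : Set (Fin N → ℝ)} (hΩ : IsOpen Ω)
    {a : (Fin N → ℝ) → (Fin N → ℝ) → Matrix (Fin N) (Fin N) ℝ}
    {b : (Fin N → ℝ) → ℝ → (Fin N → ℝ) → ℝ}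
    (ha : ∀ i j, ContDiffOn ℝ 1
      (fun q : (Fin N → ℝ) × (Fin N → ℝ) => a q.1 q.2 i j) (Ω ×ˢ (Set.univ : Set (Fin N → ℝ))))
    (hb : ContDiffOn ℝ 1 (fun q : (Fin N → ℝ) × ℝ × (Fin N → ℝ) => b q.1 q.2.1 q.2.2)
      (Ω ×ˢ (Set.univ : Set (ℝ × (Fin N → ℝ)))))
    {φ ψ : (Fin N → ℝ) → ℝ} (hφ : ContDiffOn ℝ 2 φ Ω) (hψ : ContDiffOn ℝ 2 ψ Ω)
    (hQ : ∀ x ∈ Ω, Qop N a b ψ x ≤ Qop N a b φ x)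
    (hbz : ∀ x z p, deriv (fun t : ℝ => b x t p) z ≤ 0)
    {x₀ : Fin N → ℝ} (hx₀ : x₀ ∈ Ω) (hmax : ∀ x ∈ Ω, φ x - ψ x ≤ φ x₀ - ψ x₀)
    (h0 : 0 ≤ φ x₀ - ψ x₀) :
    ∃ K ≥ (0 : ℝ), ∀ᶠ x in 𝓝 x₀,
      -K * (‖grad N (fun y => φ y - ψ y) x‖ + ((φ x₀ - ψ x₀) - (φ x - ψ x))) ≤
        ∑ i : Fin N, ∑ j : Fin N, a x (grad N φ x) i j *
          fderiv ℝ (fderiv ℝ (fun y => φ y - ψ y)) x (ee N i) (ee N j) := by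
  have hΩx : Ω ∈ 𝓝 x₀ := hΩ.mem_nhds hx₀
  have hφ' : ∀ x ∈ Ω, ContDiffAt ℝ 2 φ x := fun x hx => hφ.contDiffAt (hΩ.mem_nhds hx)
  have hψ' : ∀ x ∈ Ω, ContDiffAt ℝ 2 ψ x := fun x hx => hψ.contDiffAt (hΩ.mem_nhds hx)
  have hgφ : ContinuousAt (grad N φ) x₀ :=
    (ContDiffOn.grad (n := 1) hΩ (by convert hφ using 1; norm_num)).continuousOn.continuousAt hΩx
  have hgψ : ContinuousAt (grad N ψ) x₀ :=
    (ContDiffOn.grad (n := 1) hΩ (by convert hψ using 1; norm_num)).continuousOn.continuousAt hΩx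
  have hgsub : ∀ x ∈ Ω, grad N (fun y => φ y - ψ y) x = grad N φ x - grad N ψ x := by
    intro x hx
    funext i
    simp only [grad, pd, Pi.sub_apply]
    rw [fderiv_fun_sub ((hφ' x hx).differentiableAt two_ne_zero)
      ((hψ' x hx).differentiableAt two_ne_zero), _root_.sub_apply]
  have hg0 : grad N φ x₀ = grad N ψ x₀ := by
    have hlm : IsLocalMax (fun y => φ y - ψ y) x₀ := mem_of_superset hΩx hmax
    rw [← sub_eq_zero, ← hgsub x₀ hx₀]
    funext i
    simp [grad, pd, hlm.fderiv_eq_zero]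
  have ha0 : ∀ i j, ∃ K ≥ (0 : ℝ), ∀ᶠ x in 𝓝 x₀,
      |(a x (grad N ψ x) i j - a x (grad N φ x) i j) *
        fderiv ℝ (fderiv ℝ ψ) x (ee N i) (ee N j)| ≤ K * ‖grad N φ x - grad N ψ x‖ := by
    intro i j
    have h1 : ContDiffAt ℝ 1 (fun q : (Fin N → ℝ) × (Fin N → ℝ) => a q.1 q.2 i j)
        (x₀, grad N φ x₀) := (ha i j).contDiffAt (prod_mem_nhds hΩx univ_mem)
    obtain ⟨K, hK, hKe⟩ := h1.exists_eventually_abs_sub_le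
      (u := fun x => (x, grad N ψ x)) (v := fun x => (x, grad N φ x))
      (by rw [hg0]; exact continuousAt_id.prodMk hgψ) (continuousAt_id.prodMk hgφ)
    have h2 : ContinuousAt (fun x => |fderiv ℝ (fderiv ℝ ψ) x (ee N i) (ee N j)|) x₀ := by
      have h3 := (((hψ' x₀ hx₀).fderiv_right (m := 1) (by norm_num)).fderiv_right
        (m := 0) (by norm_num)).continuousAt
      exact ((h3.clm_apply continuousAt_const).clm_apply continuousAt_const).abs
    have h3 := h2.eventually (gt_mem_nhds (lt_add_one _))
    refine ⟨K * (|fderiv ℝ (fderiv ℝ ψ) x₀ (ee N i) (ee N j)| + 1), by positivity, ?_⟩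
    filter_upwards [hKe, h3] with x hx1 hx2
    have e : ‖(x, grad N ψ x) - (x, grad N φ x)‖ = ‖grad N φ x - grad N ψ x‖ := by
      rw [Prod.mk_sub_mk, sub_self, Prod.norm_mk, norm_zero, norm_sub_rev]
      simp
    rw [e] at hx1
    rw [abs_mul, mul_right_comm]
    gcongr
  choose Ka hKa hKae using ha0
  have hb1 : ContDiffAt ℝ 1 (fun q : (Fin N → ℝ) × ℝ × (Fin N → ℝ) => b q.1 q.2.1 q.2.2)
      (x₀, ψ x₀, grad N φ x₀) := hb.contDiffAt (prod_mem_nhds hΩx univ_mem)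
  have hψc : ContinuousAt ψ x₀ := (hψ' x₀ hx₀).continuousAt
  have hφc : ContinuousAt φ x₀ := (hφ' x₀ hx₀).continuousAt
  obtain ⟨Kb, hKb, hKbe⟩ := hb1.exists_eventually_abs_sub_le
    (u := fun x => (x, ψ x, grad N ψ x)) (v := fun x => (x, ψ x, grad N φ x))
    (by rw [hg0]; exact continuousAt_id.prodMk (hψc.prodMk hgψ))
    (continuousAt_id.prodMk (hψc.prodMk hgφ))
  have hanti : ∀ x ∈ Ω, ∀ p, Antitone fun t : ℝ => b x t p := by
    intro x hx p
    refine antitone_of_deriv_nonpos (fun t => ?_) fun t => hbz x t p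
    have h1 := (hb.contDiffAt (x := (x, t, p))
      (prod_mem_nhds (hΩ.mem_nhds hx) univ_mem)).differentiableAt one_ne_zero
    exact h1.comp t (f := fun t : ℝ => (x, t, p)) (by fun_prop)
  obtain ⟨Kc, hKc, hKce⟩ : ∃ K ≥ (0 : ℝ), ∀ᶠ x in 𝓝 x₀,
      -(K * ((φ x₀ - ψ x₀) - (φ x - ψ x))) ≤ b x (ψ x) (grad N φ x) - b x (φ x) (grad N φ x) := by
    rcases h0.eq_or_lt with h | h
    · have hφψ : ψ x₀ = φ x₀ := by linarith
      obtain ⟨K, hK, hKe⟩ := hb1.exists_eventually_abs_sub_le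
        (u := fun x => (x, ψ x, grad N φ x)) (v := fun x => (x, φ x, grad N φ x))
        (continuousAt_id.prodMk (hψc.prodMk hgφ))
        (by rw [hφψ]; exact continuousAt_id.prodMk (hφc.prodMk hgφ))
      refine ⟨K, hK, ?_⟩
      filter_upwards [hKe, hΩx] with x hx hxΩ
      have e : ‖(x, ψ x, grad N φ x) - (x, φ x, grad N φ x)‖ = |ψ x - φ x| := by
        simp [Prod.norm_def]
      have h1 := hmax x hxΩ
      rw [e, abs_of_nonneg (by linarith : 0 ≤ ψ x - φ x)] at hx
      have h2 := (abs_le.1 hx).1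
      rw [← h, zero_sub, neg_sub]
      exact h2
    · refine ⟨0, le_rfl, ?_⟩
      filter_upwards [(hφc.sub hψc).eventually (lt_mem_nhds h), hΩx] with x hx hxΩ
      have h1 := hanti x hxΩ (grad N φ x) (sub_nonneg.1 (le_of_lt hx))
      simp only at h1
      linarith
  refine ⟨∑ i, ∑ j, Ka i j + Kb + Kc, by
    have : 0 ≤ ∑ i, ∑ j, Ka i j :=
      Finset.sum_nonneg fun i _ => Finset.sum_nonneg fun j _ => hKa i j
    positivity, ?_⟩
  filter_upwards [eventually_all.2 fun i => eventually_all.2 fun j => hKae i j, hKbe, hKce, hΩx]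
    with x hx1 hx2 hx3 hxΩ
  have hQx := hQ x hxΩ
  simp only [Qop, pd_pd_eq (hφ' x hxΩ), pd_pd_eq (hψ' x hxΩ)] at hQx
  rw [fderiv_fderiv_sub (hφ' x hxΩ) (hψ' x hxΩ), hgsub x hxΩ]
  have e : ‖(x, ψ x, grad N ψ x) - (x, ψ x, grad N φ x)‖ = ‖grad N φ x - grad N ψ x‖ := by
    rw [norm_sub_rev (grad N φ x)]
    simp [Prod.norm_def]
  rw [e] at hx2
  have hm := hmax x hxΩ
  set g := ‖grad N φ x - grad N ψ x‖ with hg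
  have hg_nonneg : 0 ≤ g := norm_nonneg _
  have hsum : -((∑ i, ∑ j, Ka i j) * g) ≤ ∑ i : Fin N, ∑ j : Fin N,
      (a x (grad N ψ x) i j - a x (grad N φ x) i j) *
        fderiv ℝ (fderiv ℝ ψ) x (ee N i) (ee N j) := by
    simp only [Finset.sum_mul, ← Finset.sum_neg_distrib]
    exact Finset.sum_le_sum fun i _ => Finset.sum_le_sum fun j _ => (abs_le.1 (hx1 i j)).1
  simp only [_root_.sub_apply, mul_sub, sub_mul, Finset.sum_sub_distrib] at hsum ⊢
  have h2 := (abs_le.1 hx2).1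
  have hKs : 0 ≤ ∑ i, ∑ j, Ka i j :=
    Finset.sum_nonneg fun i _ => Finset.sum_nonneg fun j _ => hKa i j
  nlinarith [mul_nonneg hKs (sub_nonneg.2 hm), mul_nonneg hKb (sub_nonneg.2 hm),
    mul_nonneg hKc hg_nonneg]

theorem exists_isClosed_inter_setOf_eq {N : ℕ} {U : Set (Fin N → ℝ)} {w : (Fin N → ℝ) → ℝ}
    (hw : ContinuousOn w U) (M : ℝ) : ∃ C : Set (Fin N → ℝ), IsClosed C ∧
      ∀ x ∈ U, x ∈ C ↔ w x = M := by
  obtain ⟨C, hC, h⟩ := continuousOn_iff_isClosed.1 hw {M} isClosed_singleton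
  refine ⟨C, hC, fun x hx => ?_⟩
  have := Set.ext_iff.1 h x
  simpa [hx] using this.symm

theorem tangentTo_contact_set {N r : ℕ} {Ω U C : Set (Fin N → ℝ)} (hΩ : IsOpen Ω)
    (hU : IsOpen U) (hUΩ : U ⊆ Ω)
    {a : (Fin N → ℝ) → (Fin N → ℝ) → Matrix (Fin N) (Fin N) ℝ}
    {b : (Fin N → ℝ) → ℝ → (Fin N → ℝ) → ℝ}
    (ha : ∀ i j, ContDiffOn ℝ 1
      (fun q : (Fin N → ℝ) × (Fin N → ℝ) => a q.1 q.2 i j) (Ω ×ˢ (Set.univ : Set (Fin N → ℝ))))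
    (hb : ContDiffOn ℝ 1 (fun q : (Fin N → ℝ) × ℝ × (Fin N → ℝ) => b q.1 q.2.1 q.2.2)
      (Ω ×ˢ (Set.univ : Set (ℝ × (Fin N → ℝ)))))
    {φ ψ : (Fin N → ℝ) → ℝ} (hφ : ContDiffOn ℝ 2 φ Ω) (hψ : ContDiffOn ℝ 2 ψ Ω)
    (hQ : ∀ x ∈ Ω, Qop N a b ψ x ≤ Qop N a b φ x)
    (hbz : ∀ x z p, deriv (fun t : ℝ => b x t p) z ≤ 0)
    {X : Fin r → (Fin N → ℝ) → (Fin N → ℝ)} (hX : ∀ k, ContinuousOn (X k) U)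
    (hdec : ∀ x ∈ U, ∀ i j, a x (grad N φ x) i j = ∑ k, X k x i * X k x j)
    {M : ℝ} (hM : ∀ x ∈ Ω, φ x - ψ x ≤ M) (hM0 : 0 ≤ M)
    (hC : ∀ x ∈ U, x ∈ C ↔ φ x - ψ x = M) (k : Fin r) : TangentTo U C (X k) := by
  intro x₀ hx₀ hx₀C ν hν
  have hUx : U ∈ 𝓝 x₀ := hU.mem_nhds hx₀
  have hΩx : Ω ∈ 𝓝 x₀ := hΩ.mem_nhds (hUΩ hx₀)
  have he : φ x₀ - ψ x₀ = M := (hC x₀ hx₀).1 hx₀C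
  obtain ⟨K, hK, hL⟩ := exists_linearized_inequality hΩ ha hb hφ hψ hQ hbz (hUΩ hx₀)
    (fun x hx => he ▸ hM x hx) (he ▸ hM0)
  refine dotProduct_eq_zero_of_proximal_normal (w := fun y => φ y - ψ y) hK
    ((hφ.contDiffAt hΩx).sub (hψ.contDiffAt hΩx)) (fun k => (hX k).continuousAt hUx)
    (mem_of_superset hΩx fun x hx => (hM x hx).trans_eq he.symm) ?_ ?_ k
  · filter_upwards [hL, hUx] with x hx hxU
    rwa [sum_mul_bilin_ee _ _ (fun k => X k x) (hdec x hxU)] at hx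
  · filter_upwards [hν, hUx] with y hy hyU hwy
    exact hy ((hC y hyU).2 (hwy.trans he))

end

/-- Theorem Ã: the strong maximum principle of Theorem A with
the sum-of-squares hypothesis replaced by the constant-rank condition
`rank (a^{ij}(x,Dφ(x))) = rr` on `Ω`: locally a sum-of-squares decomposition
exists, and for any such (local) decomposition the nonnegative maximum of
`φ − ψ` propagates along integral curves of fields in `£(X₁,...,X_r)`. -/
theorem strong_max_principle_constant_rank
    (m : ℕ) (hm : 1 ≤ m)
    (Ω : Set (Fin (m + 1) → ℝ)) (hΩopen : IsOpen Ω) (hΩconn : IsConnected Ω)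
    (a : (Fin (m + 1) → ℝ) → (Fin (m + 1) → ℝ) → Matrix (Fin (m + 1)) (Fin (m + 1)) ℝ)
    (b : (Fin (m + 1) → ℝ) → ℝ → (Fin (m + 1) → ℝ) → ℝ)
    (ha_smooth : ∀ i j, ContDiffOn ℝ (⊤ : ℕ∞)
      (fun q : (Fin (m + 1) → ℝ) × (Fin (m + 1) → ℝ) => a q.1 q.2 i j)
      (Ω ×ˢ (Set.univ : Set (Fin (m + 1) → ℝ))))
    (hb_smooth : ContDiffOn ℝ (⊤ : ℕ∞)
      (fun q : (Fin (m + 1) → ℝ) × ℝ × (Fin (m + 1) → ℝ) => b q.1 q.2.1 q.2.2)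
      (Ω ×ˢ (Set.univ : Set (ℝ × (Fin (m + 1) → ℝ)))))
    (φ ψ : (Fin (m + 1) → ℝ) → ℝ)
    (hφ : ContDiffOn ℝ (⊤ : ℕ∞) φ Ω) (hψ : ContDiffOn ℝ (⊤ : ℕ∞) ψ Ω)
    (hQ : ∀ x ∈ Ω, Qop (m + 1) a b ψ x ≤ Qop (m + 1) a b φ x)
    -- (1) symmetry and nonnegativity of `(a^{ij})`
    (hsym : ∀ x p i j, a x p i j = a x p j i)
    (hnonneg : ∀ x p (ξ : Fin (m + 1) → ℝ), 0 ≤ ∑ i, ∑ j, a x p i j * ξ i * ξ j)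
    -- (2) `∂b/∂z ≤ 0`
    (hbz : ∀ x z p, deriv (fun t : ℝ => b x t p) z ≤ 0)
    -- (3′) constant rank of `ã^{ij}(x) = a^{ij}(x,Dφ(x))`
    (rr : ℕ) (hrank : ∀ x ∈ Ω, (a x (grad (m + 1) φ x)).rank = rr) :
    -- local existence of a sum-of-squares decomposition
    (∀ x₀ ∈ Ω, ∃ U : Set (Fin (m + 1) → ℝ), IsOpen U ∧ x₀ ∈ U ∧ U ⊆ Ω ∧
      ∃ (r : ℕ) (X : Fin r → ((Fin (m + 1) → ℝ) → (Fin (m + 1) → ℝ)))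
        (Y : (Fin (m + 1) → ℝ) → (Fin (m + 1) → ℝ)),
        (∀ k, ContDiffOn ℝ (⊤ : ℕ∞) (X k) U) ∧ ContDiffOn ℝ (⊤ : ℕ∞) Y U ∧
        (∀ f : (Fin (m + 1) → ℝ) → ℝ, ContDiff ℝ 2 f → ∀ x ∈ U,
          (∑ i, ∑ j, a x (grad (m + 1) φ x) i j * pd (m + 1) i (pd (m + 1) j f) x)
            = (∑ k, vApp (X k) (vApp (X k) f) x) + vApp Y f x)) ∧
    -- and the strong maximum principle for any such decomposition
    (∀ U : Set (Fin (m + 1) → ℝ), IsOpen U → U ⊆ Ω →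
      ∀ (r : ℕ) (X : Fin r → ((Fin (m + 1) → ℝ) → (Fin (m + 1) → ℝ)))
        (Y : (Fin (m + 1) → ℝ) → (Fin (m + 1) → ℝ)),
        (∀ k, ContDiffOn ℝ (⊤ : ℕ∞) (X k) U) → ContDiffOn ℝ (⊤ : ℕ∞) Y U →
        (∀ f : (Fin (m + 1) → ℝ) → ℝ, ContDiff ℝ 2 f → ∀ x ∈ U,
          (∑ i, ∑ j, a x (grad (m + 1) φ x) i j * pd (m + 1) i (pd (m + 1) j f) x)
            = (∑ k, vApp (X k) (vApp (X k) f) x) + vApp Y f x) →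
        ∀ Z : (Fin (m + 1) → ℝ) → (Fin (m + 1) → ℝ), LieSpan U (Set.range X) Z →
        ∀ I : Set ℝ, IsOpen I → IsPreconnected I →
        ∀ γ : ℝ → (Fin (m + 1) → ℝ), (∀ t ∈ I, γ t ∈ U) →
          (∀ t ∈ I, HasDerivAt γ (Z (γ t)) t) →
        ∀ t₀ ∈ I, (∀ x ∈ Ω, φ x - ψ x ≤ φ (γ t₀) - ψ (γ t₀)) →
          0 ≤ φ (γ t₀) - ψ (γ t₀) →
          ∀ t ∈ I, φ (γ t) - ψ (γ t) = φ (γ t₀) - ψ (γ t₀)) := by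
  have h1 : (1 : WithTop ℕ∞) ≤ ((⊤ : ℕ∞) : WithTop ℕ∞) := by exact_mod_cast le_top
  have h2 : (2 : WithTop ℕ∞) ≤ ((⊤ : ℕ∞) : WithTop ℕ∞) := WithTop.coe_le_coe.2 le_top
  refine ⟨fun x₀ hx₀ => ?_, ?_⟩
  · have hgrad : ContDiffOn ℝ (⊤ : ℕ∞) (grad (m + 1) φ) Ω := ContDiffOn.grad hΩopen hφ
    refine exists_sum_sq_decomposition hΩopen (A := fun x => a x (grad (m + 1) φ x))
      (fun i j => ?_) (fun x _ => ?_) hrank hx₀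
    · exact (ha_smooth i j).comp (contDiffOn_id.prodMk hgrad) fun x hx => ⟨hx, Set.mem_univ _⟩
    · refine Matrix.PosSemidef.of_dotProduct_mulVec_nonneg ?_ fun v => ?_
      · ext i j
        simp [hsym x _ i j]
      · refine (hnonneg x (grad (m + 1) φ x) v).trans_eq ?_
        simp only [dotProduct, Matrix.mulVec, Finset.mul_sum, star_trivial]
        exact Finset.sum_congr rfl fun i _ => Finset.sum_congr rfl fun j _ => by ring
  · intro U hU hUΩ r X Y hX _ hdec Z hZ I hI hIc γ hγU hγ t₀ ht₀ hM hM0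
    obtain ⟨C, hCc, hC⟩ := exists_isClosed_inter_setOf_eq
      ((hφ.continuousOn.sub hψ.continuousOn).mono hUΩ) (φ (γ t₀) - ψ (γ t₀))
    have hcoeff : ∀ x ∈ U, ∀ i j, a x (grad (m + 1) φ x) i j = ∑ k, X k x i * X k x j :=
      fun x hx i j => coeff_eq_of_decomposition (hsym x _)
        (fun k => (((hX k).contDiffAt (hU.mem_nhds hx)).of_le h1).differentiableAt one_ne_zero)
        (fun f hf => hdec f hf x hx) i j
    have hT := tangentTo_contact_set hΩopen hU hUΩ (fun i j => (ha_smooth i j).of_le h1)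
      (hb_smooth.of_le h1) (hφ.of_le h2) (hψ.of_le h2) hQ hbz (fun k => (hX k).continuousOn)
      hcoeff hM hM0 hC
    obtain ⟨hZs, hZT⟩ := hZ.contDiffOn_and_tangentTo hU hCc
      (Set.forall_mem_range.2 hX) (Set.forall_mem_range.2 hT)
    intro t ht
    exact (hC _ (hγU t ht)).1 (hZT.forall_mem_of_integralCurve hU hCc (hZs.of_le h1) hI hIc hγU hγ
      ht₀ ((hC _ (hγU t₀ ht₀)).2 rfl) t ht)
end
end

section
/- Let n ≥ 2 and let Ω ⊆ ℝ^{2n} be a domain with coordinates (η²,...,η^{2n},τ). For a C^∞ function u on Ω set D(u) := (1 − 2η^{n+1} u_τ)² + (u_{η^{n+1}})² + Σ_{j=2}^{n} [(u_{η^j} + η^{n+j} u_τ)² + (u_{η^{n+j}} − η^j u_τ)²], and wherever D(u) > 0 define H(u) := 2η^{n+1} ∂_τ((−1 + 2η^{n+1}u_τ)/√D(u)) + ∂_{η^{n+1}}(u_{η^{n+1}}/√D(u)) + Σ_{j=2}^{n} [(∂_{η^j} + η^{n+j}∂_τ)((u_{η^j} + η^{n+j}u_τ)/√D(u)) + (∂_{η^{n+j}}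 − η^j∂_τ)((u_{η^{n+j}} − η^j u_τ)/√D(u))]. Let u, v be C^∞ functions on Ω with D(u) > 0 and D(v) > 0 on Ω. If v = u at some point p₀ ∈ Ω, v ≥ u in Ω, and H(v) ≤ H(u) in Ω, then v ≡ u in a neighborhood of p₀. -/
open Set Finset

noncomputable section

/-- The `k`-th coordinate of a point of `ℝ^N` (zero if `k ≥ N`). -/
def cv (N k : ℕ) (x : Fin N → ℝ) : ℝ := if h : k < N then x ⟨k, h⟩ else 0

/-! Coordinates on `ℝ^{2n}` are `(η²,...,η^{2n},τ)`: the coordinate `η^j`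
(for `2 ≤ j ≤ 2n`) is the entry of index `j − 2` and `τ` is the entry of
index `2n − 1`. -/

/-- The value of the coordinate `η^j`. -/
def eta (n j : ℕ) (x : Fin (2 * n) → ℝ) : ℝ := cv (2 * n) (j - 2) x

/-- The partial derivative `∂_{η^j}`. -/
def dEta (n j : ℕ) (f : (Fin (2 * n) → ℝ) → ℝ) (x : Fin (2 * n) → ℝ) : ℝ :=
  pd (2 * n) (j - 2) f x

/-- The partial derivative `∂_τ`. -/
def dTau (n : ℕ) (f : (Fin (2 * n) → ℝ) → ℝ) (x : Fin (2 * n) → ℝ) : ℝ :=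
  pd (2 * n) (2 * n - 1) f x

/-- `D(u)`, the square of the length of the horizontal gradient of
`u(η²,...,η^{2n},τ) − x¹` for an `l_a` graph `u`. -/
def Dq (n : ℕ) (u : (Fin (2 * n) → ℝ) → ℝ) (x : Fin (2 * n) → ℝ) : ℝ :=
  (1 - 2 * eta n (n + 1) x * dTau n u x) ^ 2 + (dEta n (n + 1) u x) ^ 2 +
    ∑ j ∈ Finset.Icc 2 n,
      ((dEta n j u x + eta n (n + j) x * dTau n u x) ^ 2 +
       (dEta n (n + j) u x - eta n j x * dTau n u x) ^ 2)

/-- The horizontal (p-)mean curvature operator `H(u)` of the `l_a` graph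
`x¹ = u(η²,...,η^{2n},τ)`. -/
def Hla (n : ℕ) (u : (Fin (2 * n) → ℝ) → ℝ) (x : Fin (2 * n) → ℝ) : ℝ :=
  2 * eta n (n + 1) x *
      dTau n (fun y => (-1 + 2 * eta n (n + 1) y * dTau n u y) / Real.sqrt (Dq n u y)) x
    + dEta n (n + 1) (fun y => dEta n (n + 1) u y / Real.sqrt (Dq n u y)) x
    + ∑ j ∈ Finset.Icc 2 n,
        ((dEta n j (fun y => (dEta n j u y + eta n (n + j) y * dTau n u y) /
              Real.sqrt (Dq n u y)) x
          + eta n (n + j) x *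
            dTau n (fun y => (dEta n j u y + eta n (n + j) y * dTau n u y) /
              Real.sqrt (Dq n u y)) x)
        + (dEta n (n + j) (fun y => (dEta n (n + j) u y - eta n j y * dTau n u y) /
              Real.sqrt (Dq n u y)) x
          - eta n j x *
            dTau n (fun y => (dEta n (n + j) u y - eta n j y * dTau n u y) /
              Real.sqrt (Dq n u y)) x))

section ProximalNormal

variable {E : Type*} [NormedAddCommGroup E] [InnerProductSpace ℝ E]

/-- `ν` is a proximal normal of `Z` at `x`: the open ball of centre `x + ν` and radius `‖ν‖`
does not meet `Z`. -/
def IsProximalNormal (Z : Set E) (x ν : E) : Prop :=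
  x ∈ Z ∧ ∀ z ∈ Z, 2 * inner ℝ (z - x) ν ≤ ‖z - x‖ ^ 2

theorem isProximalNormal_sub_of_infDist_eq {Z : Set E} {y z : E} (hz : z ∈ Z)
    (h : Metric.infDist y Z = dist y z) : IsProximalNormal Z z (y - z) := by
  refine ⟨hz, fun x hx => ?_⟩
  have h1 : ‖y - z‖ ≤ ‖y - x‖ := by
    rw [← dist_eq_norm, ← dist_eq_norm, ← h]
    exact Metric.infDist_le_dist_of_mem hx
  have h2 : ‖y - x‖ ^ 2 = ‖y - z‖ ^ 2 - 2 * inner ℝ (x - z) (y - z) + ‖x - z‖ ^ 2 := by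
    rw [← real_inner_comm, ← norm_sub_sq_real]
    congr 2
    abel
  have h3 : ‖y - z‖ ^ 2 ≤ ‖y - x‖ ^ 2 := by gcongr
  linarith

theorem infDist_sq_le_of_inner_le [ProperSpace E] {Z : Set E} (hZ : IsClosed Z) {γ γ' : ℝ → E}
    (hγ : ∀ t, HasDerivAt γ (γ' t) t) (h0 : γ 0 ∈ Z) {K ε : ℝ} (hK : 0 ≤ K)
    (h : ∀ t ∈ Set.Ico (0 : ℝ) 1, ∀ z ∈ Z, Metric.infDist (γ t) Z = dist (γ t) z →
      inner ℝ (γ t - z) (γ' t) ≤ K * ‖γ t - z‖ ^ 2 + ε * ‖γ t - z‖) :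
    Metric.infDist (γ 1) Z ^ 2 ≤ ε ^ 2 * Real.exp (2 * K + 1) := by
  have hcont : Continuous γ := continuous_iff_continuousAt.2 fun t => (hγ t).continuousAt
  have key := le_gronwallBound_of_liminf_deriv_right_le
    (f := fun t => Metric.infDist (γ t) Z ^ 2)
    (f' := fun t => (2 * K + 1) * Metric.infDist (γ t) Z ^ 2 + ε ^ 2)
    (δ := 0) (K := 2 * K + 1) (ε := ε ^ 2) (a := 0) (b := 1)
    (((Metric.continuous_infDist_pt Z).comp hcont).pow 2).continuousOn ?_ ?_
    (fun _ _ => le_rfl) 1 (by simp)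
  · rw [gronwallBound_of_K_ne_0 (by positivity)] at key
    refine key.trans ?_
    have h1 : 0 < Real.exp (2 * K + 1) := Real.exp_pos _
    have h2 : ε ^ 2 / (2 * K + 1) ≤ ε ^ 2 := div_le_self (by positivity) (by linarith)
    have h3 : (1 : ℝ) ≤ Real.exp (2 * K + 1) := Real.one_le_exp (by positivity)
    have h4 : ε ^ 2 / (2 * K + 1) * (Real.exp (2 * K + 1) - 1)
        ≤ ε ^ 2 * Real.exp (2 * K + 1) := by
      apply mul_le_mul h2 (by linarith) (by linarith) (by positivity)
    simpa using h4
  · intro t ht r hr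
    obtain ⟨z, hz, hzd⟩ := hZ.exists_infDist_eq_dist ⟨_, h0⟩ (γ t)
    have hin := h t ht z hz hzd
    have hd : HasDerivAt (fun τ => ‖γ τ - z‖ ^ 2) (2 * inner ℝ (γ t - z) (γ' t)) t :=
      ((hγ t).sub_const z).norm_sq
    have hlt : 2 * inner ℝ (γ t - z) (γ' t) < r := by
      refine lt_of_le_of_lt ?_ hr
      rw [hzd, dist_eq_norm]
      nlinarith [sq_nonneg (ε - ‖γ t - z‖)]
    have hsl := (hasDerivAt_iff_tendsto_slope.1 hd).mono_left
      (nhdsWithin_mono t (fun y (hy : t < y) => hy.ne'))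
    refine Filter.Eventually.frequently ?_
    filter_upwards [hsl.eventually (gt_mem_nhds hlt), self_mem_nhdsWithin] with τ hτ hτt
    refine lt_of_le_of_lt ?_ hτ
    rw [slope_def_module, smul_eq_mul]
    have hτt' : 0 < τ - t := sub_pos.2 hτt
    have h5 : Metric.infDist (γ τ) Z ≤ ‖γ τ - z‖ := by
      rw [← dist_eq_norm]; exact Metric.infDist_le_dist_of_mem hz
    have h6 : Metric.infDist (γ τ) Z ^ 2 ≤ ‖γ τ - z‖ ^ 2 := by
      gcongr; exact Metric.infDist_nonneg
    rw [hzd, dist_eq_norm]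
    gcongr
  · simp [Metric.infDist_zero_of_mem h0]


theorem eventually_norm_sub_le_of_hasFDerivAt {F : Type*} [NormedAddCommGroup F] [NormedSpace ℝ F]
    {f : E → F} {f' : E →L[ℝ] F} {x : E} (hf : HasFDerivAt f f' x) {a d : ℝ → E}
    (ha : Continuous a) (hd : Continuous d) {η : ℝ} (hη : 0 < η) :
    ∀ᶠ s in nhdsWithin (0 : ℝ) (Set.Ioi 0), ∀ t ∈ Set.Icc (0 : ℝ) 1,
      ‖f (x + s • a t + s ^ 2 • d t) - f x - s • f' (a t)‖ ≤ η * s := by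
  obtain ⟨Ma, hMa⟩ := isCompact_Icc.exists_bound_of_continuousOn
    (ha.continuousOn (s := Set.Icc (0 : ℝ) 1))
  obtain ⟨Md, hMd⟩ := isCompact_Icc.exists_bound_of_continuousOn
    (hd.continuousOn (s := Set.Icc (0 : ℝ) 1))
  set M : ℝ := max (max Ma Md) 1
  have hM : 1 ≤ M := le_max_right _ _
  have hM0 : 0 < M := by linarith
  have hη1 : 0 < η / (4 * M) := by positivity
  obtain ⟨δ, hδ, hball⟩ := Metric.eventually_nhds_iff.1
    ((hasFDerivAt_iff_isLittleO.1 hf).def hη1)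
  have hs1 : ∀ᶠ s in nhdsWithin (0 : ℝ) (Set.Ioi 0), s < 1 :=
    nhdsWithin_le_nhds (gt_mem_nhds one_pos)
  have hs2 : ∀ᶠ s in nhdsWithin (0 : ℝ) (Set.Ioi 0), s < δ / (2 * M) :=
    nhdsWithin_le_nhds (gt_mem_nhds (by positivity))
  have hs3 : ∀ᶠ s in nhdsWithin (0 : ℝ) (Set.Ioi 0), s < η / (2 * (‖f'‖ + 1) * M) :=
    nhdsWithin_le_nhds (gt_mem_nhds (by positivity))
  filter_upwards [hs1, hs2, hs3, self_mem_nhdsWithin] with s h1 h2 h3 (h0 : 0 < s) t ht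
  have hat : ‖a t‖ ≤ M := (hMa t ht).trans ((le_max_left _ _).trans (le_max_left _ _))
  have hdt : ‖d t‖ ≤ M := (hMd t ht).trans ((le_max_right _ _).trans (le_max_left _ _))
  set y := x + s • a t + s ^ 2 • d t with hy
  have hyx : y - x = s • a t + s ^ 2 • d t := by rw [hy]; abel
  have hnorm : ‖y - x‖ ≤ 2 * M * s := by
    rw [hyx]
    refine (norm_add_le _ _).trans ?_
    rw [norm_smul, norm_smul, Real.norm_of_nonneg h0.le, Real.norm_of_nonneg (by positivity)]
    have e1 : s * ‖a t‖ ≤ s * M := by gcongr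
    have e2 : s ^ 2 * ‖d t‖ ≤ s * M := by
      have : s ^ 2 ≤ s := by nlinarith
      gcongr
    linarith
  have hdist : dist y x < δ := by
    rw [dist_eq_norm]
    refine lt_of_le_of_lt hnorm ?_
    rw [lt_div_iff₀ (by positivity)] at h2
    linarith
  have hb := hball hdist
  have e : f y - f x - s • f' (a t) = (f y - f x - f' (y - x)) + s ^ 2 • f' (d t) := by
    rw [hyx, map_add, map_smul, map_smul]; abel
  rw [e]
  refine (norm_add_le _ _).trans ?_
  have e1 : ‖f y - f x - f' (y - x)‖ ≤ η / 2 * s := by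
    refine hb.trans ?_
    calc η / (4 * M) * ‖y - x‖ ≤ η / (4 * M) * (2 * M * s) := by gcongr
      _ = η / 2 * s := by field_simp; ring
  have e2 : ‖s ^ 2 • f' (d t)‖ ≤ η / 2 * s := by
    rw [norm_smul, Real.norm_of_nonneg (by positivity)]
    have e3 : ‖f' (d t)‖ ≤ (‖f'‖ + 1) * M := by
      refine (f'.le_opNorm _).trans ?_
      gcongr
      linarith
    rw [lt_div_iff₀ (by positivity)] at h3
    calc s ^ 2 * ‖f' (d t)‖ ≤ s ^ 2 * ((‖f'‖ + 1) * M) := by gcongr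
      _ = s * (s * (2 * (‖f'‖ + 1) * M)) / 2 := by ring
      _ ≤ s * η / 2 := by gcongr
      _ = η / 2 * s := by ring
  linarith

theorem inner_smul_add_smul_le_of_norm_sub_le {w V₁ V₂ U₁ U₂ : E} {α β s L₁ L₂ : ℝ}
    (hα : |α| ≤ 1) (hβ : |β| ≤ 1) (hs : 0 ≤ s) (hs1 : s ≤ 1) (h₁ : inner ℝ w U₁ = 0)
    (h₂ : inner ℝ w U₂ = 0) (hV₁ : ‖V₁ - U₁‖ ≤ L₁ * ‖w‖) (hV₂ : ‖V₂ - U₂‖ ≤ L₂ * ‖w‖) :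
    inner ℝ w ((s * α) • V₁ + (s * β) • V₂) ≤ (L₁ + L₂) * ‖w‖ ^ 2 := by
  have key : ∀ {V U : E} {c L : ℝ}, |c| ≤ 1 → inner ℝ w U = 0 → ‖V - U‖ ≤ L * ‖w‖ →
      s * c * inner ℝ w V ≤ L * ‖w‖ ^ 2 := by
    intro V U c L hc hU hV
    have e : inner ℝ w V = inner ℝ w (V - U) := by rw [inner_sub_right, hU, sub_zero]
    have hsc : |s * c| ≤ 1 := by
      rw [abs_mul, abs_of_nonneg hs]
      exact mul_le_one₀ hs1 (abs_nonneg _) hc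
    calc s * c * inner ℝ w V ≤ |s * c| * |inner ℝ w (V - U)| := by
          rw [e, ← abs_mul]; exact le_abs_self _
      _ ≤ 1 * (‖w‖ * ‖V - U‖) := by
          gcongr
          exact abs_real_inner_le_norm _ _
      _ ≤ 1 * (‖w‖ * (L * ‖w‖)) := by gcongr
      _ = L * ‖w‖ ^ 2 := by ring
  rw [inner_add_right, real_inner_smul_right, real_inner_smul_right, add_mul]
  exact add_le_add (key hα h₁ hV₁) (key hβ h₂ hV₂)

theorem neg_inner_smul_add_smul_le {w R₁ R₂ : E} {α β s η : ℝ} (hα : |α| ≤ 1) (hβ : |β| ≤ 1)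
    (hs : 0 ≤ s) (hR₁ : ‖R₁‖ ≤ η / 2 * s) (hR₂ : ‖R₂‖ ≤ η / 2 * s) :
    -inner ℝ w ((s * α) • R₁ + (s * β) • R₂) ≤ η * s ^ 2 * ‖w‖ := by
  have key : ∀ {R : E} {c : ℝ}, |c| ≤ 1 → ‖R‖ ≤ η / 2 * s →
      -(s * c * inner ℝ w R) ≤ η / 2 * s ^ 2 * ‖w‖ := by
    intro R c hc hR
    have hsc : |s * c| ≤ s := by
      rw [abs_mul, abs_of_nonneg hs]
      exact mul_le_of_le_one_right hs hc
    calc -(s * c * inner ℝ w R) ≤ |s * c| * |inner ℝ w R| := by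
          rw [← abs_mul]; exact neg_le_abs _
      _ ≤ s * (‖w‖ * ‖R‖) := by
          gcongr
          exact abs_real_inner_le_norm _ _
      _ ≤ s * (‖w‖ * (η / 2 * s)) := by gcongr
      _ = η / 2 * s ^ 2 * ‖w‖ := by ring
  rw [inner_add_right, real_inner_smul_right, real_inner_smul_right]
  have h1 := key hα hR₁
  have h2 := key hβ hR₂
  linarith

theorem exists_bracket_loop (X₀ Y₀ : E) (X' Y' : E →L[ℝ] E) : ∃ (α β : ℝ → ℝ) (a d : ℝ → E),
    (∀ t ∈ Set.Icc (0 : ℝ) 1, |α t| ≤ 1 ∧ |β t| ≤ 1) ∧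
    (∀ t, HasDerivAt a (α t • X₀ + β t • Y₀) t) ∧
    (∀ t, HasDerivAt d (α t • X' (a t) + β t • Y' (a t)) t) ∧
    a 0 = 0 ∧ d 0 = 0 ∧ a 1 = 0 ∧ d 1 = (1 / 60 : ℝ) • (Y' X₀ - X' Y₀) := by
  let a : ℝ → E := fun t => (t - t ^ 2) • X₀ + (t ^ 2 - t ^ 3) • Y₀
  let d : ℝ → E := fun t => ((t - t ^ 2) ^ 2 / 2) • X' X₀ + ((t ^ 2 - t ^ 3) ^ 2 / 2) • Y' Y₀
    + ((t - t ^ 2) * (t ^ 2 - t ^ 3) - (2 / 3 * t ^ 3 - 5 / 4 * t ^ 4 + 3 / 5 * t ^ 5)) • X' Y₀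
    + (2 / 3 * t ^ 3 - 5 / 4 * t ^ 4 + 3 / 5 * t ^ 5) • Y' X₀
  have p1 : ∀ t : ℝ, HasDerivAt (fun t : ℝ => t - t ^ 2) (1 - 2 * t) t := fun t =>
    ((hasDerivAt_id t).sub (hasDerivAt_pow 2 t)).congr_deriv (by norm_num)
  have p2 : ∀ t : ℝ, HasDerivAt (fun t : ℝ => t ^ 2 - t ^ 3) (2 * t - 3 * t ^ 2) t := fun t =>
    ((hasDerivAt_pow 2 t).sub (hasDerivAt_pow 3 t)).congr_deriv (by norm_num)
  have ha' : ∀ t, HasDerivAt a ((1 - 2 * t) • X₀ + (2 * t - 3 * t ^ 2) • Y₀) t := by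
    intro t
    exact ((p1 t).smul_const _).add ((p2 t).smul_const _)
  have hd' : ∀ t, HasDerivAt d ((1 - 2 * t) • X' (a t) + (2 * t - 3 * t ^ 2) • Y' (a t)) t := by
    intro t
    have p3 : HasDerivAt (fun t : ℝ => 2 / 3 * t ^ 3 - 5 / 4 * t ^ 4 + 3 / 5 * t ^ 5)
        ((t - t ^ 2) * (2 * t - 3 * t ^ 2)) t := by
      have := (((hasDerivAt_pow 3 t).const_mul (2 / 3)).sub
        ((hasDerivAt_pow 4 t).const_mul (5 / 4))).add ((hasDerivAt_pow 5 t).const_mul (3 / 5))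
      refine this.congr_deriv ?_
      norm_num
      ring
    have := ((((((p1 t).pow 2).div_const 2).smul_const (X' X₀)).add
      ((((p2 t).pow 2).div_const 2).smul_const (Y' Y₀))).add
      ((((p1 t).mul (p2 t)).sub p3).smul_const (X' Y₀))).add (p3.smul_const (Y' X₀))
    refine this.congr_deriv ?_
    simp only [a, map_add, map_smul]
    norm_num
    module
  refine ⟨fun t => 1 - 2 * t, fun t => 2 * t - 3 * t ^ 2, a, d, fun t ht => ⟨?_, ?_⟩, ha', hd',
    ?_, ?_, ?_, ?_⟩
  · rw [abs_le]; constructor <;> linarith [ht.1, ht.2]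
  · rw [abs_le]; constructor <;> nlinarith [ht.1, ht.2]
  · simp [a]
  · simp [d]
  · simp [a]
  · simp only [d]
    norm_num
    module

theorem IsProximalNormal.inner_lieBracket_nonpos [ProperSpace E] {Z : Set E} (hZ : IsClosed Z)
    {X Y : E → E} {x ν : E} (hX : ContDiffAt ℝ 1 X x) (hY : ContDiffAt ℝ 1 Y x)
    (htan : ∀ᶠ z in nhds x, ∀ μ, IsProximalNormal Z z μ → inner ℝ μ (X z) = 0 ∧ inner ℝ μ (Y z) = 0)
    (hν : IsProximalNormal Z x ν) : inner ℝ (VectorField.lieBracket ℝ X Y x) ν ≤ 0 := by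
  obtain ⟨L₁, T₁, hT₁, hL₁⟩ := hX.exists_lipschitzOnWith
  obtain ⟨L₂, T₂, hT₂, hL₂⟩ := hY.exists_lipschitzOnWith
  obtain ⟨r, hr, hball⟩ := Metric.eventually_nhds_iff.1 (htan.and (Filter.inter_mem hT₁ hT₂))
  set X' := fderiv ℝ X x
  set Y' := fderiv ℝ Y x
  have hX' : HasFDerivAt X X' x := (hX.differentiableAt one_ne_zero).hasFDerivAt
  have hY' : HasFDerivAt Y Y' x := (hY.differentiableAt one_ne_zero).hasFDerivAt
  set b := VectorField.lieBracket ℝ X Y x with hb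
  have hb' : b = Y' (X x) - X' (Y x) := rfl
  obtain ⟨α, β, a, d, hαβ, ha', hd', ha0, hd0, ha1, hd1⟩ :=
     exists_bracket_loop (X x) (Y x) X' Y'
  have hac : Continuous a := continuous_iff_continuousAt.2 fun t => (ha' t).continuousAt
  have hdc : Continuous d := continuous_iff_continuousAt.2 fun t => (hd' t).continuousAt
  by_contra! hpos
  set p := inner ℝ b ν with hp
  set L : ℝ := L₁ + L₂ with hL
  have hL0 : 0 ≤ L := by positivity
  set C : ℝ := Real.exp (2 * L + 1) with hC
  have hC1 : 1 ≤ C := Real.one_le_exp (by positivity)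
  have hC0 : 0 < C := by linarith
  set η : ℝ := p / (120 * C * (‖ν‖ + 1)) with hηd
  have hη : 0 < η := by positivity
  have ev1 := eventually_norm_sub_le_of_hasFDerivAt hX' hac hdc (half_pos hη)
  have ev2 := eventually_norm_sub_le_of_hasFDerivAt hY' hac hdc (half_pos hη)
  have ev3 := eventually_norm_sub_le_of_hasFDerivAt (hasFDerivAt_id (𝕜 := ℝ) x) hac hdc one_pos
  obtain ⟨Ma, hMa⟩ := isCompact_Icc.exists_bound_of_continuousOn
    (hac.continuousOn (s := Set.Icc (0 : ℝ) 1))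
  have hMa0 : 0 ≤ Ma := (norm_nonneg _).trans (hMa 0 (by simp))
  have ev4 : ∀ᶠ s in nhdsWithin (0 : ℝ) (Set.Ioi 0), s < 1 :=
    nhdsWithin_le_nhds (gt_mem_nhds one_pos)
  have ev5 : ∀ᶠ s in nhdsWithin (0 : ℝ) (Set.Ioi 0), s < r / (2 * (Ma + 1)) :=
    nhdsWithin_le_nhds (gt_mem_nhds (by positivity))
  have ev6 : ∀ᶠ s in nhdsWithin (0 : ℝ) (Set.Ioi 0),
      s < p / (60 * ((‖b‖ + η * C) ^ 2 + 1)) :=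
    nhdsWithin_le_nhds (gt_mem_nhds (by positivity))
  obtain ⟨s, h1, h2, h3, h4, h5, h6, h0⟩ := (ev1.and (ev2.and (ev3.and (ev4.and (ev5.and
    (ev6.and self_mem_nhdsWithin)))))).exists
  replace h0 : 0 < s := h0
  set γ : ℝ → E := fun t => x + s • a t + s ^ 2 • d t with hγ
  have hγ' : ∀ t, HasDerivAt γ (s • (α t • X x + β t • Y x)
      + s ^ 2 • (α t • X' (a t) + β t • Y' (a t))) t := fun t =>
    (((ha' t).const_smul s).const_add x).add ((hd' t).const_smul (s ^ 2))
  have hγ0 : γ 0 = x := by simp [hγ, ha0, hd0]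
  have hγ1 : γ 1 = x + (s ^ 2 / 60) • b := by
    simp only [hγ, ha1, hd1, hb']
    module
  have hγx : ∀ t ∈ Set.Icc (0 : ℝ) 1, dist (γ t) x < r / 2 := by
    intro t ht
    have e1 := h3 t ht
    simp only [id, ContinuousLinearMap.coe_id', one_mul] at e1
    rw [dist_eq_norm]
    have e2 : γ t - x = (γ t - x - s • a t) + s • a t := by abel
    have e3 : ‖s • a t‖ ≤ s * Ma := by
      rw [norm_smul, Real.norm_of_nonneg h0.le]
      have := hMa t ht
      gcongr
    have e4 : ‖γ t - x‖ ≤ s + s * Ma := by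
      rw [e2]
      exact (norm_add_le _ _).trans (add_le_add e1 e3)
    rw [lt_div_iff₀ (by positivity)] at h5
    linarith
  have hx : x ∈ Z := hν.1
  have main := infDist_sq_le_of_inner_le hZ hγ' (hγ0 ▸ hx) (K := L) (ε := η * s ^ 2) hL0 ?_
  · obtain ⟨z, hz, hzd⟩ := hZ.exists_infDist_eq_dist ⟨_, hx⟩ (γ 1)
    rw [hzd, dist_comm, dist_eq_norm] at main
    set q := z - γ 1 with hq
    have hqn : ‖q‖ ≤ η * C * s ^ 2 := by
      refine le_of_sq_le_sq ?_ (by positivity)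
      refine main.trans ?_
      have : C ≤ C ^ 2 := by nlinarith
      calc (η * s ^ 2) ^ 2 * C ≤ (η * s ^ 2) ^ 2 * C ^ 2 := by gcongr
        _ = (η * C * s ^ 2) ^ 2 := by ring
    have hzx : z - x = (s ^ 2 / 60) • b + q := by rw [hq, hγ1]; abel
    have hfin := hν.2 z hz
    have e1 : ‖z - x‖ ≤ s ^ 2 * (‖b‖ + η * C) := by
      rw [hzx]
      refine (norm_add_le _ _).trans ?_
      rw [norm_smul, Real.norm_of_nonneg (by positivity)]
      have : s ^ 2 / 60 * ‖b‖ ≤ s ^ 2 * ‖b‖ := by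
        gcongr
        linarith [sq_nonneg s]
      linarith
    have e2 : ‖z - x‖ ^ 2 ≤ (s ^ 2 * (‖b‖ + η * C)) ^ 2 := by gcongr
    have e3 : inner ℝ (z - x) ν = s ^ 2 / 60 * p + inner ℝ q ν := by
      rw [hzx, inner_add_left, real_inner_smul_left]
    have e4 : -(η * C * s ^ 2 * ‖ν‖) ≤ inner ℝ q ν := by
      have := (abs_le.1 (abs_real_inner_le_norm q ν)).1
      have : ‖q‖ * ‖ν‖ ≤ η * C * s ^ 2 * ‖ν‖ := by gcongr
      linarith
    have e5 : η * C * ‖ν‖ ≤ p / 120 := by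
      rw [hηd]
      have : p / (120 * C * (‖ν‖ + 1)) * C * ‖ν‖ = p / 120 * (‖ν‖ / (‖ν‖ + 1)) := by
        field_simp
      rw [this]
      apply mul_le_of_le_one_right (by positivity)
      rw [div_le_one (by positivity)]
      linarith
    set Q := (‖b‖ + η * C) ^ 2 with hQ
    have e6 : s * (60 * (Q + 1)) < p := by rwa [lt_div_iff₀ (by positivity)] at h6
    have e7 : s ^ 2 * (p / 60) ≤ s ^ 2 * (s ^ 2 * Q) := by
      have : (s ^ 2 * (‖b‖ + η * C)) ^ 2 = s ^ 2 * (s ^ 2 * Q) := by rw [hQ]; ring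
      have e8 : s ^ 2 * (η * C * ‖ν‖) ≤ s ^ 2 * (p / 120) := by gcongr
      linarith
    have e8 : p / 60 ≤ s ^ 2 * Q := le_of_mul_le_mul_left e7 (by positivity)
    have e9 : s ^ 2 * Q ≤ s * Q := by
      have : s ^ 2 ≤ s := by nlinarith
      have : 0 ≤ Q := by positivity
      gcongr
    linarith
  · intro t ht z hz hzd
    have htc : t ∈ Set.Icc (0 : ℝ) 1 := ⟨ht.1, ht.2.le⟩
    have hn := isProximalNormal_sub_of_infDist_eq hz hzd
    have hdx := hγx t htc
    have hd2 : dist (γ t) z < r / 2 := by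
      rw [← hzd]
      exact (Metric.infDist_le_dist_of_mem hx).trans_lt hdx
    have hd3 : dist z x < r := by
      have := dist_triangle z (γ t) x
      rw [dist_comm z (γ t)] at this
      linarith
    obtain ⟨hz1, hz2⟩ := hball hd3
    obtain ⟨-, hγ2⟩ := hball (hdx.trans (by linarith))
    obtain ⟨k1, k2⟩ := hz1 _ hn
    set w := γ t - z with hw
    obtain ⟨hA, hB⟩ := hαβ t htc
    have l1 : ‖X (γ t) - X z‖ ≤ L₁ * ‖w‖ :=
      hL₁.norm_sub_le hγ2.1 hz2.1
    have l2 : ‖Y (γ t) - Y z‖ ≤ L₂ * ‖w‖ :=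
      hL₂.norm_sub_le hγ2.2 hz2.2
    have dec : s • (α t • X x + β t • Y x)
        + s ^ 2 • (α t • X' (a t) + β t • Y' (a t))
        = ((s * α t) • X (γ t) + (s * β t) • Y (γ t))
          - ((s * α t) • (X (γ t) - X x - s • X' (a t))
            + (s * β t) • (Y (γ t) - Y x - s • Y' (a t))) := by
      module
    rw [dec, inner_sub_right]
    have m1 := inner_smul_add_smul_le_of_norm_sub_le hA hB h0.le h4.le k1 k2 l1 l2
    have m2 := neg_inner_smul_add_smul_le (w := w) hA hB h0.le (h1 t htc) (h2 t htc)
    linarith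

theorem IsProximalNormal.inner_lieBracket_eq_zero [ProperSpace E] {Z : Set E} (hZ : IsClosed Z)
    {X Y : E → E} {x ν : E} (hX : ContDiffAt ℝ 1 X x) (hY : ContDiffAt ℝ 1 Y x)
    (htan : ∀ᶠ z in nhds x, ∀ μ, IsProximalNormal Z z μ → inner ℝ μ (X z) = 0 ∧ inner ℝ μ (Y z) = 0)
    (hν : IsProximalNormal Z x ν) : inner ℝ (VectorField.lieBracket ℝ X Y x) ν = 0 := by
  refine le_antisymm (hν.inner_lieBracket_nonpos hZ hX hY htan) ?_
  have h := hν.inner_lieBracket_nonpos hZ hY hX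
    (htan.mono fun z hz μ hμ => (hz μ hμ).symm)
  rw [VectorField.lieBracket_swap, inner_neg_left] at h
  linarith

end ProximalNormal

section MeanCurvature

variable {E ι : Type*} [NormedAddCommGroup E] [NormedSpace ℝ E]

/-- The derivatives of `u` along the fields `W i`, shifted by the constants `e i`. -/
def horizGrad (W : ι → E → E) (e : ι → ℝ) (u : E → ℝ) (i : ι) (x : E) : ℝ :=
  fderiv ℝ u x (W i x) + e i

/-- The derivatives along the fields `W i` of the components of the shifted gradient. -/
def horizHess (W : ι → E → E) (e : ι → ℝ) (u : E → ℝ) (i k : ι) (x : E) : ℝ :=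
  fderiv ℝ (horizGrad W e u k) x (W i x)

/-- The first and second order data of `u` on which its mean curvature depends. -/
def horizJet (W : ι → E → E) (e : ι → ℝ) (u : E → ℝ) (x : E) : (ι → ℝ) × (ι → ι → ℝ) :=
  (fun i => horizGrad W e u i x, fun i k => horizHess W e u i k x)

variable {W : ι → E → E} {e : ι → ℝ} {u g : E → ℝ} {x : E}

theorem contDiffAt_horizGrad (hW : ∀ i, ContDiff ℝ 1 (W i)) (e : ι → ℝ)
    (hu : ContDiffAt ℝ 2 u x) (i : ι) : ContDiffAt ℝ 1 (horizGrad W e u i) x :=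
  ((hu.fderiv_right (m := 1) (by norm_num)).clm_apply (hW i).contDiffAt).add contDiffAt_const

theorem horizHess_eq (hW : ∀ i, ContDiff ℝ 1 (W i)) (e : ι → ℝ) (hu : ContDiffAt ℝ 2 u x)
    (i k : ι) : horizHess W e u i k x =
      fderiv ℝ (fderiv ℝ u) x (W i x) (W k x) + fderiv ℝ u x (fderiv ℝ (W k) x (W i x)) := by
  have h1 : HasFDerivAt (fderiv ℝ u) (fderiv ℝ (fderiv ℝ u) x) x :=
    ((hu.fderiv_right (m := 1) (by norm_num)).differentiableAt one_ne_zero).hasFDerivAt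
  have h2 : HasFDerivAt (W k) (fderiv ℝ (W k) x) x :=
    ((hW k).contDiffAt.differentiableAt one_ne_zero).hasFDerivAt
  have h3 : HasFDerivAt (horizGrad W e u k) _ x := (h1.clm_apply h2).add_const (e k)
  rw [horizHess, h3.fderiv]
  simp [add_comm]

theorem continuousAt_horizJet (hW : ∀ i, ContDiff ℝ 1 (W i)) (e : ι → ℝ)
    (hu : ContDiffAt ℝ 2 u x) : ContinuousAt (horizJet W e u) x := by
  refine ContinuousAt.prodMk (continuousAt_pi.2 fun i =>
    (contDiffAt_horizGrad hW e hu i).continuousAt)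
    (continuousAt_pi.2 fun i => continuousAt_pi.2 fun k => ?_)
  have h := (contDiffAt_horizGrad hW e hu k).fderiv_right (m := 0) (by norm_num)
  exact (h.clm_apply ((hW i).contDiffAt.of_le zero_le_one)).continuousAt

theorem fderiv_fderiv_add (hu : ContDiffAt ℝ 2 u x) (hg : ContDiffAt ℝ 2 g x) :
    fderiv ℝ (fderiv ℝ (u + g)) x = fderiv ℝ (fderiv ℝ u) x + fderiv ℝ (fderiv ℝ g) x := by
  have h : fderiv ℝ (u + g) =ᶠ[nhds x] fderiv ℝ u + fderiv ℝ g := by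
    filter_upwards [hu.eventually (by simp), hg.eventually (by simp)] with y h1 h2
    exact fderiv_add (h1.differentiableAt two_ne_zero) (h2.differentiableAt two_ne_zero)
  rw [h.fderiv_eq]
  exact fderiv_add ((hu.fderiv_right (m := 1) (by norm_num)).differentiableAt one_ne_zero)
    ((hg.fderiv_right (m := 1) (by norm_num)).differentiableAt one_ne_zero)

theorem horizJet_add (hW : ∀ i, ContDiff ℝ 1 (W i)) (e : ι → ℝ) (hu : ContDiffAt ℝ 2 u x)
    (hg : ContDiffAt ℝ 2 g x) : horizJet W e (u + g) x = horizJet W e u x + horizJet W 0 g x := by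
  have h : fderiv ℝ (u + g) x = fderiv ℝ u x + fderiv ℝ g x :=
    fderiv_add (hu.differentiableAt two_ne_zero) (hg.differentiableAt two_ne_zero)
  refine Prod.ext (funext fun i => ?_) (funext fun i => funext fun k => ?_)
  · simp only [horizJet, horizGrad, h, Prod.fst_add, Pi.add_apply, Pi.zero_apply,
      _root_.add_apply]
    ring
  · have hug : ContDiffAt ℝ 2 (u + g) x := hu.add hg
    simp only [horizJet, horizHess_eq hW _ hug, horizHess_eq hW _ hu, horizHess_eq hW _ hg,
      h, fderiv_fderiv_add hu hg, Prod.snd_add, Pi.add_apply, _root_.add_apply]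
    ring

theorem horizJet_const_smul (hW : ∀ i, ContDiff ℝ 1 (W i)) (c : ℝ) (hg : ContDiffAt ℝ 2 g x) :
    horizJet W 0 (c • g) x = c • horizJet W 0 g x := by
  have h : fderiv ℝ (c • g) = c • fderiv ℝ g := fderiv_const_smul_field c
  have h2 : fderiv ℝ (c • fderiv ℝ g) x = c • fderiv ℝ (fderiv ℝ g) x :=
    fderiv_const_smul ((hg.fderiv_right (m := 1) (by norm_num)).differentiableAt one_ne_zero) c
  have hcg : ContDiffAt ℝ 2 (c • g) x := contDiffAt_const.smul hg
  refine Prod.ext (funext fun i => ?_) (funext fun i => funext fun k => ?_)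
  · simp [horizJet, horizGrad, h]
  · simp [horizJet, horizHess_eq hW _ hcg, horizHess_eq hW _ hg, h, h2, mul_add]

variable [Fintype ι]

/-- The divergence along the fields `W i` of the normalized shifted gradient. -/
def horizMeanCurv (W : ι → E → E) (e : ι → ℝ) (u : E → ℝ) (x : E) : ℝ :=
  ∑ i, fderiv ℝ (fun y => horizGrad W e u i y / √(∑ k, horizGrad W e u k y ^ 2)) x (W i x)

/-- The numerator of the mean curvature, as a function of gradient and Hessian. -/
def curvForm (F : ι → ℝ) (m : ι → ι → ℝ) : ℝ :=
  (∑ i, F i ^ 2) * ∑ i, m i i - ∑ i, ∑ k, F i * F k * m i k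

/-- The mean curvature, as a function of gradient and Hessian. -/
def curvFun (p : (ι → ℝ) × (ι → ι → ℝ)) : ℝ :=
  curvForm p.1 p.2 / √(∑ i, p.1 i ^ 2) ^ 3

theorem curvForm_add (F : ι → ℝ) (m m' : ι → ι → ℝ) :
    curvForm F (m + m') = curvForm F m + curvForm F m' := by
  simp only [curvForm, Pi.add_apply, Finset.sum_add_distrib, mul_add]
  ring

theorem curvForm_smul (F : ι → ℝ) (c : ℝ) (m : ι → ι → ℝ) :
    curvForm F (c • m) = c * curvForm F m := by
  simp only [curvForm, Pi.smul_apply, smul_eq_mul, mul_sub, Finset.mul_sum]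
  congr 1
  · exact Finset.sum_congr rfl fun i _ => by ring
  · exact Finset.sum_congr rfl fun i _ => Finset.sum_congr rfl fun k _ => by ring

theorem two_mul_curvForm (F : ι → ℝ) (m : ι → ι → ℝ) :
    2 * curvForm F m = ∑ i, ∑ k,
      (F i ^ 2 * m k k - F i * F k * m k i - F k * F i * m i k + F k ^ 2 * m i i) := by
  simp only [Finset.sum_add_distrib, Finset.sum_sub_distrib]
  rw [Finset.sum_comm (f := fun i k => F k ^ 2 * m i i),
    Finset.sum_comm (f := fun i k => F i * F k * m k i)]
  simp only [← Finset.mul_sum, ← Finset.sum_mul, mul_comm (F _) (F _)]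
  simp only [curvForm]
  have : ∑ i, ∑ k, F k * F i * m i k = ∑ i, ∑ k, F i * F k * m i k :=
    Finset.sum_congr rfl fun i _ => Finset.sum_congr rfl fun k _ => by ring
  linarith

theorem curvForm_nonneg_of_nonneg (F : ι → ℝ) (B : E →L[ℝ] E →L[ℝ] ℝ) (hB : ∀ ξ, 0 ≤ B ξ ξ)
    (w : ι → E) : 0 ≤ curvForm F fun i k => B (w i) (w k) := by
  have h : 0 ≤ 2 * curvForm F fun i k => B (w i) (w k) := by
    rw [two_mul_curvForm]
    refine Finset.sum_nonneg fun i _ => Finset.sum_nonneg fun k _ => ?_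
    refine (hB (F i • w k - F k • w i)).trans_eq ?_
    simp only [map_sub, map_smul, _root_.sub_apply, _root_.smul_apply,
      smul_eq_mul]
    ring
  linarith

theorem curvForm_mul_pos {F p : ι → ℝ} {i k : ι} (h : F i * p k ≠ F k * p i) :
    0 < curvForm F fun i k => p i * p k := by
  have h : 0 < 2 * curvForm F fun i k => p i * p k := by
    rw [two_mul_curvForm]
    have e : ∀ i k, F i ^ 2 * (p k * p k) - F i * F k * (p k * p i) - F k * F i * (p i * p k)
        + F k ^ 2 * (p i * p i) = (F i * p k - F k * p i) ^ 2 := fun i k => by ring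
    simp only [e]
    refine Finset.sum_pos' (fun i _ => Finset.sum_nonneg fun k _ => sq_nonneg _)
      ⟨i, Finset.mem_univ _, Finset.sum_pos' (fun k _ => sq_nonneg _)
        ⟨k, Finset.mem_univ _, ?_⟩⟩
    have := sub_ne_zero.2 h
    positivity
  linarith

theorem contDiffAt_curvFun {p : (ι → ℝ) × (ι → ι → ℝ)} (hp : 0 < ∑ i, p.1 i ^ 2) :
    ContDiffAt ℝ 1 curvFun p := by
  have h1 : ∀ i, ContDiff ℝ 1 fun q : (ι → ℝ) × (ι → ι → ℝ) => q.1 i := fun i =>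
    (contDiff_apply ℝ ℝ i).comp contDiff_fst
  have h2 : ∀ i k, ContDiff ℝ 1 fun q : (ι → ℝ) × (ι → ι → ℝ) => q.2 i k := fun i k =>
    (contDiff_apply_apply ℝ ℝ i k).comp contDiff_snd
  have h3 : ContDiff ℝ 1 fun q : (ι → ℝ) × (ι → ι → ℝ) => ∑ i, q.1 i ^ 2 :=
    ContDiff.sum fun i _ => (h1 i).pow 2
  refine ContDiffAt.div ?_ ((h3.contDiffAt.sqrt hp.ne').pow 3) (by positivity)
  refine ContDiff.contDiffAt ?_
  exact (h3.mul (ContDiff.sum fun i _ => h2 i i)).sub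
    (ContDiff.sum fun i _ => ContDiff.sum fun k _ => ((h1 i).mul (h1 k)).mul (h2 i k))

theorem fderiv_curvFun_apply_zero_left {p : (ι → ℝ) × (ι → ι → ℝ)} (hp : 0 < ∑ i, p.1 i ^ 2)
    (m : ι → ι → ℝ) :
    fderiv ℝ curvFun p (0, m) = curvForm p.1 m / √(∑ i, p.1 i ^ 2) ^ 3 := by
  have h1 : HasFDerivAt curvFun (fderiv ℝ curvFun p) (p + (0 : ℝ) • ((0, m) :
      (ι → ℝ) × (ι → ι → ℝ))) := by
    rw [zero_smul, add_zero]
    exact ((contDiffAt_curvFun hp).differentiableAt one_ne_zero).hasFDerivAt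
  have h2 : HasDerivAt (fun t : ℝ => p + t • ((0, m) : (ι → ℝ) × (ι → ι → ℝ)))
      ((1 : ℝ) • (0, m)) 0 := ((hasDerivAt_id (0 : ℝ)).smul_const _).const_add p
  have h3 := h1.comp_hasDerivAt 0 h2
  have h4 : HasDerivAt (fun t : ℝ => curvFun p + t * (curvForm p.1 m / √(∑ i, p.1 i ^ 2) ^ 3))
      (curvForm p.1 m / √(∑ i, p.1 i ^ 2) ^ 3) 0 := by
    simpa using ((hasDerivAt_id (0 : ℝ)).mul_const
      (curvForm p.1 m / √(∑ i, p.1 i ^ 2) ^ 3)).const_add (curvFun p)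
  have h5 : (curvFun ∘ fun t : ℝ => p + t • ((0, m) : (ι → ℝ) × (ι → ι → ℝ))) =
      fun t : ℝ => curvFun p + t * (curvForm p.1 m / √(∑ i, p.1 i ^ 2) ^ 3) := by
    funext t
    simp only [Function.comp_apply, curvFun, Prod.fst_add, Prod.snd_add, Prod.smul_fst,
      Prod.smul_snd, smul_zero, add_zero, curvForm_add, curvForm_smul]
    ring
  rw [h5] at h3
  simpa using h3.unique h4

theorem horizMeanCurv_eq (hW : ∀ i, ContDiff ℝ 1 (W i)) (hu : ContDiffAt ℝ 2 u x)
    (hD : 0 < ∑ i, horizGrad W e u i x ^ 2) :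
    horizMeanCurv W e u x = curvFun (horizJet W e u x) := by
  have hF : ∀ i, HasFDerivAt (horizGrad W e u i) (fderiv ℝ (horizGrad W e u i) x) x := fun i =>
    ((contDiffAt_horizGrad hW e hu i).differentiableAt one_ne_zero).hasFDerivAt
  have hS : HasFDerivAt (fun y => ∑ k, horizGrad W e u k y ^ 2)
      (∑ k, (2 * horizGrad W e u k x) • fderiv ℝ (horizGrad W e u k) x) x := by
    refine HasFDerivAt.fun_sum fun k _ => ?_
    simpa using (hF k).pow 2
  set D := ∑ i, horizGrad W e u i x ^ 2 with hDdef
  have hs : 0 < √D := Real.sqrt_pos.2 hD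
  have hsq : √D ^ 2 = D := Real.sq_sqrt hD.le
  have hq : ∀ i, fderiv ℝ (fun y => horizGrad W e u i y / √(∑ k, horizGrad W e u k y ^ 2)) x (W i x)
      = (D * horizHess W e u i i x
        - ∑ k, horizGrad W e u i x * horizGrad W e u k x * horizHess W e u i k x) / √D ^ 3 := by
    intro i
    have h := (hF i).mul (((Real.hasDerivAt_sqrt hD.ne').inv hs.ne').comp_hasFDerivAt x hS)
    have h' : HasFDerivAt (fun y => horizGrad W e u i y / √(∑ k, horizGrad W e u k y ^ 2)) _ x := h
    rw [h'.fderiv]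
    simp only [_root_.add_apply, _root_.smul_apply,
      _root_.sum_apply, smul_eq_mul, Function.comp_apply, ← hDdef]
    change _ * (_ * ∑ k, 2 * horizGrad W e u k x * horizHess W e u i k x) + _ * horizHess W e u i i x
      = _
    have e1 : ∑ k, 2 * horizGrad W e u k x * horizHess W e u i k x
        = 2 * ∑ k, horizGrad W e u k x * horizHess W e u i k x := by
      rw [Finset.mul_sum]; exact Finset.sum_congr rfl fun k _ => by ring
    have e2 : ∑ k, horizGrad W e u i x * horizGrad W e u k x * horizHess W e u i k x
        = horizGrad W e u i x * ∑ k, horizGrad W e u k x * horizHess W e u i k x := by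
      rw [Finset.mul_sum]; exact Finset.sum_congr rfl fun k _ => by ring
    rw [e1, e2]
    simp only [Pi.inv_apply]
    rw [show D * horizHess W e u i i x = √D ^ 2 * horizHess W e u i i x by rw [hsq]]
    field_simp
    ring
  rw [horizMeanCurv, Finset.sum_congr rfl fun i _ => hq i, ← Finset.sum_div,
    Finset.sum_sub_distrib, ← Finset.mul_sum]
  rfl

end MeanCurvature

section BarrierComparison

variable {E ι : Type*} [NormedAddCommGroup E] [NormedSpace ℝ E]

theorem fderiv_fderiv_nonneg_of_isLocalMin {g : E → ℝ} {x : E} (hg : ContDiffAt ℝ 2 g x)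
    (hmin : IsLocalMin g x) (ξ : E) : 0 ≤ fderiv ℝ (fderiv ℝ g) x ξ ξ := by
  have hl : ∀ t : ℝ, HasDerivAt (fun t : ℝ => x + t • ξ) ξ t := fun t => by
    simpa using ((hasDerivAt_id t).smul_const ξ).const_add x
  have hl0 : Filter.Tendsto (fun t : ℝ => x + t • ξ) (nhds 0) (nhds x) := by
    simpa using (hl 0).continuousAt.tendsto
  have hd : deriv (fun t : ℝ => g (x + t • ξ)) =ᶠ[nhds 0] fun t => fderiv ℝ g (x + t • ξ) ξ := by
    filter_upwards [hl0.eventually (hg.eventually (by simp))] with t ht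
    exact ((ht.differentiableAt two_ne_zero).hasFDerivAt.comp_hasDerivAt t (hl t)).deriv
  have h2 : deriv (deriv fun t : ℝ => g (x + t • ξ)) 0 = fderiv ℝ (fderiv ℝ g) x ξ ξ := by
    rw [hd.deriv_eq]
    have h := ((hg.fderiv_right (m := 1) (by norm_num)).differentiableAt one_ne_zero).hasFDerivAt
    have h' : HasFDerivAt (fderiv ℝ g) (fderiv ℝ (fderiv ℝ g) x) (x + (0 : ℝ) • ξ) := by simpa
    have h3 : HasDerivAt (fun t : ℝ => fderiv ℝ g (x + t • ξ)) (fderiv ℝ (fderiv ℝ g) x ξ) 0 :=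
      h'.comp_hasDerivAt 0 (hl 0)
    have h4 := h3.clm_apply (hasDerivAt_const (0 : ℝ) ξ)
    rw [h4.deriv, map_zero, add_zero]
  have hmin' : IsLocalMin (fun t : ℝ => g (x + t • ξ)) 0 := by
    have := hl0.eventually hmin
    simpa [IsLocalMin, IsMinFilter] using this
  by_contra! hneg
  have hc : ContinuousAt (fun t : ℝ => g (x + t • ξ)) 0 := by
    refine ContinuousAt.comp ?_ (hl 0).continuousAt
    simpa using hg.continuousAt
  have hmax := isLocalMax_of_deriv_deriv_neg (h2 ▸ hneg) hmin'.deriv_eq_zero hc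
  have hconst : (fun t : ℝ => g (x + t • ξ)) =ᶠ[nhds 0] fun _ => g (x + (0 : ℝ) • ξ) := by
    filter_upwards [hmin', hmax] with t h1 h2
    exact le_antisymm h2 h1
  have := hconst.deriv.deriv_eq
  simp [h2] at this
  exact hneg.ne this

variable [Fintype ι] {W : ι → E → E} {e : ι → ℝ} {u v h : E → ℝ} {x x₀ : E}

theorem curvFun_le_horizMeanCurv_of_isLocalMin (hW : ∀ i, ContDiff ℝ 1 (W i))
    (hu : ContDiffAt ℝ 2 u x) (hv : ContDiffAt ℝ 2 v x) (hh : ContDiffAt ℝ 2 h x)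
    (hmin : IsLocalMin (v - (u + h)) x)
    (hD : 0 < ∑ i, (horizJet W e u x + horizJet W 0 h x).1 i ^ 2) :
    curvFun (horizJet W e u x + horizJet W 0 h x) ≤ horizMeanCurv W e v x := by
  have huh : ContDiffAt ℝ 2 (u + h) x := hu.add hh
  have hg : ContDiffAt ℝ 2 (v - (u + h)) x := hv.sub huh
  have hv' : v = (u + h) + (v - (u + h)) := by abel
  have hJ : horizJet W e v x = (horizJet W e u x + horizJet W 0 h x)
      + ((0, fun i k => fderiv ℝ (fderiv ℝ (v - (u + h))) x (W i x) (W k x)) :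
        (ι → ℝ) × (ι → ι → ℝ)) := by
    conv_lhs => rw [hv']
    rw [horizJet_add hW e huh hg, horizJet_add hW e hu hh]
    congr 1
    refine Prod.ext (funext fun i => ?_) (funext fun i => funext fun k => ?_)
    · simp [horizJet, horizGrad, hmin.fderiv_eq_zero]
    · simp [horizJet, horizHess_eq hW 0 hg, hmin.fderiv_eq_zero]
  set p := horizJet W e u x + horizJet W 0 h x
  have h1 : (fun i => horizGrad W e v i x) = p.1 :=
    (congrArg Prod.fst hJ).trans (add_zero _)
  have hD' : 0 < ∑ i, horizGrad W e v i x ^ 2 := by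
    simpa [← h1] using hD
  rw [horizMeanCurv_eq hW hv hD', hJ]
  simp only [curvFun, Prod.fst_add, Prod.snd_add, add_zero, curvForm_add]
  gcongr
  exact le_add_of_nonneg_right
    (curvForm_nonneg_of_nonneg _ _ (fderiv_fderiv_nonneg_of_isLocalMin hg hmin) _)

theorem eventually_curvFun_lt (hW : ∀ i, ContDiff ℝ 1 (W i))
    (hu : ContDiffAt ℝ 2 u x₀) (hD : 0 < ∑ i, horizGrad W e u i x₀ ^ 2)
    (hh : ContDiffAt ℝ 2 h x₀)
    (hpos : 0 < fderiv ℝ curvFun (horizJet W e u x₀) (horizJet W 0 h x₀)) :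
    ∀ᶠ p : ℝ × E in nhds (0, x₀), 0 < ∑ i, horizGrad W e u i p.2 ^ 2 ∧
      0 < ∑ i, (horizJet W e u p.2 + p.1 • horizJet W 0 h p.2).1 i ^ 2 ∧
      (0 < p.1 → curvFun (horizJet W e u p.2) <
        curvFun (horizJet W e u p.2 + p.1 • horizJet W 0 h p.2)) := by
  have hJu : Filter.Tendsto (fun p : ℝ × E => horizJet W e u p.2) (nhds (0, x₀))
      (nhds (horizJet W e u x₀)) := (continuousAt_horizJet hW e hu).tendsto.comp continuousAt_snd
  have hJh : Filter.Tendsto (fun p : ℝ × E => horizJet W 0 h p.2) (nhds (0, x₀))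
      (nhds (horizJet W 0 h x₀)) := (continuousAt_horizJet hW 0 hh).tendsto.comp continuousAt_snd
  have hJ : Filter.Tendsto (fun p : ℝ × E => horizJet W e u p.2 + p.1 • horizJet W 0 h p.2)
      (nhds (0, x₀)) (nhds (horizJet W e u x₀)) := by
    have := hJu.add ((continuousAt_fst (p := ((0 : ℝ), x₀))).tendsto.smul hJh)
    simpa using this
  have hS : Continuous fun q : (ι → ℝ) × (ι → ι → ℝ) => ∑ i, q.1 i ^ 2 := by fun_prop
  have hSpos : ∀ᶠ q in nhds (horizJet W e u x₀), 0 < ∑ i, q.1 i ^ 2 :=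
    hS.continuousAt.eventually (lt_mem_nhds hD)
  have hC := (contDiffAt_curvFun (p := horizJet W e u x₀) hD).hasStrictFDerivAt one_ne_zero
  set L := fderiv ℝ curvFun (horizJet W e u x₀)
  set c := L (horizJet W 0 h x₀)
  set M := ‖horizJet W 0 h x₀‖ + 1
  have hM : 0 < M := by positivity
  have hlo := (hJ.prodMk_nhds hJu).eventually
    (hC.isLittleO.bound (c := c / (2 * M) / 2) (by positivity))
  have hL : ∀ᶠ p : ℝ × E in nhds (0, x₀), c / 2 < L (horizJet W 0 h p.2) :=
    (L.continuous.continuousAt.tendsto.comp hJh).eventually (lt_mem_nhds (half_lt_self hpos))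
  have hN : ∀ᶠ p : ℝ × E in nhds (0, x₀), ‖horizJet W 0 h p.2‖ < M :=
    hJh.norm.eventually (gt_mem_nhds (lt_add_one _))
  filter_upwards [hJu.eventually hSpos, hJ.eventually hSpos, hlo, hL, hN] with p h1 h2 h3 h4 h5
  refine ⟨h1, h2, fun hp => ?_⟩
  simp only [add_sub_cancel_left, map_smul, smul_eq_mul, norm_smul, Real.norm_eq_abs,
    abs_of_pos hp] at h3
  have h6 : c / (2 * M) / 2 * (p.1 * ‖horizJet W 0 h p.2‖) ≤ c / (2 * M) / 2 * (p.1 * M) := by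
    gcongr
  have h7 : c / (2 * M) / 2 * (p.1 * M) = p.1 * (c / 4) := by field_simp; ring
  have h8 := (abs_le.1 h3).1
  nlinarith [mul_lt_mul_of_pos_left h4 hp, mul_pos hp hpos]

end BarrierComparison

section Barrier

variable {E ι : Type*} [NormedAddCommGroup E] [NormedSpace ℝ E] [ProperSpace E] [Fintype ι]
  {W : ι → E → E} {e : ι → ℝ} {u v h ρ : E → ℝ} {x₀ : E}

theorem fderiv_curvFun_nonpos_of_barrier (hW : ∀ i, ContDiff ℝ 1 (W i))
    (hu : ContDiffAt ℝ 2 u x₀) (hv : ContDiffAt ℝ 2 v x₀) (hh : ContDiffAt ℝ 2 h x₀)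
    (hD : 0 < ∑ i, horizGrad W e u i x₀ ^ 2) (huv : u x₀ = v x₀) (hh₀ : h x₀ = 0)
    (hH : ∀ᶠ x in nhds x₀, horizMeanCurv W e v x ≤ horizMeanCurv W e u x)
    (hlt : ∀ᶠ x in nhds x₀, (0 ≤ h x → x ≠ x₀ → u x < v x) ∧ u x ≤ v x) :
    fderiv ℝ curvFun (horizJet W e u x₀) (horizJet W 0 h x₀) ≤ 0 := by
  by_contra! hpos
  obtain ⟨δ, hδ, hball⟩ := Metric.eventually_nhds_iff.1
    (eventually_curvFun_lt hW hu hD hh hpos)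
  obtain ⟨δ', hδ', hball'⟩ := Metric.eventually_nhds_iff.1
    ((hu.eventually (by simp)).and ((hv.eventually (by simp)).and ((hh.eventually (by simp)).and
      (hH.and hlt))))
  obtain ⟨R, hR, hRδ⟩ : ∃ R > 0, R < min δ δ' := exists_between (lt_min hδ hδ')
  have hRδ₁ := hRδ.trans_le (min_le_left _ _)
  have hRδ₂ := hRδ.trans_le (min_le_right _ _)
  have hcb : ∀ x ∈ Metric.closedBall x₀ R, ContDiffAt ℝ 2 u x ∧ ContDiffAt ℝ 2 v x ∧
      ContDiffAt ℝ 2 h x ∧ horizMeanCurv W e v x ≤ horizMeanCurv W e u x ∧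
      (0 ≤ h x → x ≠ x₀ → u x < v x) ∧ u x ≤ v x := fun x hx =>
    hball' ((Metric.mem_closedBall.1 hx).trans_lt hRδ₂)
  have hsc : Metric.sphere x₀ R ⊆ Metric.closedBall x₀ R := Metric.sphere_subset_closedBall
  have hcu : ContinuousOn u (Metric.closedBall x₀ R) := fun x hx =>
    (hcb x hx).1.continuousAt.continuousWithinAt
  have hcv : ContinuousOn v (Metric.closedBall x₀ R) := fun x hx =>
    (hcb x hx).2.1.continuousAt.continuousWithinAt
  have hch : ContinuousOn h (Metric.closedBall x₀ R) := fun x hx =>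
    (hcb x hx).2.2.1.continuousAt.continuousWithinAt
  obtain ⟨m, hm, hm'⟩ : ∃ m > 0, ∀ x ∈ Metric.sphere x₀ R ∩ h ⁻¹' Set.Ici 0, m ≤ v x - u x := by
    have hK : IsCompact (Metric.sphere x₀ R ∩ h ⁻¹' Set.Ici 0) :=
      (isCompact_sphere x₀ R).of_isClosed_subset
        ((hch.mono hsc).preimage_isClosed_of_isClosed Metric.isClosed_sphere isClosed_Ici)
        Set.inter_subset_left
    have hsub : Metric.sphere x₀ R ∩ h ⁻¹' Set.Ici 0 ⊆ Metric.closedBall x₀ R :=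
      Set.inter_subset_left.trans hsc
    refine hK.exists_forall_le' ((hcv.sub hcu).mono hsub) fun x hx => sub_pos.2 ?_
    exact (hcb x (hsub hx)).2.2.2.2.1 hx.2 (Metric.ne_of_mem_sphere hx.1 hR.ne')
  obtain ⟨M, hM⟩ := (isCompact_closedBall x₀ R).bddAbove_image hch
  obtain ⟨ε, hε, hεlt⟩ : ∃ ε > 0, ε < min δ (m / (|M| + 1)) :=
    exists_between (lt_min hδ (by positivity))
  have hεM : ε * (|M| + 1) < m :=
    (lt_div_iff₀ (by positivity)).1 (hεlt.trans_le (min_le_right _ _))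
  set g := v - (u + ε • h) with hgdef
  have hg : ∀ x, g x = v x - (u x + ε * h x) := fun x => rfl
  have hg₀ : g x₀ = 0 := by rw [hg, huv, hh₀]; ring
  have hsphere : ∀ x ∈ Metric.sphere x₀ R, 0 ≤ g x := by
    intro x hx
    rw [hg]
    rcases lt_or_ge (h x) 0 with hneg | hnn
    · nlinarith [(hcb x (hsc hx)).2.2.2.2.2]
    · have h1 := hm' x ⟨hx, hnn⟩
      have h2 : h x ≤ |M| + 1 :=
        ((hM ⟨x, hsc hx, rfl⟩).trans (le_abs_self M)).trans (le_add_of_nonneg_right zero_le_one)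
      nlinarith
  have hx₀ : x₀ ∈ Metric.closedBall x₀ R := Metric.mem_closedBall_self hR.le
  obtain ⟨x₁, hx₁, hmin⟩ : ∃ x₁ ∈ Metric.ball x₀ R, ∀ x ∈ Metric.closedBall x₀ R, g x₁ ≤ g x := by
    obtain ⟨x₁, hx₁, hmin⟩ := (isCompact_closedBall x₀ R).exists_isMinOn ⟨x₀, hx₀⟩
      (f := g) (hcv.sub (hcu.add (hch.const_smul ε)))
    rcases (Metric.mem_closedBall.1 hx₁).lt_or_eq with hlt | heq
    · exact ⟨x₁, hlt, fun x hx => hmin hx⟩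
    · exact ⟨x₀, Metric.mem_ball_self hR, fun x hx =>
        (hg₀.trans_le (hsphere x₁ heq)).trans (hmin hx)⟩
  have hx₁' := Metric.ball_subset_closedBall hx₁
  have hloc : IsLocalMin g x₁ := by
    filter_upwards [Metric.isOpen_ball.mem_nhds hx₁] with x hx
    exact hmin x (Metric.ball_subset_closedBall hx)
  obtain ⟨hu₁, hv₁, hh₁, hH₁, -⟩ := hcb x₁ hx₁'
  obtain ⟨hDu, hDp, hcurv⟩ := @hball (ε, x₁) (by
    rw [Prod.dist_eq, max_lt_iff]
    exact ⟨by simpa [abs_of_pos hε] using hεlt.trans_le (min_le_left _ _),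
      (Metric.mem_ball.1 hx₁).trans hRδ₁⟩)
  have hεh : ContDiffAt ℝ 2 (ε • h) x₁ := contDiffAt_const.smul hh₁
  rw [← horizJet_const_smul hW ε hh₁] at hDp hcurv
  have h1 := curvFun_le_horizMeanCurv_of_isLocalMin hW hu₁ hv₁ hεh hloc hDp
  rw [horizMeanCurv_eq hW hu₁ hDu] at hH₁
  exact absurd (hcurv hε) (h1.trans hH₁).not_gt

theorem horizGrad_mul_fderiv_comm_of_barrier (hW : ∀ i, ContDiff ℝ 1 (W i))
    (hu : ContDiffAt ℝ 2 u x₀) (hv : ContDiffAt ℝ 2 v x₀) (hρ : ContDiffAt ℝ 2 ρ x₀)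
    (hD : 0 < ∑ i, horizGrad W e u i x₀ ^ 2) (huv : u x₀ = v x₀) (hρ₀ : ρ x₀ = 0)
    (hH : ∀ᶠ x in nhds x₀, horizMeanCurv W e v x ≤ horizMeanCurv W e u x)
    (hlt : ∀ᶠ x in nhds x₀, (0 ≤ ρ x → x ≠ x₀ → u x < v x) ∧ u x ≤ v x) (i k : ι) :
    horizGrad W e u i x₀ * fderiv ℝ ρ x₀ (W k x₀) =
      horizGrad W e u k x₀ * fderiv ℝ ρ x₀ (W i x₀) := by
  by_contra hne
  set F : ι → ℝ := fun i => horizGrad W e u i x₀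
  set p : ι → ℝ := fun i => fderiv ℝ ρ x₀ (W i x₀)
  have hq : 0 < curvForm F (fun i k => p i * p k) / √(∑ i, F i ^ 2) ^ 3 := by
    have := curvForm_mul_pos (F := F) (p := p) hne
    positivity
  obtain ⟨α, hα⟩ := exists_lt_nsmul hq
    (-fderiv ℝ curvFun (horizJet W e u x₀) (horizJet W 0 ρ x₀))
  set a := (α : ℝ)
  let h : E → ℝ := fun x => ρ x + (a / 2) * ρ x ^ 2
  have hh : ContDiffAt ℝ 2 h x₀ := hρ.add (contDiffAt_const.mul (hρ.pow 2))
  have hdρ : HasFDerivAt ρ (fderiv ℝ ρ x₀) x₀ := (hρ.differentiableAt two_ne_zero).hasFDerivAt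
  have hdh : fderiv ℝ h =ᶠ[nhds x₀] fun x => (1 + a * ρ x) • fderiv ℝ ρ x := by
    filter_upwards [hρ.eventually (by simp)] with x hx
    have hx' : HasFDerivAt ρ (fderiv ℝ ρ x) x := (hx.differentiableAt two_ne_zero).hasFDerivAt
    have h1 : HasFDerivAt h _ x := hx'.add ((hx'.pow 2).const_mul (a / 2))
    rw [h1.fderiv]
    ext ξ
    simp only [_root_.add_apply, _root_.smul_apply, smul_eq_mul]
    simp
    ring
  have hdh₀ : fderiv ℝ h x₀ = fderiv ℝ ρ x₀ := by
    rw [hdh.eq_of_nhds, hρ₀, mul_zero, add_zero, one_smul]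
  have hddh : ∀ ξ η, fderiv ℝ (fderiv ℝ h) x₀ ξ η =
      fderiv ℝ (fderiv ℝ ρ) x₀ ξ η + a * (fderiv ℝ ρ x₀ ξ * fderiv ℝ ρ x₀ η) := by
    intro ξ η
    have h1 : HasFDerivAt (fderiv ℝ ρ) (fderiv ℝ (fderiv ℝ ρ) x₀) x₀ :=
      ((hρ.fderiv_right (m := 1) (by norm_num)).differentiableAt one_ne_zero).hasFDerivAt
    have h2 := ((hdρ.const_mul a).const_add 1).smul h1
    rw [hdh.fderiv_eq]
    have h3 : HasFDerivAt (fun x => (1 + a * ρ x) • fderiv ℝ ρ x) _ x₀ := h2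
    rw [h3.fderiv]
    simp [hρ₀]
    ring
  have hJ : horizJet W 0 h x₀ = horizJet W 0 ρ x₀
      + ((0, a • fun i k => p i * p k) : (ι → ℝ) × (ι → ι → ℝ)) := by
    refine Prod.ext (funext fun i => ?_) (funext fun i => funext fun k => ?_)
    · simp [horizJet, horizGrad, hdh₀]
    · simp only [horizJet, horizHess_eq hW 0 hh, horizHess_eq hW 0 hρ, hdh₀, hddh, Prod.snd_add,
        Pi.add_apply, Pi.smul_apply, smul_eq_mul, p]
      ring
  have hle := fderiv_curvFun_nonpos_of_barrier (h := h) hW hu hv hh hD huv (by simp [h, hρ₀]) hH ?_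
  · rw [hJ, map_add, fderiv_curvFun_apply_zero_left hD, curvForm_smul, mul_div_assoc] at hle
    rw [nsmul_eq_mul] at hα
    exact absurd (neg_lt_iff_pos_add'.1 hα) hle.not_gt
  · have hsmall : ∀ᶠ x in nhds x₀, 0 < 1 + a / 2 * ρ x := by
      have : ContinuousAt (fun x => 1 + a / 2 * ρ x) x₀ :=
        (hρ.continuousAt.const_mul _).const_add _
      exact this.eventually (lt_mem_nhds (by simp [hρ₀]))
    filter_upwards [hlt, hsmall] with x hx hs
    refine ⟨fun hx' => hx.1 ?_, hx.2⟩
    have : h x = ρ x * (1 + a / 2 * ρ x) := by simp only [h]; ring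
    exact nonneg_of_mul_nonneg_left (this ▸ hx') hs

end Barrier

section Propagation

variable {E ι : Type*} [NormedAddCommGroup E] [InnerProductSpace ℝ E]
  {W : ι → E → E} {e : ι → ℝ} {u v : E → ℝ} {x ν : E}

/-- The combination of `W i` and `W k` annihilated by the shifted gradient of `u`. -/
def horizTangent (W : ι → E → E) (e : ι → ℝ) (u : E → ℝ) (i k : ι) (x : E) : E :=
  horizGrad W e u i x • W k x - horizGrad W e u k x • W i x

theorem contDiffAt_horizTangent (hW : ∀ i, ContDiff ℝ 1 (W i)) (hu : ContDiffAt ℝ 2 u x)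
    (i k : ι) : ContDiffAt ℝ 1 (horizTangent W e u i k) x :=
  ((contDiffAt_horizGrad hW e hu i).smul (hW k).contDiffAt).sub
    ((contDiffAt_horizGrad hW e hu k).smul (hW i).contDiffAt)

theorem horizHess_sub_horizHess (hW : ∀ i, ContDiff ℝ 1 (W i)) (hu : ContDiffAt ℝ 2 u x)
    (i k : ι) : horizHess W e u i k x - horizHess W e u k i x =
      fderiv ℝ u x (VectorField.lieBracket ℝ (W i) (W k) x) := by
  have hs := (hu.isSymmSndFDerivAt (by simp)).eq (W i x) (W k x)
  rw [horizHess_eq hW e hu, horizHess_eq hW e hu, hs, VectorField.lieBracket, map_sub]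
  ring

theorem inner_lieBracket_horizTangent (hW : ∀ i, ContDiff ℝ 1 (W i)) (hu : ContDiffAt ℝ 2 u x)
    {c : ℝ} (hν : ∀ i, inner ℝ ν (W i x) = c * horizGrad W e u i x) {i k m : ι}
    (hik : VectorField.lieBracket ℝ (W i) (W k) x = 0)
    (him : VectorField.lieBracket ℝ (W i) (W m) x = 0) :
    inner ℝ ν (VectorField.lieBracket ℝ (horizTangent W e u i k) (horizTangent W e u i m) x) =
      horizGrad W e u i x ^ 2 * (inner ℝ ν (VectorField.lieBracket ℝ (W k) (W m) x)
        - c * fderiv ℝ u x (VectorField.lieBracket ℝ (W k) (W m) x)) := by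
  have hF : ∀ i, HasFDerivAt (horizGrad W e u i) (fderiv ℝ (horizGrad W e u i) x) x := fun i =>
    ((contDiffAt_horizGrad hW e hu i).differentiableAt one_ne_zero).hasFDerivAt
  have hWd : ∀ i, HasFDerivAt (W i) (fderiv ℝ (W i) x) x := fun i =>
    ((hW i).contDiffAt.differentiableAt one_ne_zero).hasFDerivAt
  have hX : ∀ a b j, inner ℝ ν (fderiv ℝ (horizTangent W e u a b) x (W j x)) =
      horizGrad W e u a x * inner ℝ ν (fderiv ℝ (W b) x (W j x))
      + horizHess W e u j a x * (c * horizGrad W e u b x)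
      - (horizGrad W e u b x * inner ℝ ν (fderiv ℝ (W a) x (W j x))
      + horizHess W e u j b x * (c * horizGrad W e u a x)) := by
    intro a b j
    have h : HasFDerivAt (horizTangent W e u a b) _ x :=
      ((hF a).smul (hWd b)).sub ((hF b).smul (hWd a))
    rw [h.fderiv]
    simp only [_root_.sub_apply, _root_.add_apply, _root_.smul_apply,
      ContinuousLinearMap.smulRight_apply, inner_sub_right, inner_add_right, inner_smul_right, hν]
    rfl
  have hH := horizHess_sub_horizHess (e := e) hW hu
  have hik' : inner ℝ ν (VectorField.lieBracket ℝ (W i) (W k) x) = 0 := by simp [hik]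
  have him' : inner ℝ ν (VectorField.lieBracket ℝ (W i) (W m) x) = 0 := by simp [him]
  have h1 := hH i k
  have h2 := hH i m
  have h3 := hH k m
  rw [hik, map_zero] at h1
  rw [him, map_zero] at h2
  rw [← h3]
  simp only [VectorField.lieBracket, inner_sub_right] at hik' him' ⊢
  rw [horizTangent, horizTangent, map_sub, map_sub, map_smul, map_smul, map_smul, map_smul]
  simp only [inner_sub_right, inner_smul_right, hX]
  linear_combination (horizGrad W e u i x * horizGrad W e u m x) * hik'
    - (horizGrad W e u i x * horizGrad W e u k x) * him'
    - c * (horizGrad W e u i x * horizGrad W e u m x) * h1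
    + c * (horizGrad W e u i x * horizGrad W e u k x) * h2

variable [Fintype ι] {p₀ : E}

theorem IsProximalNormal.inner_horizTangent_eq_zero [ProperSpace E] {Z : Set E}
    (hW : ∀ i, ContDiff ℝ 1 (W i)) (hν : IsProximalNormal Z x ν)
    (hu : ContDiffAt ℝ 2 u x) (hv : ContDiffAt ℝ 2 v x) (hD : 0 < ∑ i, horizGrad W e u i x ^ 2)
    (hH : ∀ᶠ y in nhds x, horizMeanCurv W e v y ≤ horizMeanCurv W e u y)
    (hle : ∀ᶠ y in nhds x, u y ≤ v y) (hxZ : u x = v x) (hZ : ∀ᶠ y in nhds x, v y = u y → y ∈ Z)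
    (i k : ι) : inner ℝ ν (horizTangent W e u i k x) = 0 := by
  let ρ : E → ℝ := fun y => inner ℝ ν (y - x) - ‖y - x‖ ^ 2
  have hid : ContDiff ℝ 2 fun y : E => y - x := contDiff_id.sub contDiff_const
  have hρ : ContDiff ℝ 2 ρ := (contDiff_const.inner ℝ hid).sub (hid.norm_sq ℝ)
  have hdρ : ∀ ξ, fderiv ℝ ρ x ξ = inner ℝ ν ξ := by
    intro ξ
    have h0 : HasFDerivAt (fun y : E => y - x) (ContinuousLinearMap.id ℝ E) x :=
      (hasFDerivAt_id x).sub_const x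
    have h : HasFDerivAt ρ _ x := (((innerSL ℝ ν).hasFDerivAt).comp x h0).sub h0.norm_sq
    rw [h.fderiv]
    simp
  have h := horizGrad_mul_fderiv_comm_of_barrier hW hu hv hρ.contDiffAt hD hxZ (by simp [ρ]) hH
    (by
      filter_upwards [hle, hZ] with y hy hyZ
      refine ⟨fun hρy hne => hy.lt_of_ne fun heq => ?_, hy⟩
      have h1 := hν.2 y (hyZ heq.symm)
      have h2 : 0 < ‖y - x‖ := norm_pos_iff.2 (sub_ne_zero.2 hne)
      rw [real_inner_comm] at h1
      simp only [ρ] at hρy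
      nlinarith) i k
  rw [hdρ, hdρ] at h
  rw [horizTangent, inner_sub_right, inner_smul_right, inner_smul_right, h, sub_self]

/-- Strong maximum principle for `horizMeanCurv`. The commutators of the fields `W i` are multiples
of a single vector `T`, with enough of them vanishing and enough of them not. -/
theorem eventually_eq_of_horizMeanCurv_le [ProperSpace E] (hW : ∀ i, ContDiff ℝ 1 (W i)) {T : E}
    {ω : ι → ι → ℝ} (hbr : ∀ i k x, VectorField.lieBracket ℝ (W i) (W k) x = ω i k • T)
    (hω : ∀ i, ∃ k m, ω i k = 0 ∧ ω i m = 0 ∧ ω k m ≠ 0)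
    (hspan : ∀ x (ℓ : E →L[ℝ] ℝ) (c : ℝ), (∀ i, ℓ (W i x) = c * e i) → ℓ T = 0 → c = 0 ∧ ℓ = 0)
    (hu : ContDiffAt ℝ 2 u p₀) (hv : ContDiffAt ℝ 2 v p₀)
    (hD : 0 < ∑ i, horizGrad W e u i p₀ ^ 2)
    (hH : ∀ᶠ x in nhds p₀, horizMeanCurv W e v x ≤ horizMeanCurv W e u x)
    (hle : ∀ᶠ x in nhds p₀, u x ≤ v x) (huv : v p₀ = u p₀) :
    ∀ᶠ x in nhds p₀, v x = u x := by
  have hD' : ∀ᶠ x in nhds p₀, 0 < ∑ i, horizGrad W e u i x ^ 2 := by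
    have : ContinuousAt (fun x => ∑ i, horizGrad W e u i x ^ 2) p₀ :=
      tendsto_finsetSum _ fun i _ => (contDiffAt_horizGrad hW e hu i).continuousAt.pow 2
    exact this.eventually (lt_mem_nhds hD)
  obtain ⟨R', hR', hball'⟩ := Metric.eventually_nhds_iff.1
    ((hu.eventually (by simp)).and ((hv.eventually (by simp)).and (hD'.and (hH.and hle))))
  obtain ⟨R, hR, hRR'⟩ := exists_between hR'
  have hball : ∀ x ∈ Metric.closedBall p₀ R, ContDiffAt ℝ 2 u x ∧ ContDiffAt ℝ 2 v x ∧
      0 < ∑ i, horizGrad W e u i x ^ 2 ∧ horizMeanCurv W e v x ≤ horizMeanCurv W e u x ∧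
      u x ≤ v x := fun x hx => hball' ((Metric.mem_closedBall.1 hx).trans_lt hRR')
  have hnear : ∀ x ∈ Metric.ball p₀ R, ∀ᶠ y in nhds x, y ∈ Metric.closedBall p₀ R := fun x hx =>
    Filter.mem_of_superset (Metric.isOpen_ball.mem_nhds hx) Metric.ball_subset_closedBall
  set Z : Set E := {x ∈ Metric.closedBall p₀ R | v x = u x} with hZdef
  have hZ : IsClosed Z := by
    have h : ContinuousOn (fun x => v x - u x) (Metric.closedBall p₀ R) := fun x hx =>
      ((hball x hx).2.1.continuousAt.sub (hball x hx).1.continuousAt).continuousWithinAt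
    have := h.preimage_isClosed_of_isClosed Metric.isClosed_closedBall (isClosed_singleton (x := 0))
    convert this using 1
    ext x
    simp [hZdef, sub_eq_zero]
  have htan : ∀ x ∈ Metric.ball p₀ R, ∀ μ, IsProximalNormal Z x μ → ∀ i k,
      inner ℝ μ (horizTangent W e u i k x) = 0 := by
    intro x hx μ hμ i k
    have hx' := hball x (Metric.ball_subset_closedBall hx)
    exact hμ.inner_horizTangent_eq_zero hW hx'.1 hx'.2.1 hx'.2.2.1
      ((hnear x hx).mono fun y hy => (hball y hy).2.2.2.1)
      ((hnear x hx).mono fun y hy => (hball y hy).2.2.2.2) hμ.1.2.symm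
      ((hnear x hx).mono fun y hy h => ⟨hy, h⟩) i k
  have hzero : ∀ x ∈ Metric.ball p₀ R, ∀ μ, IsProximalNormal Z x μ → μ = 0 := by
    intro x hx μ hμ
    obtain ⟨hux, -, hDx, -, -⟩ := hball x (Metric.ball_subset_closedBall hx)
    obtain ⟨i, hi⟩ : ∃ i, horizGrad W e u i x ≠ 0 := by
      by_contra! h
      simp [h] at hDx
    obtain ⟨k, m, hik, him, hkm⟩ := hω i
    set c := inner ℝ μ (W i x) / horizGrad W e u i x with hc
    have hμW : ∀ j, inner ℝ μ (W j x) = c * horizGrad W e u j x := by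
      intro j
      have h := htan x hx μ hμ i j
      rw [horizTangent, inner_sub_right, inner_smul_right, inner_smul_right] at h
      rw [hc]
      field_simp
      linarith
    have hbr₀ := hμ.inner_lieBracket_eq_zero hZ (contDiffAt_horizTangent (e := e) hW hux i k)
      (contDiffAt_horizTangent (e := e) hW hux i m) (by
        filter_upwards [Metric.isOpen_ball.mem_nhds hx] with y hy κ hκ
        exact ⟨htan y hy κ hκ i k, htan y hy κ hκ i m⟩)
    rw [real_inner_comm, inner_lieBracket_horizTangent hW hux hμW (by simp [hbr, hik])
      (by simp [hbr, him]), hbr, inner_smul_right, map_smul, smul_eq_mul] at hbr₀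
    have hT : inner ℝ μ T - c * fderiv ℝ u x T = 0 := by
      have h : horizGrad W e u i x ^ 2 * ω k m * (inner ℝ μ T - c * fderiv ℝ u x T) = 0 := by
        linear_combination hbr₀
      exact (mul_eq_zero.1 h).resolve_left (mul_ne_zero (pow_ne_zero 2 hi) hkm)
    obtain ⟨hc0, hℓ⟩ := hspan x (innerSL ℝ μ - c • fderiv ℝ u x) c (fun j => by
      simp only [_root_.sub_apply, _root_.smul_apply, innerSL_apply_apply, smul_eq_mul, hμW,
        horizGrad]
      ring) (by simpa using hT)
    rw [hc0, zero_smul, sub_zero] at hℓ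
    have := congrArg (fun ℓ : E →L[ℝ] ℝ => ℓ μ) hℓ
    simpa using this
  have hp₀ : p₀ ∈ Z := ⟨Metric.mem_closedBall_self hR.le, huv⟩
  filter_upwards [Metric.ball_mem_nhds p₀ (half_pos hR)] with x hx
  obtain ⟨z, hz, hxz⟩ := hZ.exists_infDist_eq_dist ⟨p₀, hp₀⟩ x
  have hzR : z ∈ Metric.ball p₀ R := by
    have h1 : dist x z ≤ dist x p₀ := hxz ▸ Metric.infDist_le_dist_of_mem hp₀
    have h2 := dist_triangle_left z p₀ x
    have h3 := Metric.mem_ball.1 hx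
    exact Metric.mem_ball.2 (by linarith)
  have hxz' := sub_eq_zero.1 (hzero z hzR _ (isProximalNormal_sub_of_infDist_eq hz hxz))
  exact hxz' ▸ hz.2

end Propagation

section AffineFields

variable {E : Type*} [NormedAddCommGroup E] [NormedSpace ℝ E]

theorem lieBracket_const_add_smul {b b' : E →L[ℝ] ℝ} {c c' t : E} (hb : b t = 0) (hb' : b' t = 0)
    (x : E) : VectorField.lieBracket ℝ (fun y => c + b y • t) (fun y => c' + b' y • t) x =
      (b' c - b c') • t := by
  have h : ∀ (b : E →L[ℝ] ℝ) (c : E),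
      HasFDerivAt (fun y => c + b y • t) (b.smulRight t) x := fun b c =>
    (b.hasFDerivAt.smul_const t).const_add c
  rw [VectorField.lieBracket, (h b c).fderiv, (h b' c').fderiv]
  simp [hb, hb', sub_smul]

end AffineFields

section HeisenbergFields

/-- The coordinate `η^j` as a continuous linear functional. -/
def etaCLM (n j : ℕ) : (Fin (2 * n) → ℝ) →L[ℝ] ℝ :=
  if h : j - 2 < 2 * n then ContinuousLinearMap.proj ⟨j - 2, h⟩ else 0

theorem etaCLM_apply (n j : ℕ) (x : Fin (2 * n) → ℝ) : etaCLM n j x = eta n j x := by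
  unfold etaCLM eta cv
  split_ifs <;> simp

theorem etaCLM_ee {n j : ℕ} (hj : j ≤ 2 * n) (hn : 0 < n) (k : ℕ) :
    etaCLM n j (ee (2 * n) k) = if j - 2 = k then 1 else 0 := by
  have h : j - 2 < 2 * n := by omega
  simp [etaCLM_apply, eta, cv, ee, h]

/-- The constant part of the invariant fields: for `j = 1` those of index `n + 1`. -/
def fieldDir (n : ℕ) : Bool → ℕ → Fin (2 * n) → ℝ
  | false, j => if j = 1 then 0 else ee (2 * n) (j - 2)
  | true, j => ee (2 * n) (n + j - 2)

/-- The coefficient of `∂_τ` in the invariant fields. -/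
def fieldCoeff (n : ℕ) : Bool → ℕ → (Fin (2 * n) → ℝ) →L[ℝ] ℝ
  | false, j => (if j = 1 then (2 : ℝ) else 1) • etaCLM n (n + j)
  | true, j => if j = 1 then 0 else -etaCLM n j

/-- The constants added to the derivatives of `u` to form the horizontal gradient. -/
def fieldShift : Bool → ℕ → ℝ
  | false, j => if j = 1 then -1 else 0
  | true, _ => 0

theorem fieldCoeff_tau {n j : ℕ} (hn : 0 < n) (hjn : j ≤ n) (b : Bool) :
    fieldCoeff n b j (ee (2 * n) (2 * n - 1)) = 0 := by
  cases b
  · simp only [fieldCoeff, _root_.smul_apply, etaCLM_ee (show n + j ≤ 2 * n by omega) hn]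
    rw [if_neg (show ¬ n + j - 2 = 2 * n - 1 by omega), smul_zero]
  · simp only [fieldCoeff]
    split_ifs
    · rfl
    · rw [_root_.neg_apply, etaCLM_ee (by omega) hn, if_neg (by omega), neg_zero]

theorem fieldCoeff_fieldDir_same {n j k : ℕ} (hj : 1 ≤ j) (hjn : j ≤ n) (hk : 1 ≤ k) (hkn : k ≤ n)
    (b : Bool) : fieldCoeff n b j (fieldDir n b k) = 0 := by
  cases b
  · simp only [fieldCoeff, fieldDir]
    split_ifs <;> simp [etaCLM_ee (show n + j ≤ 2 * n by omega) (show 0 < n by omega)] <;> omega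
  · simp only [fieldCoeff, fieldDir]
    split_ifs
    · simp
    · simp [etaCLM_ee (show j ≤ 2 * n by omega) (show 0 < n by omega)]
      omega

theorem fieldCoeff_fieldDir_of_ne {n j k : ℕ} (hj : 1 ≤ j) (hjn : j ≤ n) (hk : 1 ≤ k) (hkn : k ≤ n)
    (hjk : j ≠ k) (b b' : Bool) : fieldCoeff n b j (fieldDir n b' k) = 0 := by
  cases b <;> cases b'
  · exact fieldCoeff_fieldDir_same hj hjn hk hkn _
  · simp only [fieldCoeff, fieldDir, _root_.smul_apply,
      etaCLM_ee (show n + j ≤ 2 * n by omega) (show 0 < n by omega)]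
    rw [if_neg (show ¬ n + j - 2 = n + k - 2 by omega), smul_zero]
  · simp only [fieldCoeff, fieldDir]
    split_ifs <;> simp [etaCLM_ee (show j ≤ 2 * n by omega) (show 0 < n by omega)]
    omega
  · exact fieldCoeff_fieldDir_same hj hjn hk hkn _

theorem fieldCoeff_fieldDir_bracket {n j : ℕ} (hj : 1 ≤ j) (hjn : j ≤ n) :
    fieldCoeff n true j (fieldDir n false j) - fieldCoeff n false j (fieldDir n true j) = -2 := by
  have h1 := etaCLM_ee (show n + j ≤ 2 * n by omega) (show 0 < n by omega) (n + j - 2)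
  have h2 := etaCLM_ee (show j ≤ 2 * n by omega) (show 0 < n by omega) (j - 2)
  rw [if_pos rfl] at h1 h2
  simp only [fieldCoeff, fieldDir, _root_.smul_apply, h1]
  split_ifs
  · simp
  · rw [_root_.neg_apply, h2]
    norm_num

/-- The invariant field of index `(b, j)`, for `1 ≤ j ≤ n`. -/
def invField (n : ℕ) (b : Bool) (j : ℕ) (x : Fin (2 * n) → ℝ) : Fin (2 * n) → ℝ :=
  fieldDir n b j + fieldCoeff n b j x • ee (2 * n) (2 * n - 1)

/-- The component of index `(b, j)` of the horizontal gradient. -/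
def invGrad (n : ℕ) (u : (Fin (2 * n) → ℝ) → ℝ) (b : Bool) (j : ℕ) (x : Fin (2 * n) → ℝ) : ℝ :=
  fderiv ℝ u x (invField n b j x) + fieldShift b j

theorem fderiv_invField_false_one (n : ℕ) (f : (Fin (2 * n) → ℝ) → ℝ) (x : Fin (2 * n) → ℝ) :
    fderiv ℝ f x (invField n false 1 x) = 2 * eta n (n + 1) x * dTau n f x := by
  simp [invField, fieldDir, fieldCoeff, etaCLM_apply, dTau, pd]

theorem fderiv_invField_false {j : ℕ} (hj : j ≠ 1) (n : ℕ) (f : (Fin (2 * n) → ℝ) → ℝ)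
    (x : Fin (2 * n) → ℝ) :
    fderiv ℝ f x (invField n false j x) = dEta n j f x + eta n (n + j) x * dTau n f x := by
  simp [invField, fieldDir, fieldCoeff, etaCLM_apply, dTau, dEta, pd, hj]

theorem fderiv_invField_true_one (n : ℕ) (f : (Fin (2 * n) → ℝ) → ℝ) (x : Fin (2 * n) → ℝ) :
    fderiv ℝ f x (invField n true 1 x) = dEta n (n + 1) f x := by
  simp [invField, fieldDir, fieldCoeff, dEta, pd]

theorem fderiv_invField_true {j : ℕ} (hj : j ≠ 1) (n : ℕ) (f : (Fin (2 * n) → ℝ) → ℝ)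
    (x : Fin (2 * n) → ℝ) :
    fderiv ℝ f x (invField n true j x) = dEta n (n + j) f x - eta n j x * dTau n f x := by
  simp [invField, fieldDir, fieldCoeff, etaCLM_apply, dTau, dEta, pd, hj, sub_eq_add_neg]

theorem sum_bool_prod_Icc {n : ℕ} (hn : 1 ≤ n) (f : Bool → ℕ → ℝ) :
    ∑ i : Bool × {j // j ∈ Finset.Icc 1 n}, f i.1 i.2 =
      f false 1 + f true 1 + ∑ j ∈ Finset.Icc 2 n, (f false j + f true j) := by
  rw [Fintype.sum_prod_type_right, Finset.sum_coe_sort (Finset.Icc 1 n) fun j => ∑ b, f b j,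
    ← Finset.add_sum_Ioc_eq_sum_Icc hn]
  simp only [Fintype.sum_bool, add_comm (f true _)]
  rfl

theorem sum_invGrad_sq {n : ℕ} (hn : 1 ≤ n) (u : (Fin (2 * n) → ℝ) → ℝ) (x : Fin (2 * n) → ℝ) :
    ∑ i : Bool × {j // j ∈ Finset.Icc 1 n}, invGrad n u i.1 i.2 x ^ 2 = Dq n u x := by
  rw [sum_bool_prod_Icc hn fun b j => invGrad n u b j x ^ 2, Dq]
  simp only [invGrad, fderiv_invField_false_one, fderiv_invField_true_one, fieldShift, if_true]
  congr 1
  · ring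
  · refine Finset.sum_congr rfl fun j hj => ?_
    have hj1 : j ≠ 1 := by have := (Finset.mem_Icc.1 hj).1; omega
    simp only [fderiv_invField_false hj1, fderiv_invField_true hj1, if_neg hj1, add_zero]

theorem sum_fderiv_invGrad_div {n : ℕ} (hn : 1 ≤ n) (u : (Fin (2 * n) → ℝ) → ℝ)
    (x : Fin (2 * n) → ℝ) :
    ∑ i : Bool × {j // j ∈ Finset.Icc 1 n},
      fderiv ℝ (fun y => invGrad n u i.1 i.2 y / √(Dq n u y)) x (invField n i.1 i.2 x)
        = Hla n u x := by
  rw [sum_bool_prod_Icc hn fun b j =>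
    fderiv ℝ (fun y => invGrad n u b j y / √(Dq n u y)) x (invField n b j x), Hla]
  simp only [fderiv_invField_false_one, fderiv_invField_true_one]
  congr 1
  · simp only [invGrad, fderiv_invField_false_one, fderiv_invField_true_one, fieldShift, if_true,
      add_zero, neg_add_eq_sub, ← sub_eq_add_neg]
  · refine Finset.sum_congr rfl fun j hj => ?_
    have hj1 : j ≠ 1 := by have := (Finset.mem_Icc.1 hj).1; omega
    simp only [fderiv_invField_false hj1, fderiv_invField_true hj1, invGrad, fieldShift,
      if_neg hj1, add_zero]

theorem eq_zero_of_forall_fieldDir {n : ℕ} {ℓ : (Fin (2 * n) → ℝ) →L[ℝ] ℝ}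
    (h : ∀ b, ∀ j ∈ Finset.Icc 1 n, ℓ (fieldDir n b j) = 0)
    (hτ : ℓ (ee (2 * n) (2 * n - 1)) = 0) : ℓ = 0 := by
  have hk : ∀ k : Fin (2 * n), ℓ (ee (2 * n) k) = 0 := by
    intro k
    have hk := k.2
    rcases lt_or_ge (k : ℕ) (n - 1) with h1 | h1
    · have := h false (k + 2) (Finset.mem_Icc.2 (by omega))
      rwa [fieldDir, if_neg (by omega), Nat.add_sub_cancel] at this
    · rcases lt_or_ge (k : ℕ) (2 * n - 1) with h2 | h2
      · have := h true (k + 2 - n) (Finset.mem_Icc.2 (by omega))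
        rwa [fieldDir, show n + (k + 2 - n) - 2 = (k : ℕ) by omega] at this
      · rwa [show (k : ℕ) = 2 * n - 1 by omega]
  have he : ∀ k : Fin (2 * n), ee (2 * n) k = Pi.single k 1 := by
    intro k
    ext i
    simp [ee, Pi.single_apply, Fin.ext_iff]
  refine ContinuousLinearMap.coe_injective (LinearMap.pi_ext' fun k => LinearMap.ext_ring ?_)
  simpa [← he] using hk k

end HeisenbergFields

/-- Corollary D′: strong maximum principle for the horizontal
(p-)mean curvature operator of nonsingular `l_a` graphs in the Heisenberg group
`H_n`, `n ≥ 2`. -/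
theorem strong_max_principle_la_graphs
    (n : ℕ) (hn : 2 ≤ n)
    (Ω : Set (Fin (2 * n) → ℝ)) (hΩopen : IsOpen Ω) (hΩconn : IsConnected Ω)
    (u v : (Fin (2 * n) → ℝ) → ℝ)
    (hu : ContDiffOn ℝ (⊤ : ℕ∞) u Ω) (hv : ContDiffOn ℝ (⊤ : ℕ∞) v Ω)
    (hDu : ∀ x ∈ Ω, 0 < Dq n u x) (hDv : ∀ x ∈ Ω, 0 < Dq n v x)
    (p₀ : Fin (2 * n) → ℝ) (hp₀ : p₀ ∈ Ω)
    (htouch : v p₀ = u p₀)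
    (hge : ∀ x ∈ Ω, u x ≤ v x)
    (hH : ∀ x ∈ Ω, Hla n v x ≤ Hla n u x) :
    ∃ V : Set (Fin (2 * n) → ℝ), IsOpen V ∧ p₀ ∈ V ∧ ∀ x ∈ V, v x = u x := by
  have hn1 : 1 ≤ n := by omega
  set Φ := EuclideanSpace.equiv (Fin (2 * n)) ℝ
  let b : Bool × {j // j ∈ Finset.Icc 1 n} → EuclideanSpace ℝ (Fin (2 * n)) →L[ℝ] ℝ := fun i =>
    (fieldCoeff n i.1 i.2).comp (Φ : EuclideanSpace ℝ (Fin (2 * n)) →L[ℝ] Fin (2 * n) → ℝ)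
  let c : Bool × {j // j ∈ Finset.Icc 1 n} → EuclideanSpace ℝ (Fin (2 * n)) := fun i =>
    Φ.symm (fieldDir n i.1 i.2)
  let T : EuclideanSpace ℝ (Fin (2 * n)) := Φ.symm (ee (2 * n) (2 * n - 1))
  let W : Bool × {j // j ∈ Finset.Icc 1 n} → EuclideanSpace ℝ (Fin (2 * n)) →
    EuclideanSpace ℝ (Fin (2 * n)) := fun i y => c i + b i y • T
  let e : Bool × {j // j ∈ Finset.Icc 1 n} → ℝ := fun i => fieldShift i.1 i.2
  have hbT : ∀ i, b i T = 0 := by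
    rintro ⟨β, j, hj⟩
    have hj' := Finset.mem_Icc.1 hj
    simpa [b, T] using fieldCoeff_tau hn1 hj'.2 β
  have hbc : ∀ i k, b i (c k) = fieldCoeff n i.1 i.2 (fieldDir n k.1 k.2) := fun i k => by
    simp [b, c]
  have hWΦ : ∀ i y, W i y = Φ.symm (invField n i.1 i.2 (Φ y)) := fun i y => by
    simp [W, b, c, T, invField]
  have hfd : ∀ (f : (Fin (2 * n) → ℝ) → ℝ) i y,
      fderiv ℝ (f ∘ Φ) y (W i y) = fderiv ℝ f (Φ y) (invField n i.1 i.2 (Φ y)) := fun f i y => by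
    rw [Φ.comp_right_fderiv, hWΦ]
    simp
  have hgrad : ∀ (f : (Fin (2 * n) → ℝ) → ℝ) i y,
      horizGrad W e (f ∘ Φ) i y = invGrad n f i.1 i.2 (Φ y) := fun f i y => by
    rw [horizGrad, hfd, invGrad]
  have hsq : ∀ (f : (Fin (2 * n) → ℝ) → ℝ) y,
      ∑ i, horizGrad W e (f ∘ Φ) i y ^ 2 = Dq n f (Φ y) := fun f y => by
    simp only [hgrad, sum_invGrad_sq hn1]
  have hcurv : ∀ (f : (Fin (2 * n) → ℝ) → ℝ) y,
      horizMeanCurv W e (f ∘ Φ) y = Hla n f (Φ y) := fun f y => by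
    rw [← sum_fderiv_invGrad_div hn1, horizMeanCurv]
    refine Finset.sum_congr rfl fun i _ => ?_
    simp only [hsq]
    simp only [hgrad]
    exact hfd (fun x => invGrad n f i.1 i.2 x / √(Dq n f x)) i y
  have hΩ : ∀ᶠ y in nhds (Φ.symm p₀), Φ y ∈ Ω :=
    Φ.continuous.continuousAt.eventually
      (by rw [Φ.apply_symm_apply]; exact hΩopen.mem_nhds hp₀)
  have hsmooth : ∀ f : (Fin (2 * n) → ℝ) → ℝ,
      ContDiffOn ℝ (⊤ : ℕ∞) f Ω → ContDiffAt ℝ 2 (f ∘ Φ) (Φ.symm p₀) := by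
    intro f hf
    refine ContDiffAt.comp _ ?_ Φ.contDiff.contDiffAt
    rw [Φ.apply_symm_apply]
    exact (hf.contDiffAt (hΩopen.mem_nhds hp₀)).of_le
      (WithTop.coe_le_coe.2 le_top : ((2 : ℕ∞) : WithTop ℕ∞) ≤ _)
  have key : ∀ᶠ y in nhds (Φ.symm p₀), (v ∘ Φ) y = (u ∘ Φ) y := by
    refine eventually_eq_of_horizMeanCurv_le (W := W) (e := e) (T := T)
      (ω := fun i k => b k (c i) - b i (c k))
      (fun i => contDiff_const.add ((b i).contDiff.smul contDiff_const))
      (fun i k x => lieBracket_const_add_smul (hbT i) (hbT k) x) ?_ ?_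
      (hsmooth u hu) (hsmooth v hv) ?_ ?_ ?_ (by simpa using htouch)
    · rintro ⟨β, j, hj⟩
      have hj' := Finset.mem_Icc.1 hj
      obtain ⟨k, hk, hk', hjk⟩ : ∃ k, 1 ≤ k ∧ k ≤ n ∧ j ≠ k := by
        rcases eq_or_ne j 1 with rfl | h
        · exact ⟨2, by omega, by omega, by omega⟩
        · exact ⟨1, by omega, by omega, h⟩
      refine ⟨(false, ⟨k, Finset.mem_Icc.2 ⟨hk, hk'⟩⟩), (true, ⟨k, Finset.mem_Icc.2 ⟨hk, hk'⟩⟩), ?_⟩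
      simp only [hbc, fieldCoeff_fieldDir_of_ne hk hk' hj'.1 hj'.2 hjk.symm,
        fieldCoeff_fieldDir_of_ne hj'.1 hj'.2 hk hk' hjk, sub_zero,
        fieldCoeff_fieldDir_bracket hk hk', true_and]
      norm_num
    · intro x ℓ a hℓ hT
      have hℓc : ∀ i, ℓ (c i) = a * e i := fun i => by
        simpa [W, hT] using hℓ i
      have ha : a = 0 := by
        have := hℓc (false, ⟨1, Finset.mem_Icc.2 ⟨le_rfl, hn1⟩⟩)
        simpa [c, e, fieldDir, fieldShift] using this
      refine ⟨ha, ?_⟩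
      have h0 : ℓ.comp (Φ.symm : (Fin (2 * n) → ℝ) →L[ℝ] EuclideanSpace ℝ (Fin (2 * n))) = 0 :=
        eq_zero_of_forall_fieldDir
          (fun β j hj => by simpa [ha] using hℓc (β, ⟨j, hj⟩)) hT
      ext y
      simpa using congrArg (fun L : (Fin (2 * n) → ℝ) →L[ℝ] ℝ => L (Φ y)) h0
    · rw [hsq, Φ.apply_symm_apply]
      exact hDu p₀ hp₀
    · filter_upwards [hΩ] with y hy
      rw [hcurv, hcurv]
      exact hH _ hy
    · filter_upwards [hΩ] with y hy
      exact hge _ hy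
  have hmain : ∀ᶠ x in nhds p₀, v x = u x := by
    filter_upwards [Φ.symm.continuous.continuousAt.eventually key] with x hx
    simpa using hx
  obtain ⟨V, hV, hVo, hpV⟩ := eventually_nhds_iff.1 hmain
  exact ⟨V, hVo, hpV, hV⟩
end
end
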